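/- arXiv:2206.10752 — 2 statements merged into one kernel-verified Lean document; each statement's English description precedes it below -/
import Mathlib

section
/- Let G be a finite group that is minimally faithful of degree 3. Then G is solvable. -/
/-- `rdim G` is the smallest `n` such that `G` has a faithful `n`-dimensional
complex representation, i.e. an injective group homomorphism `G →* GL n ℂ`. -/
noncomputable def rdim (G : Type*) [Group G] : ℕ :=
  sInf {n : ℕ | ∃ ρ : G →* GL (Fin n) ℂ, Function.Injective ρ}

/-- `G` is minimally faithful of degree `n` if `rdim G = n` and every proper
subgroup has strictly smaller representation dimension. -/
def MinFaithful (G : Type*) [Group G] (n : ℕ) : Prop :=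
  rdim G = n ∧ ∀ H : Subgroup G, H ≠ ⊤ → rdim H < n


/-- finite-order operators: generalized eigenspaces are eigenspaces and span. -/
theorem semisimple_of_pow {V : Type*} [AddCommGroup V] [Module ℂ V] [FiniteDimensional ℂ V]
    (f : Module.End ℂ V) (k : ℕ) (hk : 0 < k) (h : f ^ k = 1) : f.IsSemisimple := by
  apply Module.End.isSemisimple_of_squarefree_aeval_eq_zero (p := Polynomial.X ^ k - 1)
  · have : (Polynomial.X ^ k - 1 : Polynomial ℂ).Separable := by
      have := Polynomial.separable_X_pow_sub_C (F := ℂ) (n := k) 1 (by exact_mod_cast hk.ne') one_ne_zero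
      simpa using this
    exact this.squarefree
  · simp [h]

theorem simdiag_aux {A V : Type*} [AddCommGroup V] [Module ℂ V] [FiniteDimensional ℂ V]
    (f : A → Module.End ℂ V) (hcomm : Pairwise fun a b => Commute (f a) (f b))
    (hss : ∀ a, (f a).IsSemisimple) {n : ℕ} (hn : Module.finrank ℂ V = n) :
    ∃ (B : Module.Basis (Fin n) ℂ V) (d : A → Fin n → ℂ), ∀ a j, f a (B j) = d a j • B j := by
  classical
  have htop : ⨆ χ : A → ℂ, ⨅ i, (f i).maxGenEigenspace (χ i) = ⊤ :=
    Module.End.iSup_iInf_maxGenEigenspace_eq_top_of_iSup_maxGenEigenspace_eq_top_of_commute f hcomm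
      (fun i => Module.End.iSup_maxGenEigenspace_eq_top _)
  have hind : iSupIndep fun χ : A → ℂ => ⨅ i, (f i).maxGenEigenspace (χ i) := by
    apply Module.End.independent_iInf_maxGenEigenspace_of_forall_mapsTo
    intro i j φ
    by_cases hij : i = j
    · subst hij
      exact Module.End.mapsTo_maxGenEigenspace_of_comm (Commute.refl _) _
    · exact Module.End.mapsTo_maxGenEigenspace_of_comm (hcomm (Ne.symm hij)) _
  have hinternal := DirectSum.isInternal_submodule_of_iSupIndep_of_iSup_eq_top hind htop
  let B := hinternal.collectedBasis (fun χ => Module.finBasis ℂ _)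
  have : Fintype (Σ χ : A → ℂ, Fin (Module.finrank ℂ ↥(⨅ i, (f i).maxGenEigenspace (χ i)))) :=
    FiniteDimensional.fintypeBasisIndex B
  have hcard : Fintype.card (Σ χ : A → ℂ, Fin (Module.finrank ℂ ↥(⨅ i, (f i).maxGenEigenspace (χ i)))) = Fintype.card (Fin n) := by
    rw [← Module.finrank_eq_card_basis B]; simp [hn]
  let e := Fintype.equivOfCardEq hcard
  refine ⟨B.reindex e, fun a j => (e.symm j).1 a, ?_⟩
  intro a j
  have hm : B.reindex e j ∈ ⨅ i, (f i).maxGenEigenspace ((e.symm j).1 i) := by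
    simp only [Module.Basis.reindex_apply]
    exact hinternal.collectedBasis_mem _ _
  rw [Submodule.mem_iInf] at hm
  have := hm a
  rw [(hss a).isFinitelySemisimple.maxGenEigenspace_eq_eigenspace, Module.End.mem_eigenspace_iff] at this
  exact this

theorem simdiag {A : Type*} [Group A] [Finite A] (hA : ∀ a b : A, a * b = b * a) {n : ℕ}
    (ρ : A →* GL (Fin n) ℂ) :
    ∃ (Q : GL (Fin n) ℂ) (d : A → Fin n → ℂ),
      ∀ a, ((ρ a : GL (Fin n) ℂ) : Matrix (Fin n) (Fin n) ℂ) * (Q : Matrix _ _ ℂ)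
        = (Q : Matrix _ _ ℂ) * Matrix.diagonal (d a) := by
  classical
  let f : A → Module.End ℂ (Fin n → ℂ) := fun a => Matrix.toLin' (ρ a : Matrix (Fin n) (Fin n) ℂ)
  have hcomm : Pairwise fun a b => Commute (f a) (f b) := by
    intro a b _
    show f a * f b = f b * f a
    simp only [f, Module.End.mul_eq_comp, ← Matrix.toLin'_mul, ← Units.val_mul, ← map_mul, hA a b]
  have hss : ∀ a, (f a).IsSemisimple := fun a => by
    apply semisimple_of_pow _ (Nat.card A) Nat.card_pos
    have : f a ^ Nat.card A = Matrix.toLin' ((ρ a : Matrix (Fin n) (Fin n) ℂ) ^ Nat.card A) := by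
      exact (Matrix.toLin'_pow _ _).symm
    rw [this, ← Units.val_pow_eq_pow_val, ← map_pow, pow_card_eq_one']
    simp
    rfl
  obtain ⟨B', d, hB⟩ := simdiag_aux f hcomm hss (n := n) (by simp)
  let std := Pi.basisFun ℂ (Fin n)
  refine ⟨⟨std.toMatrix B', B'.toMatrix std, by simp, by simp⟩, d, ?_⟩
  intro a
  ext i j
  have h := congrFun (hB a j) i
  simp only [f, Matrix.toLin'_apply] at h
  simp only [Matrix.mul_diagonal]
  rw [Matrix.mul_apply]
  simp only [Module.Basis.toMatrix_apply, std, Pi.basisFun_repr]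
  simp only [Matrix.mulVec, dotProduct, Pi.smul_apply, smul_eq_mul] at h
  rw [h, mul_comm]


/-- `gl G n`: the group has a faithful `n`-dimensional representation. -/
def EmbGL (G : Type*) [Group G] (n : ℕ) : Prop := ∃ f : G →* GL (Fin n) ℂ, Function.Injective f

/-- Key property: normalizers of abelian subgroups act through a group of order at most two. -/
def SP (G : Type*) [Group G] : Prop :=
  ∀ A : Subgroup G, (∀ x ∈ A, ∀ y ∈ A, x * y = y * x) → ∀ g h : G,
    (∀ x, x ∈ A ↔ g * x * g⁻¹ ∈ A) → (∀ x, x ∈ A ↔ h * x * h⁻¹ ∈ A) →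
    (∀ x ∈ A, g * x = x * g) ∨ (∀ x ∈ A, h * x = x * h) ∨ (∀ x ∈ A, (g * h) * x = x * (g * h))

theorem weights {G : Type*} [Group G] [Finite G] {n : ℕ} (ρ : G →* GL (Fin n) ℂ)
    (hρ : Function.Injective ρ) (A : Subgroup G) (hA : ∀ x ∈ A, ∀ y ∈ A, x * y = y * x) :
    ∃ d : G → Fin n → ℂ, (∀ x ∈ A, ∀ y ∈ A, d x = d y → x = y) ∧
      ∀ g, (∀ x, x ∈ A ↔ g * x * g⁻¹ ∈ A) → ∀ i, ∃ j, ∀ x ∈ A, d (g * x * g⁻¹) j = d x i := by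
  classical
  obtain ⟨Q, d, hd⟩ := simdiag (A := A) (fun a b => Subtype.ext (hA a a.2 b b.2)) (ρ.comp A.subtype)
  refine ⟨fun x => if h : x ∈ A then d ⟨x, h⟩ else 0, ?_, ?_⟩
  · intro x hx y hy h
    simp only [hx, hy, dif_pos] at h
    have h1 := hd ⟨x, hx⟩
    have h2 := hd ⟨y, hy⟩
    rw [h, ← h2] at h1
    have h3 : (ρ x) * Q = (ρ y) * Q := Units.ext (by simpa using h1)
    exact hρ (mul_right_cancel h3)
  · intro g hg i
    let M : GL (Fin n) ℂ := Q⁻¹ * ρ g * Q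
    have hM : ∃ j, (M : Matrix (Fin n) (Fin n) ℂ) j i ≠ 0 := by
      by_contra hcon
      push Not at hcon
      have h1 : ((M⁻¹ * M : GL (Fin n) ℂ) : Matrix (Fin n) (Fin n) ℂ) i i = 0 := by
        rw [Units.val_mul, Matrix.mul_apply]
        simp [hcon]
      simp at h1
    obtain ⟨j, hj⟩ := hM
    refine ⟨j, fun x hx => ?_⟩
    have hx' := (hg x).1 hx
    simp only [hx, hx', dif_pos]
    have h1 := hd ⟨x, hx⟩
    have h2 := hd ⟨_, hx'⟩
    simp only [MonoidHom.comp_apply, Subgroup.subtype_apply] at h1 h2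
    have hQ : (Q : Matrix (Fin n) (Fin n) ℂ) * (M : Matrix (Fin n) (Fin n) ℂ) = ((ρ g : GL (Fin n) ℂ) : Matrix (Fin n) (Fin n) ℂ) * (Q : Matrix (Fin n) (Fin n) ℂ) := by
      rw [← Units.val_mul, ← Units.val_mul]; congr 1; simp [M, mul_assoc]
    have h3 : Matrix.diagonal (d ⟨_, hx'⟩) * M.1 = M.1 * Matrix.diagonal (d ⟨x, hx⟩) := by
      have : (Q : Matrix (Fin n) (Fin n) ℂ) * (Matrix.diagonal (d ⟨_, hx'⟩) * (M : Matrix _ _ ℂ))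
          = Q.1 * (M.1 * Matrix.diagonal (d ⟨x, hx⟩)) := by
        rw [← mul_assoc, ← h2, mul_assoc, hQ, ← mul_assoc Q.1 M.1, hQ, mul_assoc (ρ g).1, ← h1]
        simp only [← Units.val_mul, ← mul_assoc, ← map_mul]
        simp
      have h4 := congrArg (fun N => ((Q⁻¹ : GL (Fin n) ℂ) : Matrix (Fin n) (Fin n) ℂ) * N) this
      simpa [← mul_assoc] using h4
    have h5 := congrFun (congrFun h3 j) i
    rw [Matrix.diagonal_mul, Matrix.mul_diagonal, mul_comm] at h5
    exact mul_left_cancel₀ hj h5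

theorem SP_of_GL2 {G : Type*} [Group G] [Finite G] (h2 : EmbGL G 2) : SP G := by
  obtain ⟨ρ, hρ⟩ := h2
  intro A hA
  obtain ⟨d, hinj, hd⟩ := weights ρ hρ A hA
  have key : ∀ g, (∀ x, x ∈ A ↔ g * x * g⁻¹ ∈ A) → (∀ x ∈ A, g * x = x * g) ∨
      (∀ x ∈ A, d (g * x * g⁻¹) 0 = d x 1 ∧ d (g * x * g⁻¹) 1 = d x 0) := by
    intro g hg
    have hc : (∀ x ∈ A, d (g * x * g⁻¹) 0 = d x 0 ∧ d (g * x * g⁻¹) 1 = d x 1) →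
        (∀ x ∈ A, g * x = x * g) := by
      intro h x hx
      have := hinj (g * x * g⁻¹) ((hg x).1 hx) x hx (by
        ext i; fin_cases i
        · exact (h x hx).1
        · exact (h x hx).2)
      rw [mul_inv_eq_iff_eq_mul] at this
      exact this
    obtain ⟨j0, h0⟩ := hd g hg 0
    obtain ⟨j1, h1⟩ := hd g hg 1
    fin_cases j0 <;> fin_cases j1 <;> simp only [Fin.zero_eta, Fin.mk_one, Fin.isValue] at h0 h1
    · left; apply hc
      have e : ∀ x ∈ A, d x 0 = d x 1 := fun x hx => by rw [← h0 x hx, h1 x hx]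
      intro x hx
      exact ⟨h0 x hx, by rw [← e _ ((hg x).1 hx), h1 x hx]⟩
    · left; apply hc; intro x hx; exact ⟨h0 x hx, h1 x hx⟩
    · right; intro x hx; exact ⟨h1 x hx, h0 x hx⟩
    · left; apply hc
      have e : ∀ x ∈ A, d x 0 = d x 1 := fun x hx => by rw [← h0 x hx, h1 x hx]
      intro x hx
      exact ⟨by rw [e _ ((hg x).1 hx), h0 x hx], h1 x hx⟩
  intro g h hg hh
  rcases key g hg with h1 | h1
  · exact Or.inl h1
  rcases key h hh with h2 | h2
  · exact Or.inr (Or.inl h2)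
  right; right
  intro x hx
  have hx' := (hh x).1 hx
  have hx'' := (hg _).1 hx'
  have : (g * h) * x * (g * h)⁻¹ = x := by
    have e : (g * h) * x * (g * h)⁻¹ = g * (h * x * h⁻¹) * g⁻¹ := by group
    rw [e]
    apply hinj _ hx'' _ hx
    ext i; fin_cases i
    · exact (h1 _ hx').1.trans (h2 x hx).2
    · exact (h1 _ hx').2.trans (h2 x hx).1
  rwa [mul_inv_eq_iff_eq_mul] at this

theorem perm_le3_solvable (S : Type*) [Finite S] (h : Nat.card S ≤ 3) : Group.IsSolvable (Equiv.Perm S) := by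
  have h3 : Group.IsSolvable (Equiv.Perm (Fin 3)) := by
    have : Group.IsSolvable (alternatingGroup (Fin 3)) := by
      have hc : Nat.card (alternatingGroup (Fin 3)) = 3 := by
        rw [Nat.card_eq_fintype_card]; decide
      have : Fact (Nat.Prime 3) := ⟨Nat.prime_three⟩
      have := isCyclic_of_prime_card hc
      let := IsCyclic.commGroup (α := alternatingGroup (Fin 3))
      infer_instance
    exact Group.isSolvable_of_ker_le_range (alternatingGroup (Fin 3)).subtype (Equiv.Perm.sign (α := Fin 3))
      (by intro x hx; simpa using! hx)
  have : Fintype S := Fintype.ofFinite S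
  have : Nonempty (S ↪ Fin 3) := by
    apply Function.Embedding.nonempty_of_card_le
    rw [← Nat.card_eq_fintype_card]; simpa using h
  obtain ⟨e⟩ := this
  exact Group.isSolvable_of_isSolvable_injective (Equiv.Perm.viaEmbeddingHom_injective e)

theorem perfect_hom_trivial {G H : Type*} [Group G] [Group H] (hG : commutator G = ⊤)
    [Group.IsSolvable H] (f : G →* H) (g : G) : f g = 1 := by
  by_contra hne
  have hnt : Nontrivial f.range := ⟨⟨⟨f g, g, rfl⟩, 1, fun h => hne (congrArg Subtype.val h)⟩⟩
  have hlt := Group.IsSolvable.commutator_lt_top_of_nontrivial f.range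
  apply hlt.ne
  have : Subgroup.map f.rangeRestrict (commutator G) = commutator f.range := by
    rw [commutator_def, Subgroup.map_commutator, commutator_def,
      Subgroup.map_top_of_surjective _ f.rangeRestrict_surjective]
  rw [← this, hG, Subgroup.map_top_of_surjective _ f.rangeRestrict_surjective]

/-- In a perfect subgroup of `GL₃`, normal abelian subgroups are central. -/
theorem normal_abelian_central {G : Type*} [Group G] [Finite G] (hG : commutator G = ⊤)
    (ρ : G →* GL (Fin 3) ℂ) (hρ : Function.Injective ρ) (A : Subgroup G)
    (hA : ∀ x ∈ A, ∀ y ∈ A, x * y = y * x) (hN : A.Normal) (g : G) (x : G) (hx : x ∈ A) :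
    g * x = x * g := by
  classical
  obtain ⟨d, hinj, hd⟩ := weights ρ hρ A hA
  let w : Fin 3 → (A → ℂ) := fun i a => d a i
  let S := Set.range w
  let cj : G → A → A := fun g a => ⟨g⁻¹ * a * g, by simpa using hN.conj_mem a a.2 g⁻¹⟩
  have hmem : ∀ (g : G) (s : A → ℂ), s ∈ S → (fun a => s (cj g a)) ∈ S := by
    rintro g _ ⟨i, rfl⟩
    obtain ⟨j, hj⟩ := hd g (fun x => ⟨fun hx => hN.conj_mem x hx g, fun hx => by
      have := hN.conj_mem _ hx g⁻¹
      simpa [mul_assoc] using this⟩) i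
    refine ⟨j, ?_⟩
    funext a
    have := hj _ (cj g a).2
    simp only [w, cj] at this ⊢
    rw [← this]
    congr 1
    group
  let act : MulAction G S :=
    { smul := fun g s => ⟨fun a => s.1 (cj g a), hmem g s.1 s.2⟩
      one_smul := by
        rintro ⟨s, hs⟩
        apply Subtype.ext
        funext a
        show s (cj 1 a) = s a
        congr 1
        apply Subtype.ext
        simp [cj]
      mul_smul := by
        rintro g h ⟨s, hs⟩
        apply Subtype.ext
        funext a
        show s (cj (g * h) a) = s (cj h (cj g a))
        congr 1
        apply Subtype.ext
        simp [cj, mul_assoc] }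
  have hfin : Finite S := Set.finite_range w
  have hcard : Nat.card S ≤ 3 := by
    have : Nat.card S ≤ Nat.card (Fin 3) := Nat.card_le_card_of_surjective (Set.rangeFactorization w)
      Set.rangeFactorization_surjective
    simpa using this
  have := perm_le3_solvable S hcard
  have htriv := perfect_hom_trivial hG (MulAction.toPermHom G S)
  have hfix : ∀ (g : G) (i : Fin 3) (a : A), w i (cj g a) = w i a := by
    intro g i a
    have h := congrArg (fun e : Equiv.Perm S => (e ⟨w i, i, rfl⟩ : S).1 a) (htriv g)
    exact h
  have h := hinj _ (cj g ⟨x, hx⟩).2 x hx (by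
    funext i
    exact hfix g i ⟨x, hx⟩)
  simp only [cj] at h
  have : g⁻¹ * x * g = x := h
  calc g * x = g * (g⁻¹ * x * g) := by rw [this]
    _ = x * g := by group

theorem EmbGL.sub {G H : Type*} [Group G] [Group H] {n : ℕ} (h : EmbGL G n) (f : H →* G)
    (hf : Function.Injective f) : EmbGL H n := by
  obtain ⟨r, hr⟩ := h
  exact ⟨r.comp f, hr.comp hf⟩

theorem SP_of_perfect {G : Type*} [Group G] [Finite G] (hG : commutator G = ⊤)
    (ρ : G →* GL (Fin 3) ℂ) (hρ : Function.Injective ρ)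
    (hsub : ∀ H : Subgroup G, H ≠ ⊤ → EmbGL H 2) : SP G := by
  intro A hA g h hg hh
  by_cases hN : Subgroup.normalizer (A : Set G) = ⊤
  · left
    have hn : A.Normal := Subgroup.normalizer_eq_top_iff.1 hN
    intro x hx
    exact normal_abelian_central hG ρ hρ A hA hn g x hx
  · have hs := SP_of_GL2 (hsub _ hN)
    have hg' : g ∈ Subgroup.normalizer (A : Set G) := Subgroup.mem_normalizer_iff.2 hg
    have hh' : h ∈ Subgroup.normalizer (A : Set G) := Subgroup.mem_normalizer_iff.2 hh
    have hle : A ≤ Subgroup.normalizer (A : Set G) := Subgroup.le_normalizer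
    have := hs (A.subgroupOf _) (fun x hx y hy => Subtype.ext (hA _ hx _ hy)) ⟨g, hg'⟩ ⟨h, hh'⟩
      (fun x => hg x.1) (fun x => hh x.1)
    rcases this with h1 | h1 | h1
    · left; intro x hx; exact congrArg Subtype.val (h1 ⟨x, hle hx⟩ hx)
    · right; left; intro x hx; exact congrArg Subtype.val (h1 ⟨x, hle hx⟩ hx)
    · right; right; intro x hx; exact congrArg Subtype.val (h1 ⟨x, hle hx⟩ hx)


theorem SP.sub {G : Type*} [Group G] (h : SP G) (H : Subgroup G) : SP H := by
  intro A hA g k hg hk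
  have aux : ∀ g : H, (∀ x, x ∈ A ↔ g * x * g⁻¹ ∈ A) →
      ∀ x : G, x ∈ A.map H.subtype ↔ (g : G) * x * (g : G)⁻¹ ∈ A.map H.subtype := by
    intro g hg x
    simp only [Subgroup.mem_map, Subgroup.subtype_apply]
    constructor
    · rintro ⟨y, hy, rfl⟩
      exact ⟨g * y * g⁻¹, (hg y).1 hy, by simp⟩
    · rintro ⟨y, hy, e⟩
      refine ⟨g⁻¹ * y * g, (hg _).2 (by simpa [mul_assoc] using hy), ?_⟩
      simp [e, mul_assoc]
  have := h (A.map H.subtype) (by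
    rintro _ ⟨x, hx, rfl⟩ _ ⟨y, hy, rfl⟩
    exact congrArg Subtype.val (hA x hx y hy)) g k (aux g hg) (aux k hk)
  have aux2 : ∀ g : H, (∀ x ∈ A.map H.subtype, (g : G) * x = x * g) → ∀ x ∈ A, g * x = x * g := by
    intro g hg x hx
    exact Subtype.ext (hg x ⟨x, hx, rfl⟩)
  rcases this with h1 | h1 | h1
  · exact Or.inl (aux2 g h1)
  · exact Or.inr (Or.inl (aux2 k h1))
  · exact Or.inr (Or.inr (aux2 (g * k) h1))

/-- odd order elements commute with whatever their square commutes with -/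
theorem comm_of_sq {G : Type*} [Group G] {g x : G} (ho : Odd (orderOf g))
    (h : (g * g) * x = x * (g * g)) : g * x = x * g := by
  obtain ⟨k, hk⟩ := ho
  have h1 : g = (g * g) ^ (k + 1) := by
    rw [← pow_two, ← pow_mul, show 2 * (k + 1) = orderOf g + 1 by omega, pow_succ, pow_orderOf_eq_one,
      one_mul]
  have h2 : Commute ((g * g) ^ (k + 1)) x := Commute.pow_left h _
  rw [← h1] at h2
  exact h2

theorem abelian_of_odd_pgroup {Q : Type*} [Group Q] [Finite Q] (h : SP Q) {p : ℕ} [hp : Fact p.Prime]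
    (hp2 : p ≠ 2) (hQ : IsPGroup p Q) : ∀ x y : Q, x * y = y * x := by
  have hodd : ∀ g : Q, Odd (orderOf g) := by
    intro g
    obtain ⟨k, hk⟩ := (IsPGroup.iff_orderOf.1 hQ) g
    rw [hk]
    exact (hp.out.odd_of_ne_two hp2).pow
  let S : Set (Subgroup Q) := {A | ∀ x ∈ A, ∀ y ∈ A, x * y = y * x}
  obtain ⟨A, hA⟩ := (Set.toFinite S).exists_maximal ⟨⊥, by
    intro x hx y hy
    rw [Subgroup.mem_bot] at hx hy
    simp [hx, hy]⟩
  have hAab : ∀ x ∈ A, ∀ y ∈ A, x * y = y * x := hA.prop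
  have hnil : Group.IsNilpotent Q := hQ.isNilpotent
  have hN : Subgroup.normalizer (A : Set Q) ≤ A := by
    intro g hg
    have hg' := Subgroup.mem_normalizer_iff.1 hg
    have hc : ∀ x ∈ A, g * x = x * g := by
      rcases h A hAab g g hg' hg' with h1 | h1 | h1
      · exact h1
      · exact h1
      · intro x hx; exact comm_of_sq (hodd g) (h1 x hx)
    have hle : Subgroup.closure (insert g (A : Set Q)) ∈ S := by
      have : ∀ x ∈ insert g (A : Set Q), ∀ y ∈ insert g (A : Set Q), x * y = y * x := by
        rintro x (rfl | hx) y (rfl | hy)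
        · rfl
        · exact hc y hy
        · exact (hc x hx).symm
        · exact hAab x hx y hy
      have := Subgroup.isMulCommutative_closure this
      intro x hx y hy
      exact congrArg Subtype.val (this.is_comm.comm ⟨x, hx⟩ ⟨y, hy⟩)
    have := hA.le_of_ge hle (fun x hx => Subgroup.subset_closure (Set.mem_insert_of_mem _ hx))
    exact this (Subgroup.subset_closure (Set.mem_insert _ _))
  have htop : A = ⊤ := by
    by_contra hne
    have := Group.normalizerCondition_of_isNilpotent (G := Q) A (lt_top_iff_ne_top.2 hne)
    exact absurd hN this.not_ge
  intro x y
  exact hAab x (htop ▸ Subgroup.mem_top x) y (htop ▸ Subgroup.mem_top y)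

open scoped IsMulCommutative in
theorem fix_trivial {G : Type*} [Group G] [Finite G] (hG : commutator G = ⊤) {p : ℕ} [hp : Fact p.Prime]
    (P : Sylow p G) (hab : ∀ x ∈ P, ∀ y ∈ P, x * y = y * x) (x : G) (hx : x ∈ P)
    (hc : ∀ g ∈ Subgroup.normalizer (P : Set G), g * x = x * g) : x = 1 := by
  have hcomm : IsMulCommutative P := ⟨⟨fun a b => Subtype.ext (hab _ a.2 _ b.2)⟩⟩
  have key : ∀ (k : ℕ) (g₀ : G), g₀⁻¹ * x ^ k * g₀ ∈ (P : Subgroup G) → g₀⁻¹ * x ^ k * g₀ = x ^ k := by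
    intro k g₀ h
    obtain ⟨n, hn, h⟩ := P.conj_eq_normalizer_conj_of_mem (x ^ k) g₀ (P.pow_mem hx k) h
    rw [h]
    have h1 : Commute n x := hc n hn
    have h2 : n * x ^ k = x ^ k * n := h1.pow_right k
    rw [mul_assoc, ← h2]; simp
  have h1 := MonoidHom.transfer_eq_pow (MonoidHom.id (P : Subgroup G)) x key
  rw [perfect_hom_trivial hG] at h1
  have h2 : x ^ (P : Subgroup G).index = 1 := (congrArg Subtype.val h1).symm
  have h3 := P.not_dvd_index
  obtain ⟨k, hk⟩ := (IsPGroup.iff_orderOf.1 P.2) ⟨x, hx⟩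
  have h4 : orderOf x ∣ (P : Subgroup G).index := orderOf_dvd_of_pow_eq_one h2
  rw [Subgroup.orderOf_mk] at hk
  have : k = 0 := by
    by_contra hk0
    exact h3 ((dvd_pow_self p hk0).trans (hk ▸ h4))
  rw [this, pow_zero, orderOf_eq_one_iff] at hk
  exact hk

section
variable {G : Type*} [Group G] [Finite G]
theorem sylow_abelian (hS : SP G) {p : ℕ} [hp : Fact p.Prime] (hp2 : p ≠ 2)
    (P : Sylow p G) : ∀ x ∈ P, ∀ y ∈ P, x * y = y * x := by
  intro x hx y hy
  exact congrArg Subtype.val (abelian_of_odd_pgroup (hS.sub P) hp2 P.2 ⟨x, hx⟩ ⟨y, hy⟩)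

theorem sylow_fix (hG : commutator G = ⊤) (hS : SP G) {p : ℕ} [hp : Fact p.Prime]
    (P : Sylow p G) (hab : ∀ x ∈ P, ∀ y ∈ P, x * y = y * x) (s : G)
    (hs : s ∈ Subgroup.normalizer (P : Set G)) (hsc : ¬ ∀ x ∈ P, s * x = x * s)
    (x : G) (hx : x ∈ P) (hc : s * x = x * s) : x = 1 := by
  apply fix_trivial hG P hab x hx
  intro g hg
  rcases hS P hab g s (Subgroup.mem_normalizer_iff.1 hg) (Subgroup.mem_normalizer_iff.1 hs) with h1 | h1 | h1
  · exact h1 x hx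
  · exact absurd h1 hsc
  · have h2 := h1 x hx
    have h3 : g * x * s = x * g * s := by
      rw [mul_assoc, ← hc, ← mul_assoc, h2, mul_assoc]
    exact mul_right_cancel h3

theorem sylow_inv (hG : commutator G = ⊤) (hS : SP G) {p : ℕ} [hp : Fact p.Prime]
    (P : Sylow p G) (hab : ∀ x ∈ P, ∀ y ∈ P, x * y = y * x) (s : G)
    (hs : s ∈ Subgroup.normalizer (P : Set G)) (hsc : ¬ ∀ x ∈ P, s * x = x * s)
    (x : G) (hx : x ∈ P) : s * x * s⁻¹ = x⁻¹ := by
  have hs' := Subgroup.mem_normalizer_iff.1 hs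
  have hy : s * x * s⁻¹ ∈ P := (hs' x).1 hx
  have hss : (s * s) * x = x * (s * s) := by
    rcases hS P hab s s hs' hs' with h1 | h1 | h1
    · exact absurd h1 hsc
    · exact absurd h1 hsc
    · exact h1 x hx
  have := sylow_fix hG hS P hab s hs hsc (x * (s * x * s⁻¹)) (P.mul_mem hx hy) (by
    have h2 : s * (s * x * s⁻¹) * s⁻¹ = x := by
      have : s * (s * x * s⁻¹) * s⁻¹ = (s * s) * x * (s * s)⁻¹ := by group
      rw [this, hss]; group
    calc s * (x * (s * x * s⁻¹)) = (s * x * s⁻¹) * (s * (s * x * s⁻¹) * s⁻¹) * s := by group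
      _ = (s * x * s⁻¹) * x * s := by rw [h2]
      _ = x * (s * x * s⁻¹) * s := by rw [hab _ hy _ hx])
  exact (eq_inv_of_mul_eq_one_right this)

theorem exists_noncentral (hG : commutator G = ⊤) (hS : SP G) {p : ℕ} [hp : Fact p.Prime]
    (P : Sylow p G) (hab : ∀ x ∈ P, ∀ y ∈ P, x * y = y * x) (hpd : p ∣ Nat.card G) :
    ∃ s ∈ Subgroup.normalizer (P : Set G), ¬ ∀ x ∈ P, s * x = x * s := by
  by_contra hcon
  push Not at hcon
  have : (P : Subgroup G) = ⊥ := by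
    rw [eq_bot_iff]
    intro x hx
    rw [Subgroup.mem_bot]
    exact fix_trivial hG P hab x hx (fun g hg => hcon g hg x hx)
  have h2 := P.ne_bot_of_dvd_card hpd
  exact h2 this

theorem two_dvd_card (hG : commutator G = ⊤) (hS : SP G) [Nontrivial G] : 2 ∣ Nat.card G := by
  obtain ⟨p, hp, hpd⟩ := Nat.exists_prime_and_dvd (Finite.one_lt_card (α := G)).ne'
  by_cases h2 : p = 2
  · exact h2 ▸ hpd
  have : Fact p.Prime := ⟨hp⟩
  let P : Sylow p G := default
  have hab := sylow_abelian hS h2 P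
  obtain ⟨s, hs, hsc⟩ := exists_noncentral hG hS P hab hpd
  by_contra hodd
  apply hsc
  have hs' := Subgroup.mem_normalizer_iff.1 hs
  have ho : Odd (orderOf s) := by
    rw [← Nat.not_even_iff_odd, even_iff_two_dvd]
    exact fun h => hodd (h.trans (orderOf_dvd_natCard s))
  rcases hS P hab s s hs' hs' with h1 | h1 | h1
  · exact h1
  · exact h1
  · intro x hx; exact comm_of_sq ho (h1 x hx)
end


theorem det_one_of_perfect {G : Type*} [Group G] (hG : commutator G = ⊤) {n : ℕ}
    (ρ : G →* GL (Fin n) ℂ) (g : G) : (ρ g).1.det = 1 := by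
  have := perfect_hom_trivial hG ((Matrix.GeneralLinearGroup.det (n := Fin n) (R := ℂ)).comp ρ) g
  simpa using congrArg Units.val this

theorem diag_pow {G : Type*} [Group G] {n : ℕ} (ρ : G →* GL (Fin n) ℂ) {Q : GL (Fin n) ℂ} {x : G}
    {d : Fin n → ℂ} (h : (ρ x).1 * Q.1 = Q.1 * Matrix.diagonal d) (k : ℕ) :
    (ρ (x ^ k)).1 * Q.1 = Q.1 * Matrix.diagonal (fun i => d i ^ k) := by
  induction k with
  | zero => simp
  | succ k ih =>
    rw [pow_succ, map_mul, Units.val_mul, mul_assoc, h, ← mul_assoc, ih, mul_assoc,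
      Matrix.diagonal_mul_diagonal]
    simp [pow_succ]

theorem diag_inj {G : Type*} [Group G] {n : ℕ} (ρ : G →* GL (Fin n) ℂ) (hρ : Function.Injective ρ)
    {Q : GL (Fin n) ℂ} {x y : G} {d : Fin n → ℂ} (hx : (ρ x).1 * Q.1 = Q.1 * Matrix.diagonal d)
    (hy : (ρ y).1 * Q.1 = Q.1 * Matrix.diagonal d) : x = y := by
  rw [← hy] at hx
  have h3 : (ρ x) * Q = (ρ y) * Q := Units.ext (by simpa using hx)
  exact hρ (mul_right_cancel h3)

theorem diag_congr {n : ℕ} {Q : GL (Fin n) ℂ} {M : Matrix (Fin n) (Fin n) ℂ} {d e : Fin n → ℂ}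
    (hx : M * Q.1 = Q.1 * Matrix.diagonal d) (hy : M * Q.1 = Q.1 * Matrix.diagonal e) : d = e := by
  rw [hx] at hy
  have := congrArg (fun N => ((Q⁻¹ : GL (Fin n) ℂ) : Matrix (Fin n) (Fin n) ℂ) * N) hy
  simp only [← mul_assoc, ← Units.val_mul, inv_mul_cancel] at this
  simpa using Matrix.diagonal_injective (by simpa using this)

theorem diag_one {G : Type*} [Group G] {n : ℕ} (ρ : G →* GL (Fin n) ℂ) (Q : GL (Fin n) ℂ) :
    (ρ 1).1 * Q.1 = Q.1 * Matrix.diagonal (fun _ => 1) := by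
  simp

theorem diag_mul {G : Type*} [Group G] {n : ℕ} (ρ : G →* GL (Fin n) ℂ) {Q : GL (Fin n) ℂ} {x y : G}
    {d e : Fin n → ℂ} (hx : (ρ x).1 * Q.1 = Q.1 * Matrix.diagonal d)
    (hy : (ρ y).1 * Q.1 = Q.1 * Matrix.diagonal e) :
    (ρ (x * y)).1 * Q.1 = Q.1 * Matrix.diagonal (fun i => d i * e i) := by
  rw [map_mul, Units.val_mul, mul_assoc, hy, ← mul_assoc, hx, mul_assoc,
      Matrix.diagonal_mul_diagonal]

theorem diag_root {G : Type*} [Group G] {n : ℕ} (ρ : G →* GL (Fin n) ℂ) {Q : GL (Fin n) ℂ} {x : G}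
    {d : Fin n → ℂ} (h : (ρ x).1 * Q.1 = Q.1 * Matrix.diagonal d) {k : ℕ} (hk : x ^ k = 1) (i : Fin n) :
    d i ^ k = 1 := by
  have h1 := diag_pow ρ h k
  rw [hk] at h1
  exact congrFun (diag_congr h1 (diag_one ρ Q)) i

theorem diag_det {n : ℕ} {Q : GL (Fin n) ℂ} {M : Matrix (Fin n) (Fin n) ℂ} {d : Fin n → ℂ}
    (h : M * Q.1 = Q.1 * Matrix.diagonal d) : M.det = ∏ i, d i := by
  have h1 := congrArg Matrix.det h
  rw [Matrix.det_mul, Matrix.det_mul, Matrix.det_diagonal, mul_comm] at h1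
  exact mul_left_cancel₀ (Matrix.GeneralLinearGroup.det Q).ne_zero h1

theorem diag_trace {n : ℕ} {Q : GL (Fin n) ℂ} {M : Matrix (Fin n) (Fin n) ℂ} {d : Fin n → ℂ}
    (h : M * Q.1 = Q.1 * Matrix.diagonal d) : M.trace = ∑ i, d i := by
  have h1 : M = Q.1 * Matrix.diagonal d * (Q⁻¹).1 := by
    rw [← h, mul_assoc, ← Units.val_mul]; simp
  rw [h1, Matrix.trace_mul_comm, ← mul_assoc, ← Units.val_mul]
  simp [Matrix.trace]

theorem diag_sub {n : ℕ} {Q : GL (Fin n) ℂ} {M : Matrix (Fin n) (Fin n) ℂ} {d : Fin n → ℂ}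
    (h : M * Q.1 = Q.1 * Matrix.diagonal d) :
    (M - 1) * Q.1 = Q.1 * Matrix.diagonal (fun i => d i - 1) := by
  rw [← Matrix.diagonal_sub, mul_sub, sub_mul, h]; simp

theorem diag_exists {G : Type*} [Group G] [Finite G] {n : ℕ} (ρ : G →* GL (Fin n) ℂ) (x : G) :
    ∃ (Q : GL (Fin n) ℂ) (d : Fin n → ℂ), (ρ x).1 * Q.1 = Q.1 * Matrix.diagonal d := by
  obtain ⟨Q, d, hd⟩ := simdiag (A := Subgroup.zpowers x)
    (fun a b => (inferInstance : IsMulCommutative (Subgroup.zpowers x)).is_comm.comm a b)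
    (ρ.comp (Subgroup.zpowers x).subtype)
  exact ⟨Q, d ⟨x, Subgroup.mem_zpowers x⟩, hd ⟨x, Subgroup.mem_zpowers x⟩⟩

/-- anything commuting with a family of diagonal matrices separating the indices is diagonal -/
theorem diag_of_comm {n : ℕ} {Q M : GL (Fin n) ℂ}
    (h : ∀ i j, i ≠ j → ∃ (N : Matrix (Fin n) (Fin n) ℂ) (d : Fin n → ℂ),
      N * Q.1 = Q.1 * Matrix.diagonal d ∧ d i ≠ d j ∧ M.1 * N = N * M.1) :
    ∃ e : Fin n → ℂ, M.1 * Q.1 = Q.1 * Matrix.diagonal e := by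
  let R : GL (Fin n) ℂ := Q⁻¹ * M * Q
  have hQR : Q.1 * R.1 = M.1 * Q.1 := by
    rw [← Units.val_mul, ← Units.val_mul]; congr 1; simp [R, mul_assoc]
  refine ⟨fun i => R.1 i i, ?_⟩
  rw [← hQR]
  congr 1
  ext i j
  by_cases hij : i = j
  · subst hij; simp
  rw [Matrix.diagonal_apply_ne _ hij]
  obtain ⟨N, d, hd, hne, hc⟩ := h i j hij
  have h3 : R.1 * Matrix.diagonal d = Matrix.diagonal d * R.1 := by
    have : Q.1 * (R.1 * Matrix.diagonal d) = Q.1 * (Matrix.diagonal d * R.1) := by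
      rw [← mul_assoc, hQR, mul_assoc, ← hd, ← mul_assoc, hc, mul_assoc, ← hQR, ← mul_assoc, hd, mul_assoc]
    have h4 := congrArg (fun N => ((Q⁻¹ : GL (Fin n) ℂ) : Matrix (Fin n) (Fin n) ℂ) * N) this
    simpa [← mul_assoc] using h4
  have h5 := congrFun (congrFun h3 i) j
  rw [Matrix.diagonal_mul, Matrix.mul_diagonal, mul_comm] at h5
  by_contra h0
  exact hne (mul_right_cancel₀ h0 h5).symm

theorem odd_root_eq_one {d : ℂ} {k : ℕ} (hk : Odd k) (h : d ^ k = 1) (h2 : d * d = 1) : d = 1 := by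
  obtain ⟨m, rfl⟩ := hk
  rw [pow_succ, pow_mul, pow_two, h2] at h
  simpa using h

/-- an inverted odd order element has distinct eigenvalues, one of them 1 -/
theorem inverted_diag {G : Type*} [Group G] [Finite G] (ρ : G →* GL (Fin 3) ℂ)
    (hρ : Function.Injective ρ) (hdet : ∀ g, (ρ g).1.det = 1) {x t : G} (hx : x ≠ 1)
    (ho : Odd (orderOf x)) (ht : t * x * t⁻¹ = x⁻¹) :
    ∃ (Q : GL (Fin 3) ℂ) (d : Fin 3 → ℂ), (ρ x).1 * Q.1 = Q.1 * Matrix.diagonal d ∧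
      (∀ i j, i ≠ j → d i ≠ d j) ∧ ∃ i, d i = 1 := by
  obtain ⟨Q, d, hd⟩ := diag_exists ρ x
  have h0 : ((ρ x).1 - 1).det = 0 := by
    have h1 : ((ρ x⁻¹).1 - 1).det = ((ρ x).1 - 1).det := by
      have : (ρ x⁻¹).1 - 1 = (ρ t).1 * ((ρ x).1 - 1) * (ρ t⁻¹).1 := by
        rw [← ht, mul_sub, sub_mul, mul_one, ← Units.val_mul (ρ t) (ρ t⁻¹), ← map_mul, map_mul, map_mul]
        simp
      rw [this, Matrix.det_mul, Matrix.det_mul, hdet, hdet]; simp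
    have h2 : (ρ x⁻¹).1 - 1 = (ρ x⁻¹).1 * (-((ρ x).1 - 1)) := by
      rw [neg_sub, mul_sub, mul_one, ← Units.val_mul, ← map_mul]; simp
    rw [h2, Matrix.det_mul, hdet, Matrix.det_neg] at h1
    simp at h1
    have h3 : (2 : ℂ) * ((ρ x).1 - 1).det = 0 := by linear_combination -h1
    simpa using h3
  rw [diag_det (diag_sub hd), Fin.prod_univ_three] at h0
  have h1 := hdet x
  rw [diag_det hd, Fin.prod_univ_three] at h1
  have hr := fun i => diag_root ρ hd (pow_orderOf_eq_one x) i
  have hall : ¬ (d 0 = 1 ∧ d 1 = 1 ∧ d 2 = 1) := by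
    rintro ⟨a, b, c⟩
    apply hx
    apply diag_inj ρ hρ hd
    rw [show d = fun _ => 1 by funext i; fin_cases i <;> assumption]
    exact diag_one ρ Q
  have o := fun i => odd_root_eq_one ho (hr i)
  have key : ∀ a b c : ℂ, a = 1 → a * b * c = 1 → (b * b = 1 → b = 1) → (¬ (a = 1 ∧ b = 1 ∧ c = 1)) →
      a ≠ b ∧ a ≠ c ∧ b ≠ c := by
    intro a b c ha h hb hn
    subst ha
    refine ⟨?_, ?_, ?_⟩
    · rintro rfl; simp at h; simp [h] at hn
    · rintro rfl; simp at h; simp [h] at hn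
    · rintro rfl
      simp at h; have := hb h; simp [this] at hn
  have fin : (d 0 ≠ d 1 ∧ d 0 ≠ d 2 ∧ d 1 ≠ d 2) ∧ ∃ i, d i = 1 := by
    rcases mul_eq_zero.1 h0 with h0 | h0
    · rcases mul_eq_zero.1 h0 with h0 | h0
      · have h0 := sub_eq_zero.1 h0
        exact ⟨key _ _ _ h0 h1 (o 1) hall, 0, h0⟩
      · have h0 := sub_eq_zero.1 h0
        have := key _ _ _ h0 (by rw [← h1]; ring : d 1 * d 0 * d 2 = 1) (o 0) (by tauto)
        exact ⟨⟨this.1.symm, this.2.2, this.2.1⟩, 1, h0⟩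
    · have h0 := sub_eq_zero.1 h0
      have := key _ _ _ h0 (by rw [← h1]; ring : d 2 * d 0 * d 1 = 1) (o 0) (by tauto)
      exact ⟨⟨this.2.2, this.1.symm, this.2.1.symm⟩, 2, h0⟩
  refine ⟨Q, d, hd, ?_, fin.2⟩
  obtain ⟨⟨a, b, c⟩, -⟩ := fin
  intro i j hij
  fin_cases i <;> fin_cases j <;> first | exact absurd rfl hij | assumption | exact Ne.symm ‹_›

theorem inverted_comm_diag {G : Type*} [Group G] (ρ : G →* GL (Fin 3) ℂ)
    {x y : G} {Q : GL (Fin 3) ℂ} {d : Fin 3 → ℂ} (hd : (ρ x).1 * Q.1 = Q.1 * Matrix.diagonal d)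
    (hinj : ∀ i j, i ≠ j → d i ≠ d j) (hc : y * x = x * y) :
    ∃ e : Fin 3 → ℂ, (ρ y).1 * Q.1 = Q.1 * Matrix.diagonal e := by
  apply diag_of_comm
  intro i j hij
  refine ⟨_, d, hd, hinj i j hij, ?_⟩
  rw [← Units.val_mul, ← map_mul, hc, map_mul, Units.val_mul]

theorem diag_comm {G : Type*} [Group G] {n : ℕ} (ρ : G →* GL (Fin n) ℂ) (hρ : Function.Injective ρ)
    {Q : GL (Fin n) ℂ} {x y : G} {d e : Fin n → ℂ} (hx : (ρ x).1 * Q.1 = Q.1 * Matrix.diagonal d)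
    (hy : (ρ y).1 * Q.1 = Q.1 * Matrix.diagonal e) : x * y = y * x := by
  apply diag_inj ρ hρ (diag_mul ρ hx hy)
  convert diag_mul ρ hy hx using 4
  ring

/-- (F): centralizers of nontrivial odd order elements are abelian -/
theorem centralizer_abelian {G : Type*} [Group G] [Finite G] (hG : commutator G = ⊤) (hS : SP G)
    (ρ : G →* GL (Fin 3) ℂ) (hρ : Function.Injective ρ) (v : G) (hv : v ≠ 1) (ho : Odd (orderOf v))
    (x y : G) (hx : x * v = v * x) (hy : y * v = v * y) : x * y = y * x := by
  have hov : orderOf v ≠ 1 := fun h => hv (orderOf_eq_one_iff.1 h)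
  obtain ⟨p, hp, hpd⟩ := Nat.exists_prime_and_dvd hov
  have : Fact p.Prime := ⟨hp⟩
  have hp2 : p ≠ 2 := by
    rintro rfl
    exact (Nat.not_even_iff_odd.2 ho) (even_iff_two_dvd.2 hpd)
  obtain ⟨m, hm⟩ := hpd
  have hu : orderOf (v ^ m) = p := by
    have hm0 : m ≠ 0 := by rintro rfl; exact (orderOf_pos v).ne' (by simpa using hm)
    rw [orderOf_pow_of_dvd hm0 ⟨p, by rw [hm]; ring⟩, hm]
    exact Nat.mul_div_cancel _ (Nat.pos_of_ne_zero hm0)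
  have hu1 : v ^ m ≠ 1 := by
    intro h; rw [h, orderOf_one] at hu; exact hp.one_lt.ne hu
  have hpg : IsPGroup p (Subgroup.zpowers (v ^ m)) := by
    apply IsPGroup.of_card (n := 1); rw [Nat.card_zpowers, hu, pow_one]
  obtain ⟨P, hP⟩ := hpg.exists_le_sylow
  have hab := sylow_abelian hS hp2 P
  have hpG : p ∣ Nat.card G := hu ▸ orderOf_dvd_natCard _
  obtain ⟨s, hs, hsc⟩ := exists_noncentral hG hS P hab hpG
  have hinv := sylow_inv hG hS P hab s hs hsc (v ^ m) (hP (Subgroup.mem_zpowers _))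
  obtain ⟨Q, d, hd, hdi, -⟩ := inverted_diag ρ hρ (det_one_of_perfect hG ρ) hu1
    (by rw [hu]; exact hp.odd_of_ne_two hp2) hinv
  obtain ⟨e, he⟩ := inverted_comm_diag ρ hd hdi (y := x) (Commute.pow_right hx m)
  obtain ⟨f, hf⟩ := inverted_comm_diag ρ hd hdi (y := y) (Commute.pow_right hy m)
  exact diag_comm ρ hρ he hf


theorem invol_diag {G : Type*} [Group G] (ρ : G →* GL (Fin 3) ℂ)
    (hρ : Function.Injective ρ) (hdet : ∀ g, (ρ g).1.det = 1) {x : G} (hx : x ≠ 1) (h2 : x * x = 1)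
    {Q : GL (Fin 3) ℂ} {d : Fin 3 → ℂ} (hd : (ρ x).1 * Q.1 = Q.1 * Matrix.diagonal d) :
    ∃ k, d = fun i => if i = k then 1 else -1 := by
  have h1 := hdet x
  rw [diag_det hd, Fin.prod_univ_three] at h1
  have hr : ∀ i, d i = 1 ∨ d i = -1 := fun i => by
    have := diag_root ρ hd (k := 2) (by rw [pow_two, h2]) i
    exact sq_eq_one_iff.1 this
  have hall : ¬ (d 0 = 1 ∧ d 1 = 1 ∧ d 2 = 1) := by
    rintro ⟨a, b, c⟩
    apply hx
    apply diag_inj ρ hρ hd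
    rw [show d = fun _ => 1 by funext i; fin_cases i <;> assumption]
    exact diag_one ρ Q
  rcases hr 0 with a | a <;> rcases hr 1 with b | b <;> rcases hr 2 with c | c <;>
    first | exact (hall (And.intro a (And.intro b c))).elim | (exfalso; rw [a, b, c] at h1; norm_num at h1; done) | skip
  · exact ⟨0, by funext i; fin_cases i <;> simp [a, b, c]⟩
  · exact ⟨1, by funext i; fin_cases i <;> simp [a, b, c]⟩
  · exact ⟨2, by funext i; fin_cases i <;> simp [a, b, c]⟩

theorem invol_trace {G : Type*} [Group G] [Finite G] (ρ : G →* GL (Fin 3) ℂ)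
    (hρ : Function.Injective ρ) (hdet : ∀ g, (ρ g).1.det = 1) {x : G} (hx : x ≠ 1) (h2 : x * x = 1) :
    (ρ x).1.trace = -1 := by
  obtain ⟨Q, d, hd⟩ := diag_exists ρ x
  obtain ⟨k, hk⟩ := invol_diag ρ hρ hdet hx h2 hd
  rw [diag_trace hd, hk, Fin.sum_univ_three]
  fin_cases k <;> simp

theorem klein {G : Type*} [Group G] [Finite G] (ρ : G →* GL (Fin 3) ℂ)
    (hρ : Function.Injective ρ) (hdet : ∀ g, (ρ g).1.det = 1) {z w : G} (hz : z ≠ 1) (hw : w ≠ 1)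
    (hzw : z ≠ w) (hz2 : z * z = 1) (hw2 : w * w = 1) (hc : z * w = w * z) :
    (∀ x y, x * z = z * x → x * w = w * x → y * z = z * y → y * w = w * y → x * y = y * x) ∧
    (∀ y, y * z = z * y → y * w = w * y → y * y = 1 → y ≠ 1 → y = z ∨ y = w ∨ y = z * w) := by
  have hcl : ∀ x ∈ ({z, w} : Set G), ∀ y ∈ ({z, w} : Set G), x * y = y * x := by
    rintro x (rfl | rfl) y (rfl | rfl)
    · rfl
    · exact hc
    · exact hc.symm
    · rfl
  have hcomm := Subgroup.isMulCommutative_closure hcl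
  obtain ⟨Q, d, hd⟩ := simdiag (A := Subgroup.closure {z, w})
    (fun a b => hcomm.is_comm.comm a b) (ρ.comp (Subgroup.subtype _))
  have hdz := hd ⟨z, Subgroup.subset_closure (by simp)⟩
  have hdw := hd ⟨w, Subgroup.subset_closure (by simp)⟩
  generalize d ⟨z, _⟩ = dz at hdz
  generalize d ⟨w, _⟩ = dw at hdw
  simp only [MonoidHom.comp_apply, Subgroup.subtype_apply] at hdz hdw
  obtain ⟨k, rfl⟩ := invol_diag ρ hρ hdet hz hz2 hdz
  obtain ⟨l, rfl⟩ := invol_diag ρ hρ hdet hw hw2 hdw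
  have hkl : k ≠ l := by
    rintro rfl
    exact hzw (diag_inj ρ hρ hdz hdw)
  have hdg : ∀ y, y * z = z * y → y * w = w * y →
      ∃ e : Fin 3 → ℂ, (ρ y).1 * Q.1 = Q.1 * Matrix.diagonal e := by
    intro y hyz hyw
    apply diag_of_comm
    intro i j hij
    by_cases hk : i = k ∨ j = k
    · refine ⟨_, _, hdz, ?_, ?_⟩
      · rcases hk with rfl | rfl
        · simp [hij.symm]; norm_num
        · simp [hij]; norm_num
      · rw [← Units.val_mul, ← map_mul, hyz, map_mul, Units.val_mul]
    · have hl : i = l ∨ j = l := by omega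
      refine ⟨_, _, hdw, ?_, ?_⟩
      · rcases hl with rfl | rfl
        · simp [hij.symm]; norm_num
        · simp [hij]; norm_num
      · rw [← Units.val_mul, ← map_mul, hyw, map_mul, Units.val_mul]
  constructor
  · intro x y h1 h2 h3 h4
    obtain ⟨e, he⟩ := hdg x h1 h2
    obtain ⟨f, hf⟩ := hdg y h3 h4
    exact diag_comm ρ hρ he hf
  · intro y h1 h2 h3 h4
    obtain ⟨e, he⟩ := hdg y h1 h2
    obtain ⟨m, rfl⟩ := invol_diag ρ hρ hdet h4 h3 he
    by_cases hmk : m = k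
    · subst hmk; left; exact diag_inj ρ hρ he hdz
    by_cases hml : m = l
    · subst hml; right; left; exact diag_inj ρ hρ he hdw
    right; right
    apply diag_inj ρ hρ he
    convert diag_mul ρ hdz hdw using 4 with i
    rcases (by omega : i = m ∨ i = k ∨ i = l) with rfl | rfl | rfl
    · simp [hmk, hml]
    · simp [hkl, Ne.symm hmk]
    · simp [hkl.symm, Ne.symm hml]

/-- If an abelian Sylow 2-subgroup exists then it is trivial -/
theorem sylow2_trivial {G : Type*} [Group G] [Finite G] (hG : commutator G = ⊤) (hS : SP G)
    (P : Sylow 2 G) (hab : ∀ x ∈ P, ∀ y ∈ P, x * y = y * x) (x : G) (hx : x ∈ P) : x = 1 := by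
  apply fix_trivial hG P hab x hx
  intro g hg
  have hg' := Subgroup.mem_normalizer_iff.1 hg
  rcases hS P hab g g hg' hg' with h1 | h1 | h1
  · exact h1 x hx
  · exact h1 x hx
  have h1 := h1 x hx
  obtain ⟨a, m, hm, hor⟩ := Nat.exists_eq_two_pow_mul_odd (orderOf_pos g).ne'
  have hgm : g ^ m ∈ P := by
    have hpg : IsPGroup 2 (Subgroup.zpowers (g ^ m)) := by
      rw [IsPGroup.iff_orderOf]
      rintro ⟨y, hy⟩
      rw [Subgroup.orderOf_mk]
      have h3 : orderOf y ∣ 2 ^ a := by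
        refine (orderOf_dvd_of_mem_zpowers hy).trans ?_
        rw [orderOf_dvd_iff_pow_eq_one, ← pow_mul, mul_comm m, ← hor, pow_orderOf_eq_one]
      obtain ⟨k, -, hk⟩ := (Nat.dvd_prime_pow Nat.prime_two).1 h3
      exact ⟨k, hk⟩
    have h4 := hpg.inf_normalizer_sylow P
    have h5 : g ^ m ∈ Subgroup.zpowers (g ^ m) ⊓ Subgroup.normalizer (P : Set G) :=
      ⟨Subgroup.mem_zpowers _, Subgroup.pow_mem _ hg m⟩
    rw [h4] at h5
    exact h5.2
  have h6 : Commute (g ^ m) x := hab _ hgm _ hx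
  obtain ⟨k, rfl⟩ := hm
  have h7 : Commute ((g * g) ^ k) x := Commute.pow_left h1 k
  have h8 : g = ((g * g) ^ k)⁻¹ * g ^ (2 * k + 1) := by
    rw [← pow_two, ← pow_mul, pow_succ]; simp
  have h9 : Commute (((g * g) ^ k)⁻¹ * g ^ (2 * k + 1)) x := (h7.inv_left).mul_left h6
  rw [← h8] at h9
  exact h9


theorem swap_aux {G : Type*} [Group G] [Finite G] (hG : commutator G = ⊤) (hS : SP G)
    {z w : G} (hz : z ≠ 1) (hw : w ≠ 1)
    (hzw : z ≠ w) (hz2 : z * z = 1) (hw2 : w * w = 1) (hc : z * w = w * z)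
    (hK1 : ∀ x y, x * z = z * x → x * w = w * x → y * z = z * y → y * w = w * y → x * y = y * x)
    (hK2 : ∀ y, y * z = z * y → y * w = w * y → y * y = 1 → y ≠ 1 → y = z ∨ y = w ∨ y = z * w)
    (P : Sylow 2 G) (hP : ∀ x ∈ P, x * z = z * x) :
    ∃ s, s * z = z * s ∧ s * w * s⁻¹ = z * w := by
  let D : Subgroup G :=
    { carrier := {x | x * z = z * x ∧ x * w = w * x ∧ ∃ k, x ^ (2 ^ k) = 1}
      one_mem' := ⟨by simp, by simp, 0, by simp⟩
      mul_mem' := by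
        rintro x y ⟨h1, h2, k, hk⟩ ⟨h3, h4, l, hl⟩
        refine ⟨Commute.mul_left h1 h3, Commute.mul_left h2 h4, k + l, ?_⟩
        have : Commute x y := hK1 x y h1 h2 h3 h4
        rw [this.mul_pow, pow_add, pow_mul, hk, mul_comm, pow_mul, hl]; simp
      inv_mem' := by
        rintro x ⟨h1, h2, k, hk⟩
        exact ⟨Commute.inv_left h1, Commute.inv_left h2, k, by simp [hk]⟩ }
  have hDab : ∀ x ∈ D, ∀ y ∈ D, x * y = y * x := fun x hx y hy => hK1 x y hx.1 hx.2.1 hy.1 hy.2.1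
  have hzD : z ∈ D := ⟨rfl, hc, 1, by rw [pow_one, pow_two, hz2]⟩
  have hwD : w ∈ D := ⟨hc.symm, rfl, 1, by rw [pow_one, pow_two, hw2]⟩
  have hD2 : IsPGroup 2 D := by
    rintro ⟨x, hx⟩
    obtain ⟨k, hk⟩ := hx.2.2
    exact ⟨k, Subtype.ext hk⟩
  let C := Subgroup.centralizer ({z} : Set G)
  have hmC : ∀ x, x ∈ C ↔ x * z = z * x := by
    intro x; simp only [C, Subgroup.mem_centralizer_singleton_iff]
  have hDC : D ≤ C := fun x hx => (hmC x).2 hx.1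
  have hPC : (P : Subgroup G) ≤ C := fun x hx => (hmC x).2 (hP x hx)
  have hD'2 : IsPGroup 2 (D.subgroupOf C) :=
    hD2.of_injective (Subgroup.subgroupOfEquivOfLe hDC).toMonoidHom (MulEquiv.injective _)
  have hP'2 : IsPGroup 2 ((P : Subgroup G).subgroupOf C) :=
    P.2.of_injective (Subgroup.subgroupOfEquivOfLe hPC).toMonoidHom (MulEquiv.injective _)
  obtain ⟨P₁, hP₁⟩ := hD'2.exists_le_sylow
  obtain ⟨P₀, hP₀⟩ := hP'2.exists_le_sylow
  by_cases hle : (P₁ : Subgroup C) ≤ D.subgroupOf C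
  · exfalso
    have h1 : Nat.card P ≤ Nat.card D := by
      rw [← Nat.card_congr (Subgroup.subgroupOfEquivOfLe hDC).toEquiv]
      have e : Nat.card P = Nat.card ((P : Subgroup G).subgroupOf C) :=
        (Nat.card_congr (Subgroup.subgroupOfEquivOfLe hPC).toEquiv).symm
      rw [e]
      refine (Subgroup.card_le_of_le hP₀).trans ?_
      have e2 : Nat.card P₀ = Nat.card P₁ := Nat.card_congr (P₀.equiv P₁).toEquiv
      refine le_trans (le_of_eq e2) ?_
      exact Subgroup.card_le_of_le hle
    obtain ⟨P₃, hP₃⟩ := hD2.exists_le_sylow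
    have h2 : D = P₃ := Subgroup.eq_of_le_of_card_ge hP₃ (by
      have e2 : Nat.card P₃ = Nat.card P := Nat.card_congr (P₃.equiv P).toEquiv
      exact (le_of_eq e2).trans h1)
    have h3 : ∀ x ∈ P₃, x ∈ D := by intro x hx; rw [h2]; exact hx
    exact hz (sylow2_trivial hG hS P₃ (fun x hx y hy => hDab x (h3 x hx) y (h3 y hy)) z (hP₃ hzD))
  · have hlt : (D.subgroupOf C).subgroupOf P₁ < ⊤ := by
      rw [lt_top_iff_ne_top]
      intro h
      exact hle (Subgroup.subgroupOf_eq_top.1 h)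
    have hnil : Group.IsNilpotent P₁ := P₁.2.isNilpotent
    obtain ⟨s, hs, hsD⟩ := SetLike.exists_of_lt
      (Group.normalizerCondition_of_isNilpotent (G := P₁) _ hlt)
    have hsC : s.1.1 * z = z * s.1.1 := (hmC _).1 s.1.2
    refine ⟨s.1.1, hsC, ?_⟩
    have hn := Subgroup.mem_normalizer_iff.1 hs
    have hm : s.1.1 * w * s.1.1⁻¹ ∈ D :=
      (hn ⟨⟨w, hDC hwD⟩, hP₁ (by exact hwD)⟩).1 (by exact hwD)
    obtain ⟨a, b, -⟩ := hm
    rcases hK2 _ a b (by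
      have : s.1.1 * w * s.1.1⁻¹ * (s.1.1 * w * s.1.1⁻¹) = s.1.1 * (w * w) * s.1.1⁻¹ := by group
      rw [this, hw2]; simp) (by simpa using hw) with h | h | h
    · exfalso
      rw [mul_inv_eq_iff_eq_mul, ← hsC] at h
      exact hzw (mul_left_cancel h).symm
    · exfalso
      rw [mul_inv_eq_iff_eq_mul] at h
      apply hsD
      have : s.1.1 ∈ D := by
        refine ⟨hsC, h, ?_⟩
        obtain ⟨k, hk⟩ := P₁.2 s
        refine ⟨k, ?_⟩
        have := congrArg (fun x : P₁ => x.1.1) hk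
        simpa using this
      exact this
    · exact h

open scoped Pointwise in
theorem isolated {G : Type*} [Group G] [Finite G] (hG : commutator G = ⊤) (hS : SP G)
    (ρ : G →* GL (Fin 3) ℂ) (hρ : Function.Injective ρ) {z : G} (hz : z ≠ 1) (hz2 : z * z = 1)
    (P : Sylow 2 G) (hP : ∀ x ∈ P, x * z = z * x) (g : G)
    (hc : z * (g * z * g⁻¹) = (g * z * g⁻¹) * z) : g * z * g⁻¹ = z := by
  by_contra hne
  set w := g * z * g⁻¹ with hwdef
  have hw : w ≠ 1 := by simpa [hwdef] using hz
  have hw2 : w * w = 1 := by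
    have : w * w = g * (z * z) * g⁻¹ := by rw [hwdef]; group
    rw [this, hz2]; simp
  have hdet := det_one_of_perfect hG ρ
  obtain ⟨hK1, hK2⟩ := klein ρ hρ hdet hz hw (Ne.symm hne) hz2 hw2 hc
  obtain ⟨s, hs1, hs2⟩ := swap_aux hG hS hz hw (Ne.symm hne) hz2 hw2 hc hK1 hK2 P hP
  obtain ⟨hK1', hK2'⟩ := klein ρ hρ hdet hw hz hne hw2 hz2 hc.symm
  obtain ⟨t, ht1, ht2⟩ := swap_aux hG hS hw hz hne hw2 hz2 hc.symm hK1' hK2' (MulAut.conj g • P) (by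
    intro x hx
    have hx' : x ∈ MulAut.conj g • (P : Subgroup G) := hx
    obtain ⟨y, hy, rfl⟩ := hx'
    show g * y * g⁻¹ * w = w * (g * y * g⁻¹)
    rw [hwdef]
    have := hP y hy
    calc g * y * g⁻¹ * (g * z * g⁻¹) = g * (y * z) * g⁻¹ := by group
      _ = _ := by rw [this]; group)
  let V : Subgroup G := Subgroup.closure {z, w}
  have hcl : ∀ x ∈ ({z, w} : Set G), ∀ y ∈ ({z, w} : Set G), x * y = y * x := by
    rintro x (rfl | rfl) y (rfl | rfl)
    · rfl
    · exact hc
    · exact hc.symm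
    · rfl
  have hcomm := Subgroup.isMulCommutative_closure hcl
  have hzV : z ∈ V := Subgroup.subset_closure (by simp)
  have hwV : w ∈ V := Subgroup.subset_closure (by simp)
  have norm : ∀ s : G, s * z * s⁻¹ ∈ V → s * w * s⁻¹ ∈ V → ∀ x, x ∈ V ↔ s * x * s⁻¹ ∈ V := by
    intro s h1 h2
    have hle : V.map (MulAut.conj s).toMonoidHom ≤ V := by
      rw [MonoidHom.map_closure, Subgroup.closure_le]
      rintro _ ⟨y, (rfl | rfl), rfl⟩
      · exact h1
      · exact h2
    have heq : V.map (MulAut.conj s).toMonoidHom = V :=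
      Subgroup.eq_of_le_of_card_ge hle (by
        rw [Subgroup.card_map_of_injective (MulEquiv.injective _)])
    intro x
    constructor
    · intro hx; exact hle ⟨x, hx, rfl⟩
    · intro hx
      rw [← heq] at hx
      obtain ⟨y, hy, e⟩ := hx
      have : y = x := by simpa using e
      exact this ▸ hy
  have hs3 : s * z * s⁻¹ = z := by rw [hs1]; group
  have ht3 : t * w * t⁻¹ = w := by rw [ht1]; group
  have := hS V (fun x hx y hy => congrArg Subtype.val (hcomm.is_comm.comm ⟨x, hx⟩ ⟨y, hy⟩)) s t
    (norm s (by rw [hs3]; exact hzV) (by rw [hs2]; exact mul_mem hzV hwV))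
    (norm t (by rw [ht2]; exact mul_mem hwV hzV) (by rw [ht3]; exact hwV))
  rcases this with h | h | h
  · have := h w hwV
    rw [this] at hs2
    exact hz (by simpa using hs2)
  · have := h z hzV
    rw [this] at ht2
    exact hw (by simpa using ht2)
  · have h1 := h w hwV
    have h2 : s * (t * w * t⁻¹) * s⁻¹ = w := by
      calc s * (t * w * t⁻¹) * s⁻¹ = (s * t * w) * (s * t)⁻¹ := by group
        _ = w := by rw [h1]; group
    rw [ht3, hs2] at h2
    exact hz (by simpa using h2)


theorem emb2_of_invariant {G : Type*} [Group G] [Finite G] (ρ : G →* GL (Fin 3) ℂ)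
    (hρ : Function.Injective ρ) (hdet : ∀ g, (ρ g).1.det = 1) (W : Submodule ℂ (Fin 3 → ℂ))
    (hW : Module.finrank ℂ W = 2) (hinv : ∀ g, ∀ w ∈ W, Matrix.toLin' (ρ g).1 w ∈ W) : EmbGL G 2 := by
  let f : G →* (W →ₗ[ℂ] W) :=
    { toFun := fun g => (Matrix.toLin' (ρ g).1).restrict (hinv g)
      map_one' := by
        apply LinearMap.ext; intro w; apply Subtype.ext
        simp [LinearMap.restrict_apply]
      map_mul' := by
        intro g h
        apply LinearMap.ext; intro w; apply Subtype.ext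
        simp [LinearMap.restrict_apply] }
  let b : Module.Basis (Fin 2) ℂ W := Module.finBasisOfFinrankEq ℂ W hW
  let F : G →* Matrix (Fin 2) (Fin 2) ℂ :=
    (LinearMap.toMatrixAlgEquiv b).toRingEquiv.toRingHom.toMonoidHom.comp f
  refine ⟨F.toHomUnits, ?_⟩
  rw [injective_iff_map_eq_one]
  intro g hg
  have h1 : F g = 1 := congrArg Units.val hg
  have h2 : f g = 1 := by
    apply (LinearMap.toMatrixAlgEquiv b).injective
    rw [map_one]; exact h1
  have h3 : ∀ w ∈ W, Matrix.toLin' (ρ g).1 w = w := by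
    intro w hw
    have := congrArg (fun k : W →ₗ[ℂ] W => (k ⟨w, hw⟩).1) h2
    exact this
  obtain ⟨Q, d, hd⟩ := diag_exists ρ g
  have h4 : ((ρ g).1 - 1).rank ≤ 1 := by
    have hle : W ≤ LinearMap.ker (Matrix.toLin' ((ρ g).1 - 1)) := by
      intro w hw
      rw [LinearMap.mem_ker, map_sub, LinearMap.sub_apply, h3 w hw]; simp
    have h5 := Submodule.finrank_mono hle
    have h6 := LinearMap.finrank_range_add_finrank_ker (Matrix.toLin' ((ρ g).1 - 1))
    rw [Module.finrank_fin_fun] at h6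
    rw [Matrix.rank_eq_finrank_range_toLin ((ρ g).1 - 1) (Pi.basisFun ℂ (Fin 3)) (Pi.basisFun ℂ (Fin 3))]
    have h7 : Matrix.toLin (Pi.basisFun ℂ (Fin 3)) (Pi.basisFun ℂ (Fin 3)) ((ρ g).1 - 1)
      = Matrix.toLin' ((ρ g).1 - 1) := by rw [Matrix.toLin_eq_toLin']
    rw [h7]
    omega
  have h5 : (Matrix.diagonal (fun i => d i - 1)).rank ≤ 1 := by
    have h6 := diag_sub hd
    have hQ : IsUnit Q.1.det := (Matrix.GeneralLinearGroup.det Q).isUnit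
    rw [← Matrix.rank_mul_eq_right_of_isUnit_det Q.1 (Matrix.diagonal (fun i => d i - 1)) hQ, ← h6,
      Matrix.rank_mul_eq_left_of_isUnit_det Q.1 _ hQ]
    exact h4
  rw [Matrix.rank_diagonal, Fintype.card_le_one_iff] at h5
  have h6 : ∀ i j, i ≠ j → d i ≠ 1 → d j = 1 := by
    intro i j hij hi
    by_contra hj
    have := h5 ⟨i, sub_ne_zero.2 hi⟩ ⟨j, sub_ne_zero.2 hj⟩
    exact hij (congrArg Subtype.val this)
  have h7 := hdet g
  rw [diag_det hd, Fin.prod_univ_three] at h7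
  have h8 : ∀ i, d i = 1 := by
    by_contra hcon
    push Not at hcon
    obtain ⟨i, hi⟩ := hcon
    have h9 := fun j hij => h6 i j hij hi
    fin_cases i
    · rw [h9 1 (by decide), h9 2 (by decide)] at h7; exact hi (by simpa using h7)
    · rw [h9 0 (by decide), h9 2 (by decide)] at h7; exact hi (by simpa using h7)
    · rw [h9 0 (by decide), h9 1 (by decide)] at h7; exact hi (by simpa using h7)
  apply diag_inj ρ hρ hd
  rw [show d = fun _ => 1 from funext h8]
  exact diag_one ρ Q

theorem schur3 {G : Type*} [Group G] [Finite G] (ρ : G →* GL (Fin 3) ℂ)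
    (hρ : Function.Injective ρ) (hdet : ∀ g, (ρ g).1.det = 1) (hirr : ¬ EmbGL G 2)
    (S : Matrix (Fin 3) (Fin 3) ℂ) (hS : ∀ g, (ρ g).1 * S = S * (ρ g).1) :
    ∃ c : ℂ, S = c • (1 : Matrix (Fin 3) (Fin 3) ℂ) := by
  obtain ⟨c, hc⟩ := Module.End.exists_eigenvalue (Matrix.toLin' S)
  refine ⟨c, ?_⟩
  set N := S - c • (1 : Matrix (Fin 3) (Fin 3) ℂ) with hN
  by_contra hne
  have hN0 : N ≠ 0 := sub_ne_zero.2 hne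
  have hNc : ∀ g, (ρ g).1 * N = N * (ρ g).1 := by
    intro g; rw [hN, mul_sub, sub_mul, hS g]; simp
  have hNv : ∀ g v, Matrix.toLin' (ρ g).1 (Matrix.toLin' N v) = Matrix.toLin' N (Matrix.toLin' (ρ g).1 v) := by
    intro g v
    rw [← LinearMap.comp_apply, ← Matrix.toLin'_mul, hNc, Matrix.toLin'_mul]; rfl
  have h6 := LinearMap.finrank_range_add_finrank_ker (Matrix.toLin' N)
  rw [Module.finrank_fin_fun] at h6
  have hk : Module.finrank ℂ (LinearMap.ker (Matrix.toLin' N)) ≠ 0 := by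
    intro h0
    have h1 := Submodule.finrank_eq_zero.1 h0
    obtain ⟨v, hv⟩ := hc.exists_hasEigenvector
    apply hv.2
    have : v ∈ LinearMap.ker (Matrix.toLin' N) := by
      rw [LinearMap.mem_ker, hN, map_sub, LinearMap.sub_apply, hv.apply_eq_smul]; simp
    rw [h1] at this
    simpa using this
  have hr : Module.finrank ℂ (LinearMap.range (Matrix.toLin' N)) ≠ 0 := by
    intro h0
    have h1 := Submodule.finrank_eq_zero.1 h0
    apply hN0
    rw [LinearMap.range_eq_bot] at h1
    simpa using h1
  apply hirr
  rcases (by omega : Module.finrank ℂ (LinearMap.range (Matrix.toLin' N)) = 2 ∨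
    Module.finrank ℂ (LinearMap.ker (Matrix.toLin' N)) = 2) with h | h
  · refine emb2_of_invariant ρ hρ hdet _ h ?_
    rintro g _ ⟨v, rfl⟩
    exact ⟨_, (hNv g v).symm⟩
  · refine emb2_of_invariant ρ hρ hdet _ h ?_
    intro g v hv
    rw [LinearMap.mem_ker] at hv ⊢
    rw [← hNv, hv, map_zero]

theorem class_trace {G : Type*} [Group G] [Finite G] (ρ : G →* GL (Fin 3) ℂ)
    (hρ : Function.Injective ρ) (hdet : ∀ g, (ρ g).1.det = 1) (hirr : ¬ EmbGL G 2)
    (X : Finset G) (hX : ∀ g, ∀ x ∈ X, g * x * g⁻¹ ∈ X) (htr : ∀ x ∈ X, (ρ x).1.trace = -1)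
    (z : G) (hz : z ∈ X) : 3 * ∑ x ∈ X, (ρ (z * x)).1.trace = X.card := by
  obtain ⟨c, hc⟩ := schur3 ρ hρ hdet hirr (∑ x ∈ X, (ρ x).1) (by
    intro g
    rw [Finset.mul_sum, Finset.sum_mul]
    refine Finset.sum_bij (fun x _ => g * x * g⁻¹) (fun x hx => hX g x hx) (by
      intro a _ b _ h; simpa using h) (by
      intro b hb
      exact ⟨g⁻¹ * b * g, by simpa using hX g⁻¹ b hb, by group⟩) ?_
    intro x hx
    rw [← Units.val_mul, ← Units.val_mul, ← map_mul, ← map_mul]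
    simp)
  have h1 : ∑ x ∈ X, (ρ x).1.trace = 3 * c := by
    rw [← Matrix.trace_sum, hc]; simp [Matrix.trace_smul, mul_comm]
  rw [Finset.sum_congr rfl htr] at h1
  have h2 : ∑ x ∈ X, (ρ (z * x)).1.trace = - c := by
    have : ∑ x ∈ X, (ρ (z * x)).1.trace = ((ρ z).1 * ∑ x ∈ X, (ρ x).1).trace := by
      rw [Finset.mul_sum, Matrix.trace_sum]; simp
    rw [this, hc]
    simp [Matrix.trace_smul, htr z hz]
  rw [h2]
  simp at h1
  linear_combination h1

theorem torus_trace {G : Type*} [Group G] [Finite G] (ρ : G →* GL (Fin 3) ℂ)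
    (hρ : Function.Injective ρ) (hdet : ∀ g, (ρ g).1.det = 1) (z v : G) (hv : v ≠ 1)
    (T : Finset G) (hvT : v ∈ T) (hT1 : ∀ x ∈ T, x * v = v * x) (hT2 : ∀ x ∈ T, Odd (orderOf x))
    (hT3 : ∀ x ∈ T, z * x * z⁻¹ = x⁻¹) (hT4 : ∀ x ∈ T, v * x ∈ T) :
    ∑ x ∈ T, (ρ x).1.trace = T.card := by
  classical
  obtain ⟨Q, d, hd, hinj, i₀, hi₀⟩ := inverted_diag ρ hρ hdet hv (hT2 v hvT) (hT3 v hvT)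
  have hex : ∀ x, ∃ e : Fin 3 → ℂ, x ∈ T → (ρ x).1 * Q.1 = Q.1 * Matrix.diagonal e := by
    intro x
    by_cases hx : x ∈ T
    · obtain ⟨e, he⟩ := inverted_comm_diag ρ hd hinj (hT1 x hx)
      exact ⟨e, fun _ => he⟩
    · exact ⟨0, fun h => absurd h hx⟩
  choose e he using hex
  have hev : e v = d := diag_congr (he v hvT) hd
  let M : GL (Fin 3) ℂ := Q⁻¹ * ρ z * Q
  have hQM : Q.1 * M.1 = (ρ z).1 * Q.1 := by
    rw [← Units.val_mul, ← Units.val_mul]; congr 1; simp [M, mul_assoc]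
  have hM : ∀ x ∈ T, ∀ i j, e x i * M.1 i j * e x j = M.1 i j := by
    intro x hx i j
    have h1 : x * z * x = z := by
      have := hT3 x hx
      rw [mul_inv_eq_iff_eq_mul] at this
      rw [mul_assoc, this]; group
    have h2 : Q.1 * (Matrix.diagonal (e x) * M.1 * Matrix.diagonal (e x)) = Q.1 * M.1 := by
      rw [← mul_assoc, ← mul_assoc, ← he x hx, mul_assoc (ρ x).1, hQM, ← mul_assoc, mul_assoc _ Q.1,
        ← he x hx, ← mul_assoc, ← Units.val_mul, ← Units.val_mul, ← map_mul, ← map_mul, h1]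
    have h4 := congrArg (fun N => ((Q⁻¹ : GL (Fin 3) ℂ) : Matrix (Fin 3) (Fin 3) ℂ) * N) h2
    simp only [← mul_assoc, ← Units.val_mul, inv_mul_cancel] at h4
    simp only [Units.val_one, one_mul] at h4
    have h5 := congrFun (congrFun h4 i) j
    rwa [Matrix.mul_diagonal, Matrix.diagonal_mul] at h5
  have hM0 : ∀ j, j ≠ i₀ → M.1 i₀ j = 0 := by
    intro j hj
    have h1 := hM v hvT i₀ j
    rw [hev, hi₀, one_mul] at h1
    by_contra h0
    exact hinj j i₀ hj (by rw [hi₀]; exact mul_left_cancel₀ h0 (by rw [h1, mul_one]))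
  have hM1 : M.1 i₀ i₀ ≠ 0 := by
    intro h0
    have h1 : ((M * M⁻¹ : GL (Fin 3) ℂ) : Matrix (Fin 3) (Fin 3) ℂ) i₀ i₀ = 0 := by
      rw [Units.val_mul, Matrix.mul_apply]
      apply Finset.sum_eq_zero
      intro j _
      by_cases hj : j = i₀
      · subst hj; rw [h0, zero_mul]
      · rw [hM0 j hj, zero_mul]
    simp at h1
  have he0 : ∀ x ∈ T, e x i₀ = 1 := by
    intro x hx
    apply odd_root_eq_one (hT2 x hx) (diag_root ρ (he x hx) (pow_orderOf_eq_one x) i₀)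
    have := hM x hx i₀ i₀
    exact mul_left_cancel₀ hM1 (by linear_combination this)
  have hsum : ∀ i, i ≠ i₀ → ∑ x ∈ T, e x i = 0 := by
    intro i hi
    have h1 : ∑ x ∈ T, e (v * x) i = ∑ x ∈ T, e x i := by
      have himg : T.image (fun x => v * x) = T := by
        apply Finset.eq_of_subset_of_card_le
        · intro y hy
          obtain ⟨x, hx, rfl⟩ := Finset.mem_image.1 hy
          exact hT4 x hx
        · rw [Finset.card_image_of_injective _ (mul_right_injective v)]
      conv_rhs => rw [← himg]
      rw [Finset.sum_image (fun a _ b _ h => mul_left_cancel h)]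
    have h2 : ∑ x ∈ T, e (v * x) i = d i * ∑ x ∈ T, e x i := by
      rw [Finset.mul_sum]
      apply Finset.sum_congr rfl
      intro x hx
      exact congrFun (diag_congr (he _ (hT4 x hx)) (diag_mul ρ hd (he x hx))) i
    rw [h1] at h2
    by_contra h0
    exact hinj i i₀ hi (by rw [hi₀]; exact mul_right_cancel₀ h0 (by rw [← h2, one_mul]))
  calc ∑ x ∈ T, (ρ x).1.trace = ∑ x ∈ T, ∑ i, e x i :=
        Finset.sum_congr rfl (fun x hx => diag_trace (he x hx))
    _ = ∑ i, ∑ x ∈ T, e x i := Finset.sum_comm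
    _ = ∑ x ∈ T, e x i₀ := Finset.sum_eq_single i₀ (fun i _ hi => hsum i hi) (by simp)
    _ = T.card := by rw [Finset.sum_congr rfl he0]; simp


/-- nontrivial of odd order -/
def NT {G : Type*} [Group G] (v : G) : Prop := v ≠ 1 ∧ Odd (orderOf v)

/-- a conjugation carries A to B -/
def CJ {G : Type*} [Group G] (A B : Subgroup G) : Prop := ∃ g, ∀ x, x ∈ A ↔ g * x * g⁻¹ ∈ B

/-- centralizers of nontrivial odd elements are abelian -/
def CA (G : Type*) [Group G] : Prop :=
  ∀ v : G, NT v → ∀ x y, x * v = v * x → y * v = v * y → x * y = y * x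

/-- centralizer of an element -/
abbrev cen {G : Type*} [Group G] (v : G) : Subgroup G := Subgroup.centralizer {v}

theorem mem_cen {G : Type*} [Group G] {v x : G} : x ∈ cen v ↔ x * v = v * x := by
  simp only [cen, Subgroup.mem_centralizer_singleton_iff]

theorem cen_eq {G : Type*} [Group G] (hF : CA G) {u v : G} (hu : NT u) (hv : NT v)
    (h : u * v = v * u) : cen u = cen v := by
  ext x
  rw [mem_cen, mem_cen]
  exact ⟨fun hx => hF u hu x v hx h.symm, fun hx => hF v hv x u hx h⟩

theorem cen_conj {G : Type*} [Group G] {u v g : G} (h : g * u * g⁻¹ = v) (x : G) :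
    x ∈ cen u ↔ g * x * g⁻¹ ∈ cen v := by
  rw [mem_cen, mem_cen, ← h]
  have e1 : g * x * g⁻¹ * (g * u * g⁻¹) = g * (x * u) * g⁻¹ := by group
  have e2 : (g * u * g⁻¹) * (g * x * g⁻¹) = g * (u * x) * g⁻¹ := by group
  rw [e1, e2]
  simp

theorem NT.conj {G : Type*} [Group G] {u : G} (hu : NT u) (g : G) : NT (g * u * g⁻¹) := by
  refine ⟨by simpa using hu.1, ?_⟩
  have : orderOf (g * u * g⁻¹) = orderOf u := MulEquiv.orderOf_eq (MulAut.conj g) u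
  rw [this]; exact hu.2

theorem CJ.symm {G : Type*} [Group G] {A B : Subgroup G} (h : CJ A B) : CJ B A := by
  obtain ⟨g, hg⟩ := h
  refine ⟨g⁻¹, fun x => ?_⟩
  rw [hg]
  have : g * (g⁻¹ * x * g⁻¹⁻¹) * g⁻¹ = x := by group
  rw [this]

theorem CJ.trans {G : Type*} [Group G] {A B C : Subgroup G} (h : CJ A B) (h' : CJ B C) : CJ A C := by
  obtain ⟨g, hg⟩ := h
  obtain ⟨k, hk⟩ := h'
  refine ⟨k * g, fun x => ?_⟩
  rw [hg, hk]
  have : k * (g * x * g⁻¹) * k⁻¹ = k * g * x * (k * g)⁻¹ := by group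
  rw [this]

section
variable {G : Type*} [Group G] [Finite G]

theorem powE_odd (x : G) : Odd (orderOf (x ^ (2 ^ Nat.card G))) := by
  obtain ⟨a, m, hm, hor⟩ := Nat.exists_eq_two_pow_mul_odd (orderOf_pos x).ne'
  have hle : a ≤ Nat.card G := by
    have h1 : 2 ^ a ≤ orderOf x := by
      rw [hor]; exact Nat.le_mul_of_pos_right _ hm.pos
    have h2 := Nat.lt_two_pow_self (n := a)
    have h3 : orderOf x ≤ Nat.card G := Nat.le_of_dvd Nat.card_pos (orderOf_dvd_natCard x)
    omega
  have h : orderOf (x ^ (2 ^ Nat.card G)) ∣ m := by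
    rw [orderOf_dvd_iff_pow_eq_one, ← pow_mul]
    obtain ⟨c, hc⟩ := Nat.exists_eq_add_of_le hle
    rw [hc, pow_add, mul_assoc, mul_comm _ m, ← mul_assoc, ← hor, pow_mul, pow_orderOf_eq_one, one_pow]
  exact hm.of_dvd_nat h

theorem exists_root_two_pow {x : G} (hx : Odd (orderOf x)) (E : ℕ) : ∃ k : ℕ, (x ^ k) ^ (2 ^ E) = x := by
  have hc : Nat.Coprime (2 ^ E) (orderOf x) := Nat.Coprime.pow_left _ (Nat.coprime_two_left.2 hx)
  obtain ⟨m, hm⟩ := exists_pow_eq_self_of_coprime hc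
  exact ⟨m, by rw [← pow_mul, mul_comm, pow_mul, hm]⟩

theorem odd_of_pow {x : G} (hx : Odd (orderOf x)) (k : ℕ) : Odd (orderOf (x ^ k)) :=
  hx.of_dvd_nat (orderOf_pow_dvd k)

theorem tor_exists (A : Subgroup G) (hA : ∀ x ∈ A, ∀ y ∈ A, x * y = y * x) :
    ∃ T D : Subgroup G, (∀ x, x ∈ T ↔ x ∈ A ∧ Odd (orderOf x)) ∧
      (∀ x, x ∈ D ↔ x ∈ A ∧ x ^ (2 ^ Nat.card G) = 1) ∧ Nat.card A = Nat.card T * Nat.card D := by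
  let f : A →* G :=
    { toFun := fun x => (x : G) ^ (2 ^ Nat.card G)
      map_one' := by simp
      map_mul' := fun x y => by
        have : Commute (x : G) y := hA x x.2 y y.2
        exact this.mul_pow _ }
  refine ⟨f.range, f.ker.map A.subtype, ?_, ?_, ?_⟩
  · intro x
    constructor
    · rintro ⟨y, rfl⟩
      exact ⟨A.pow_mem y.2 _, powE_odd (y : G)⟩
    · rintro ⟨h1, h2⟩
      obtain ⟨k, hk⟩ := exists_root_two_pow h2 (Nat.card G)
      exact ⟨⟨x ^ k, A.pow_mem h1 k⟩, hk⟩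
  · intro x
    constructor
    · rintro ⟨y, hy, rfl⟩
      exact ⟨y.2, hy⟩
    · rintro ⟨h1, h2⟩
      exact ⟨⟨x, h1⟩, h2, rfl⟩
  · rw [Subgroup.card_map_of_injective A.subtype_injective, ← Subgroup.index_ker, mul_comm]
    exact (Subgroup.card_mul_index f.ker).symm

theorem norm_card (hS : SP G) (hF : CA G) {v : G} (hv : NT v) :
    Nat.card {h : G // ∀ x, x ∈ cen v ↔ h * x * h⁻¹ ∈ cen v} ≤ 2 * Nat.card (cen v) := by
  have hA : ∀ x ∈ cen v, ∀ y ∈ cen v, x * y = y * x :=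
    fun x hx y hy => hF v hv x y (mem_cen.1 hx) (mem_cen.1 hy)
  have hvA : v ∈ cen v := mem_cen.2 rfl
  by_cases hall : ∀ h : G, (∀ x, x ∈ cen v ↔ h * x * h⁻¹ ∈ cen v) → h ∈ cen v
  · have : Nat.card {h : G // ∀ x, x ∈ cen v ↔ h * x * h⁻¹ ∈ cen v} ≤ Nat.card (cen v) :=
      Nat.card_le_card_of_injective (fun h => (⟨h.1, hall h.1 h.2⟩ : cen v)) (by
        intro a b h; exact Subtype.ext (congrArg (fun x : cen v => x.1) h))
    omega
  · push Not at hall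
    obtain ⟨s, hs, hsA⟩ := hall
    have key : ∀ h : G, (∀ x, x ∈ cen v ↔ h * x * h⁻¹ ∈ cen v) → h ∈ cen v ∨ s⁻¹ * h ∈ cen v := by
      intro h hh
      have hs' : ∀ x, x ∈ cen v ↔ s⁻¹ * x * s⁻¹⁻¹ ∈ cen v := by
        intro x; rw [hs (s⁻¹ * x * s⁻¹⁻¹)]
        have : s * (s⁻¹ * x * s⁻¹⁻¹) * s⁻¹ = x := by group
        rw [this]
      rcases hS _ hA s⁻¹ h hs' hh with h1 | h1 | h1
      · exfalso; apply hsA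
        have := h1 v hvA
        rw [mem_cen]
        calc s * v = s * (v * s⁻¹) * s := by group
          _ = v * s := by rw [← this]; group
      · left; exact mem_cen.2 (h1 v hvA)
      · right; exact mem_cen.2 (h1 v hvA)
    have hle : Nat.card {h : G // ∀ x, x ∈ cen v ↔ h * x * h⁻¹ ∈ cen v} ≤ Nat.card (cen v ⊕ cen v) := by
      classical
      refine Nat.card_le_card_of_injective (fun h => if hh : h.1 ∈ cen v then Sum.inl ⟨h.1, hh⟩ else
        Sum.inr ⟨s⁻¹ * h.1, (key h.1 h.2).resolve_left hh⟩) ?_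
      intro a b hab
      by_cases ha : a.1 ∈ cen v <;> by_cases hb : b.1 ∈ cen v <;> simp [ha, hb] at hab
      · exact Subtype.ext hab
      · exact Subtype.ext hab
    rw [Nat.card_sum] at hle
    omega

end


section
variable {G : Type*} [Group G] [Finite G]

/-- number of odd order elements of A -/
noncomputable def tor (A : Subgroup G) : ℕ := Nat.card {x : G // x ∈ A ∧ Odd (orderOf x)}

theorem tor_eq {A T : Subgroup G} (h : ∀ x, x ∈ T ↔ x ∈ A ∧ Odd (orderOf x)) : Nat.card T = tor A :=
  Nat.card_congr (Equiv.subtypeEquivRight h)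

theorem cen_ab (hF : CA G) {v : G} (hv : NT v) : ∀ x ∈ cen v, ∀ y ∈ cen v, x * y = y * x :=
    fun x hx y hy => hF v hv x y (mem_cen.1 hx) (mem_cen.1 hy)

theorem tor_dvd (hF : CA G) {v : G} (hv : NT v) : tor (cen v) ∣ Nat.card G := by
  obtain ⟨T, D, hT, -, -⟩ := tor_exists (cen v) (cen_ab hF hv)
  rw [← tor_eq hT]
  exact T.card_subgroup_dvd_card

theorem tor_prime (hF : CA G) {v : G} (hv : NT v) {p : ℕ} (hp : p.Prime) (h : p ∣ tor (cen v)) :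
    p ≠ 2 ∧ ∃ x ∈ cen v, orderOf x = p := by
  obtain ⟨T, D, hT, -, -⟩ := tor_exists (cen v) (cen_ab hF hv)
  rw [← tor_eq hT] at h
  have : Fact p.Prime := ⟨hp⟩
  obtain ⟨x, hx⟩ := exists_prime_orderOf_dvd_card' p h
  have hx' := (hT x).1 x.2
  have ho : orderOf (x : G) = p := by rw [← hx]; simp
  refine ⟨?_, x, hx'.1, ho⟩
  rintro rfl
  rw [ho] at hx'
  exact absurd hx'.2 (by decide)

theorem tor_odd (hF : CA G) {v : G} (hv : NT v) : Odd (tor (cen v)) := by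
  by_contra h
  rw [Nat.not_odd_iff_even, even_iff_two_dvd] at h
  exact (tor_prime hF hv Nat.prime_two h).1 rfl

theorem tor_ge (hF : CA G) {v : G} (hv : NT v) : 3 ≤ tor (cen v) := by
  have h1 := tor_odd hF hv
  have h2 : 1 < tor (cen v) := by
    apply Finite.one_lt_card_iff_nontrivial.2
    exact ⟨⟨⟨v, mem_cen.2 rfl, hv.2⟩, ⟨1, one_mem _, by simp⟩, fun h => hv.1 (congrArg Subtype.val h)⟩⟩
  obtain ⟨k, hk⟩ := h1
  omega

theorem tor_cj {A B : Subgroup G} (h : CJ A B) : tor A = tor B := by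
  obtain ⟨g, hg⟩ := h
  apply Nat.card_congr
  refine (MulAut.conj g).toEquiv.subtypeEquiv ?_
  intro x
  have e1 : orderOf (g * x * g⁻¹) = orderOf x := MulEquiv.orderOf_eq (MulAut.conj g) x
  show _ ↔ g * x * g⁻¹ ∈ B ∧ Odd (orderOf (g * x * g⁻¹))
  rw [e1, hg]

theorem NT.of_prime {x : G} {p : ℕ} (hp : p.Prime) (hp2 : p ≠ 2) (h : orderOf x = p) : NT x := by
  refine ⟨?_, by rw [h]; exact hp.odd_of_ne_two hp2⟩
  rintro rfl
  rw [orderOf_one] at h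
  exact hp.one_lt.ne h

theorem sylow_le_cen (hS : SP G) (hF : CA G) {v : G} (hv : NT v) {p : ℕ} (hp : p.Prime)
    (h : p ∣ tor (cen v)) : ∃ P : Sylow p G, ∀ x ∈ P, x ∈ cen v := by
  obtain ⟨hp2, x, hx, ho⟩ := tor_prime hF hv hp h
  have hfp : Fact p.Prime := ⟨hp⟩
  have hpg : IsPGroup p (Subgroup.zpowers x) := by
    apply IsPGroup.of_card (n := 1); rw [Nat.card_zpowers, ho, pow_one]
  obtain ⟨P, hP⟩ := hpg.exists_le_sylow
  have hab := sylow_abelian hS hp2 P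
  refine ⟨P, fun y hy => ?_⟩
  rw [← cen_eq hF (NT.of_prime hp hp2 ho) hv (mem_cen.1 hx), mem_cen]
  exact hab y hy x (hP (Subgroup.mem_zpowers x))

open scoped Pointwise in
theorem conj_into (hS : SP G) (hF : CA G) {v : G} (hv : NT v) {p : ℕ} (hp : p.Prime)
    (h : p ∣ tor (cen v)) (y : G) (hy : orderOf y = p) :
    ∃ g, g * y * g⁻¹ ∈ cen v ∧ ∀ x, x ∈ cen y ↔ g * x * g⁻¹ ∈ cen v := by
  have hp2 := (tor_prime hF hv hp h).1
  obtain ⟨P, hP⟩ := sylow_le_cen hS hF hv hp h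
  have hfp : Fact p.Prime := ⟨hp⟩
  have hpg : IsPGroup p (Subgroup.zpowers y) := by
    apply IsPGroup.of_card (n := 1); rw [Nat.card_zpowers, hy, pow_one]
  obtain ⟨P', hP'⟩ := hpg.exists_le_sylow
  obtain ⟨g, hg⟩ := MulAction.exists_smul_eq G P' P
  have h1 : g * y * g⁻¹ ∈ P := by
    rw [← hg]
    exact ⟨y, hP' (Subgroup.mem_zpowers y), rfl⟩
  have h2 := hP _ h1
  refine ⟨g, h2, fun x => ?_⟩
  rw [← cen_eq hF ((NT.of_prime hp hp2 hy).conj g) hv (mem_cen.1 h2)]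
  exact cen_conj rfl x

theorem cj_of_prime (hS : SP G) (hF : CA G) {v u : G} (hv : NT v) (hu : NT u) {p : ℕ} (hp : p.Prime)
    (h : p ∣ tor (cen v)) (h' : p ∣ tor (cen u)) : CJ (cen u) (cen v) := by
  obtain ⟨hp2, y, hy, ho⟩ := tor_prime hF hu hp h'
  obtain ⟨g, -, hg⟩ := conj_into hS hF hv hp h y ho
  rw [cen_eq hF (NT.of_prime hp hp2 ho) hu (mem_cen.1 hy)] at hg
  exact ⟨g, hg⟩

/-- elements conjugate to a non-2-element of A -/
def img (A : Subgroup G) : Set G := {x | ∃ g e, e ∈ A ∧ e ^ (2 ^ Nat.card G) ≠ 1 ∧ g * e * g⁻¹ = x}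

theorem powE_NT {e : G} (he : e ^ (2 ^ Nat.card G) ≠ 1) : NT (e ^ (2 ^ Nat.card G)) := ⟨he, powE_odd e⟩

theorem cen_powE (hF : CA G) {v : G} (hv : NT v) {e : G} (he : e ∈ cen v)
    (h1 : e ^ (2 ^ Nat.card G) ≠ 1) : cen (e ^ (2 ^ Nat.card G)) = cen v :=
  cen_eq hF (powE_NT h1) hv (Commute.pow_left (mem_cen.1 he) _)

theorem img_disjoint (hF : CA G) {v u : G} (hv : NT v) (hu : NT u) (h : ¬ CJ (cen v) (cen u)) :
    Disjoint (img (cen v)) (img (cen u)) := by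
  rw [Set.disjoint_left]
  rintro x ⟨g, e, he, he1, rfl⟩ ⟨k, f, hf, hf1, hx⟩
  apply h
  rw [← cen_powE hF hv he he1, ← cen_powE hF hu hf hf1]
  refine ⟨k⁻¹ * g, cen_conj ?_⟩
  have h1 : (k⁻¹ * g) * e * (k⁻¹ * g)⁻¹ = f := by
    calc (k⁻¹ * g) * e * (k⁻¹ * g)⁻¹ = k⁻¹ * (g * e * g⁻¹) * k := by group
      _ = f := by rw [← hx]; group
  rw [← h1, conj_pow]

theorem img_card (hS : SP G) (hF : CA G) {v : G} (hv : NT v) :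
    Nat.card G * (tor (cen v) - 1) ≤ 2 * tor (cen v) * (img (cen v)).ncard := by
  classical
  have : Fintype G := Fintype.ofFinite G
  obtain ⟨T, D, hT, hD, hc⟩ := tor_exists (cen v) (cen_ab hF hv)
  rw [← tor_eq hT]
  let B : Finset G := Finset.univ.filter (fun e => e ∈ cen v ∧ e ^ (2 ^ Nat.card G) ≠ 1)
  have hB : B.card + Nat.card D = Nat.card (cen v) := by
    have e1 : Nat.card D = (Finset.univ.filter (fun e => e ∈ cen v ∧ e ^ (2 ^ Nat.card G) = 1)).card := by
      rw [← Fintype.card_subtype, ← Nat.card_eq_fintype_card]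
      exact Nat.card_congr (Equiv.subtypeEquivRight hD)
    have e2 : Nat.card (cen v) = (Finset.univ.filter (fun e => e ∈ cen v)).card := by
      rw [← Fintype.card_subtype, ← Nat.card_eq_fintype_card]
    rw [e1, e2, ← Finset.card_filter_add_card_filter_not (s := Finset.univ.filter (fun e => e ∈ cen v))
      (fun e => e ^ (2 ^ Nat.card G) = 1), Finset.filter_filter, Finset.filter_filter, add_comm]
  let I : Finset G := (Set.toFinite (img (cen v))).toFinset
  have hI : I.card = (img (cen v)).ncard := (Set.ncard_eq_toFinset_card _ _).symm
  have hmaps : ∀ a ∈ (Finset.univ : Finset G) ×ˢ B, a.1 * a.2 * a.1⁻¹ ∈ I := by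
    rintro ⟨g, e⟩ ha
    simp only [Finset.mem_product, Finset.mem_univ, true_and, B, Finset.mem_filter] at ha
    simp only [I, Set.Finite.mem_toFinset]
    exact ⟨g, e, ha.1, ha.2, rfl⟩
  have hfib : ∀ b ∈ I, (((Finset.univ : Finset G) ×ˢ B).filter (fun a => a.1 * a.2 * a.1⁻¹ = b)).card
      ≤ 2 * Nat.card (cen v) := by
    intro b hb
    simp only [I, Set.Finite.mem_toFinset] at hb
    obtain ⟨g₀, e₀, he₀, he₁, rfl⟩ := hb
    refine le_trans ?_ (norm_card hS hF hv)
    rw [Nat.card_eq_fintype_card, Fintype.card_subtype]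
    refine Finset.card_le_card_of_injOn (fun a => g₀⁻¹ * a.1) ?_ ?_
    · rintro ⟨g, e⟩ ha
      simp only [Finset.coe_filter, Finset.mem_product, Finset.mem_univ, true_and, B, Finset.mem_filter,
        Set.mem_setOf_eq] at ha ⊢
      obtain ⟨⟨ha1, ha2⟩, ha3⟩ := ha
      have hk : (g₀⁻¹ * g) * e ^ (2 ^ Nat.card G) * (g₀⁻¹ * g)⁻¹ = e₀ ^ (2 ^ Nat.card G) := by
        rw [← conj_pow]
        congr 1
        calc (g₀⁻¹ * g) * e * (g₀⁻¹ * g)⁻¹ = g₀⁻¹ * (g * e * g⁻¹) * g₀ := by group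
          _ = e₀ := by rw [ha3]; group
      have := cen_conj hk
      rwa [cen_powE hF hv ha1 ha2, cen_powE hF hv he₀ he₁] at this
    · rintro ⟨g, e⟩ ha ⟨k, f⟩ hb h
      simp only [Finset.coe_filter, Set.mem_setOf_eq] at ha hb h
      have hgk : g = k := mul_left_cancel h
      subst hgk
      have := ha.2.trans hb.2.symm
      have hef : e = f := by simpa using this
      rw [hef]
  have hmain := Finset.card_le_mul_card_image_of_maps_to hmaps _ hfib
  rw [Finset.card_product, Finset.card_univ, ← Nat.card_eq_fintype_card, hI] at hmain
  have hDpos : 0 < Nat.card D := Nat.card_pos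
  have hBeq : B.card = (Nat.card T - 1) * Nat.card D := by
    rw [Nat.sub_mul, ← hc]; omega
  rw [hBeq, hc] at hmain
  refine Nat.le_of_mul_le_mul_right ?_ hDpos
  calc Nat.card G * (Nat.card T - 1) * Nat.card D = Nat.card G * ((Nat.card T - 1) * Nat.card D) := by ring
    _ ≤ _ := hmain
    _ = _ := by ring

/-- at most two classes -/
theorem two_classes (hS : SP G) (hF : CA G) {u v w : G} (hu : NT u) (hv : NT v) (hw : NT w)
    (h1 : 5 ≤ tor (cen v)) (h2 : 5 ≤ tor (cen w)) (huv : ¬ CJ (cen u) (cen v))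
    (huw : ¬ CJ (cen u) (cen w)) (hvw : ¬ CJ (cen v) (cen w)) : False := by
  have d1 := img_disjoint hF hu hv huv
  have d2 := img_disjoint hF hu hw huw
  have d3 := img_disjoint hF hv hw hvw
  have c1 := img_card hS hF hu
  have c2 := img_card hS hF hv
  have c3 := img_card hS hF hw
  have h0 := tor_ge hF hu
  have e1 : (img (cen u) ∪ img (cen v) ∪ img (cen w)).ncard =
      (img (cen u)).ncard + (img (cen v)).ncard + (img (cen w)).ncard := by
    rw [Set.ncard_union_eq (Set.disjoint_union_left.2 ⟨d2, d3⟩), Set.ncard_union_eq d1]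
  have e2 : (img (cen u) ∪ img (cen v) ∪ img (cen w)).ncard ≤ Nat.card G := by
    rw [← Set.ncard_univ]; exact Set.ncard_le_ncard (Set.subset_univ _)
  rw [e1] at e2
  have hg : 0 < Nat.card G := Nat.card_pos
  generalize (img (cen u)).ncard = x at *
  generalize (img (cen v)).ncard = y at *
  generalize (img (cen w)).ncard = t at *
  generalize Nat.card G = n at *
  have b : ∀ m a q : ℕ, m + 1 ≤ a → n * (a - 1) ≤ 2 * a * q → n * m ≤ 2 * (m + 1) * q := by
    intro m a q ha h
    obtain ⟨c, rfl⟩ := Nat.exists_eq_add_of_le ha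
    have : m + 1 + c - 1 = m + c := by omega
    rw [this] at h
    have h5 : (m + 1 + c) * (n * m) ≤ (m + 1 + c) * (2 * (m + 1) * q) := by
      calc (m + 1 + c) * (n * m) = n * (m * (m + 1) + c * m) := by ring
        _ ≤ n * (m * (m + 1) + c * (m + 1)) := by gcongr; omega
        _ = (m + 1) * (n * (m + c)) := by ring
        _ ≤ (m + 1) * (2 * (m + 1 + c) * q) := by gcongr
        _ = _ := by ring
    exact Nat.le_of_mul_le_mul_left h5 (by omega)
  have b1 := b 2 _ _ h0 c1
  have b2 := b 4 _ _ h1 c2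
  have b3 := b 4 _ _ h2 c3
  omega
end


section
variable {G : Type*} [Group G] [Finite G]

/-- z is an isolated involution -/
structure Iso (z : G) : Prop where
  ne : z ≠ 1
  sq : z * z = 1
  iso : ∀ g, z * (g * z * g⁻¹) = (g * z * g⁻¹) * z → g * z * g⁻¹ = z

theorem inv_pow_shift {z u : G} (h : z * u * z⁻¹ = u⁻¹) (j : ℕ) : (u ^ j)⁻¹ * z = z * u ^ j := by
  have h1 : z * u ^ j * z⁻¹ = (u ^ j)⁻¹ := by rw [← conj_pow, h, inv_pow]
  rw [← h1]; group

theorem Iso.inv {z : G} (hz : Iso z) : z⁻¹ = z := inv_eq_of_mul_eq_one_left hz.sq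

theorem Iso.prod_odd {z : G} (hz : Iso z) (g : G) : Odd (orderOf (z * (g * z * g⁻¹))) := by
  set x := g * z * g⁻¹ with hx
  set u := z * x with hu
  have hx2 : x * x = 1 := by
    have : x * x = g * (z * z) * g⁻¹ := by rw [hx]; group
    rw [this, hz.sq]; simp
  have hxi : x⁻¹ = x := inv_eq_of_mul_eq_one_left hx2
  have hzu : z * u = x := by rw [hu, ← mul_assoc, hz.sq, one_mul]
  have hui : z * u * z⁻¹ = u⁻¹ := by rw [hzu, hu, mul_inv_rev, hxi]
  by_contra hodd
  rw [Nat.not_odd_iff_even] at hodd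
  obtain ⟨m, hm⟩ := hodd
  have hpos := orderOf_pos u
  have hum : u ^ m * u ^ m = 1 := by rw [← pow_add, ← hm, pow_orderOf_eq_one]
  have hconj : ∃ k, k * z * k⁻¹ = z * u ^ m := by
    rcases Nat.even_or_odd' m with ⟨j, hj | hj⟩
    · refine ⟨(u ^ j)⁻¹, ?_⟩
      rw [inv_pow_shift hui, inv_inv, hj, two_mul, pow_add, mul_assoc]
    · refine ⟨(u ^ j)⁻¹ * g, ?_⟩
      calc (u ^ j)⁻¹ * g * z * ((u ^ j)⁻¹ * g)⁻¹ = (u ^ j)⁻¹ * (g * z * g⁻¹) * u ^ j := by group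
        _ = (u ^ j)⁻¹ * (z * u) * u ^ j := by rw [← hx, hzu]
        _ = ((u ^ j)⁻¹ * z) * (u * u ^ j) := by group
        _ = z * u ^ m := by
          rw [inv_pow_shift hui, hj, ← pow_succ', mul_assoc, ← pow_add]
          congr 2; ring
  obtain ⟨k, hk⟩ := hconj
  have h1 := hz.iso k (by
    rw [hk]
    have := inv_pow_shift hui m
    have e : (u ^ m)⁻¹ = u ^ m := inv_eq_of_mul_eq_one_left hum
    rw [e] at this
    rw [← this, ← mul_assoc, mul_assoc (u ^ m), hz.sq, mul_one]
    rw [← this, mul_assoc, hz.sq, mul_one])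
  rw [hk] at h1
  have h2 : u ^ m = 1 := by simpa using h1
  have h3 := Nat.le_of_dvd (by omega) (orderOf_dvd_of_pow_eq_one h2)
  omega

theorem inv_conj {z v : G} (hv : Odd (orderOf v)) (h : z * v * z⁻¹ = v⁻¹) :
    ∃ k : ℕ, (v ^ k)⁻¹ * z * (v ^ k) = z * v := by
  obtain ⟨k, hk⟩ := exists_root_two_pow hv 1
  refine ⟨k, ?_⟩
  rw [inv_pow_shift h, mul_assoc, ← pow_two]
  simpa using hk

theorem not_mem_cen {z v : G} (hv : NT v) (h : z * v * z⁻¹ = v⁻¹) : z ∉ cen v := by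
  intro hm
  rw [mem_cen] at hm
  rw [hm] at h
  have h1 : v = v⁻¹ := by simpa using h
  have h2 : v * v = 1 := by nth_rewrite 2 [h1]; simp
  obtain ⟨k, hk⟩ := hv.2
  apply hv.1
  have h4 := pow_orderOf_eq_one v
  rw [hk, pow_succ, pow_mul, pow_two, h2] at h4
  simpa using h4

theorem norm_cen {z v : G} (h : z * v * z⁻¹ = v⁻¹) {x : G} (hx : x ∈ cen v) : z * x * z⁻¹ ∈ cen v := by
  have := (cen_conj h x).1 hx
  rw [mem_cen] at this ⊢
  have h2 : Commute (z * x * z⁻¹) v⁻¹ := this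
  have h3 := h2.inv_right
  rw [inv_inv] at h3
  exact h3

theorem inverts_all (hF : CA G) {z v : G} (hz : Iso z) (hv : NT v) (h : z * v * z⁻¹ = v⁻¹) {x : G}
    (hx : x ∈ cen v) (ho : Odd (orderOf x)) : z * x * z⁻¹ = x⁻¹ := by
  have h1 := norm_cen h hx
  have hab := cen_ab hF hv
  set y := z * x * z⁻¹ with hy
  have hoy : orderOf y = orderOf x := MulEquiv.orderOf_eq (MulAut.conj z) x
  have hc : Commute y x := hab _ h1 _ hx
  have hzy : z * y * z⁻¹ = x := by
    rw [hy, hz.inv]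
    calc z * (z * x * z) * z = (z * z) * x * (z * z) := by group
      _ = x := by rw [hz.sq]; simp
  have hcz : z * (y * x) * z⁻¹ = y * x := by
    calc z * (y * x) * z⁻¹ = (z * y * z⁻¹) * (z * x * z⁻¹) := by group
      _ = x * y := by rw [hzy]
      _ = y * x := hc.symm
  by_cases h1' : y * x = 1
  · exact eq_inv_of_mul_eq_one_left h1'
  · exfalso
    have hodd : Odd (orderOf (y * x)) := by
      refine Odd.of_dvd_nat ?_ hc.orderOf_mul_dvd_lcm
      rw [hoy, Nat.lcm_self]; exact ho
    have hm : y * x ∈ cen v := mul_mem h1 hx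
    have := cen_eq hF ⟨h1', hodd⟩ hv (mem_cen.1 hm)
    apply not_mem_cen hv h
    rw [← this, mem_cen]
    rwa [mul_inv_eq_iff_eq_mul] at hcz

theorem coprime_cen (hS : SP G) (hF : CA G) {z v : G} (hz : Iso z) (hv : NT v) (h : z * v * z⁻¹ = v⁻¹) :
    Nat.Coprime (tor (cen v)) (Nat.card (cen z)) := by
  rw [Nat.coprime_iff_gcd_eq_one]
  by_contra hne
  obtain ⟨p, hp, hpd⟩ := Nat.exists_prime_and_dvd hne
  have hp1 := hpd.trans (Nat.gcd_dvd_left _ _)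
  have hp2 := hpd.trans (Nat.gcd_dvd_right _ _)
  have : Fact p.Prime := ⟨hp⟩
  obtain ⟨y, hy⟩ := exists_prime_orderOf_dvd_card' p hp2
  have hyo : orderOf (y : G) = p := by rw [← hy]; simp
  have hyz := mem_cen.1 y.2
  obtain ⟨g, -, hg2⟩ := conj_into hS hF hv hp hp1 y hyo
  have hzA := (hg2 z).1 (mem_cen.2 hyz.symm)
  have hzA2 := norm_cen h hzA
  have hc := cen_ab hF hv _ hzA _ hzA2
  have h3 := hz.iso (g⁻¹ * z * g) (by
    have e1 : z * (g⁻¹ * z * g * z * (g⁻¹ * z * g)⁻¹) =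
      g⁻¹ * ((g * z * g⁻¹) * (z * (g * z * g⁻¹) * z⁻¹)) * g := by group
    rw [e1, hc]; group)
  have h4 : z * (g * z * g⁻¹) * z⁻¹ = g * z * g⁻¹ := by
    have e1 : z * (g * z * g⁻¹) * z⁻¹ = g * (g⁻¹ * z * g * z * (g⁻¹ * z * g)⁻¹) * g⁻¹ := by group
    rw [e1, h3]
  have h5 := hz.iso g (by rwa [mul_inv_eq_iff_eq_mul] at h4)
  rw [h5] at hzA
  exact not_mem_cen hv h hzA

theorem cen_transitive (hF : CA G) {z u v : G} (hz : Iso z) (hu : NT u) (hv : NT v)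
    (hzu : z * u * z⁻¹ = u⁻¹) (hzv : z * v * z⁻¹ = v⁻¹) (hcj : CJ (cen u) (cen v)) :
    ∃ h ∈ cen z, ∀ x, x ∈ cen u ↔ h * x * h⁻¹ ∈ cen v := by
  obtain ⟨g, hg⟩ := hcj
  set y := g⁻¹ * z * g with hy
  have hgu : g * u * g⁻¹ ∈ cen v := (hg u).1 (mem_cen.2 rfl)
  have hinv := inverts_all hF hz hv hzv hgu (hu.conj g).2
  have hyu : y * u * y⁻¹ = u⁻¹ := by
    calc y * u * y⁻¹ = g⁻¹ * (z * (g * u * g⁻¹) * z⁻¹) * g := by rw [hy]; group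
      _ = u⁻¹ := by rw [hinv]; group
  have hzy : z * y ∈ cen u := by
    rw [mem_cen, ← mul_inv_eq_iff_eq_mul]
    calc z * y * u * (z * y)⁻¹ = z * (y * u * y⁻¹) * z⁻¹ := by group
      _ = (z * u * z⁻¹)⁻¹ := by rw [hyu]; group
      _ = u := by rw [hzu]; simp
  have hodd : Odd (orderOf (z * y)) := by
    have := hz.prod_odd g⁻¹
    rwa [inv_inv] at this
  have hinv2 := inverts_all hF hz hu hzu hzy hodd
  obtain ⟨k, hk⟩ := inv_conj hodd hinv2
  rw [← mul_assoc z z y, hz.sq, one_mul] at hk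
  set w := (z * y) ^ k with hw
  have hwm : w ∈ cen u := pow_mem hzy k
  refine ⟨g * w⁻¹, ?_, ?_⟩
  · rw [mem_cen]
    calc g * w⁻¹ * z = g * (w⁻¹ * z * w) * w⁻¹ := by group
      _ = z * (g * w⁻¹) := by rw [hk, hy]; group
  · intro x
    rw [cen_conj (u := u) (v := u) (g := w⁻¹) (by
      have := mem_cen.1 (inv_mem hwm)
      rw [this]; group) x, hg]
    have : g * (w⁻¹ * x * w⁻¹⁻¹) * g⁻¹ = g * w⁻¹ * x * (g * w⁻¹)⁻¹ := by group
    rw [this]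
end


section
variable {G : Type*} [Group G] [Finite G]

open scoped Pointwise in
theorem orbit_dvd (C : Subgroup G) (A : Subgroup G) (O : Finset (Subgroup G))
    (hO : ∀ B, B ∈ O ↔ ∃ h ∈ C, ∀ x, x ∈ A ↔ h * x * h⁻¹ ∈ B) : O.card ∣ Nat.card C := by
  letI : MulAction C (Subgroup G) := MulAction.compHom (Subgroup G) ((MulAut.conj : G →* MulAut G).comp C.subtype)
  have h1 := MulAction.index_stabilizer C A
  have h2 : (O : Set (Subgroup G)) = MulAction.orbit C A := by
    ext B
    rw [Finset.mem_coe, hO, MulAction.mem_orbit_iff]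
    constructor
    · rintro ⟨h, hh, hx⟩
      refine ⟨⟨h, hh⟩, ?_⟩
      show MulAut.conj h • A = B
      ext y
      rw [Subgroup.mem_pointwise_smul_iff_inv_smul_mem]
      show (MulAut.conj h)⁻¹ y ∈ A ↔ _
      rw [hx, ← map_inv]
      simp [mul_assoc]
    · rintro ⟨⟨h, hh⟩, hx⟩
      refine ⟨h, hh, ?_⟩
      change MulAut.conj h • A = B at hx
      intro x
      rw [← hx]
      exact (Subgroup.smul_mem_pointwise_smul_iff (a := MulAut.conj h) (S := A) (x := x)).symm
  rw [← h2, Set.ncard_coe_finset] at h1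
  rw [← h1]
  exact Subgroup.index_dvd_card _

theorem class_card (z : G) (X : Finset G) (hX : ∀ x, x ∈ X ↔ ∃ g, g * z * g⁻¹ = x) :
    X.card * Nat.card (cen z) = Nat.card G := by
  have h1 := MulAction.index_stabilizer (ConjAct G) z
  have h2 : (X : Set G) = MulAction.orbit (ConjAct G) z := by
    ext B
    rw [Finset.mem_coe, hX, MulAction.mem_orbit_iff]
    constructor
    · rintro ⟨g, hg⟩
      exact ⟨ConjAct.toConjAct g, by rw [ConjAct.smul_def]; simpa using hg⟩
    · rintro ⟨g, hg⟩
      exact ⟨ConjAct.ofConjAct g, by rw [ConjAct.smul_def] at hg; simpa using hg⟩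
  rw [← h2, Set.ncard_coe_finset] at h1
  have h3 := Subgroup.index_mul_card (MulAction.stabilizer (ConjAct G) z)
  rw [h1] at h3
  have h4 := Subgroup.nat_card_centralizer_nat_card_stabilizer z
  rw [h4, h3]
  rfl

/-- counting over the class of an isolated involution -/
theorem fib [Fintype G] [DecidableEq G] [DecidableEq (Subgroup G)] (hF : CA G) {z : G} (hz : Iso z) (X I1 : Finset G)
    (hX : ∀ x, x ∈ X ↔ ∃ g, g * z * g⁻¹ = x)
    (hI : ∀ v, v ∈ I1 ↔ NT v ∧ z * v * z⁻¹ = v⁻¹)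
    (T : Subgroup G → Finset G) (hT : ∀ A x, x ∈ T A ↔ x ∈ A ∧ Odd (orderOf x)) (f : G → ℂ) :
    ∑ x ∈ X, f (z * x) = f 1 + ∑ A ∈ I1.image cen, (∑ v ∈ T A, f v - f 1) := by
  have h1 : ∑ x ∈ X, f (z * x) = ∑ v ∈ insert 1 I1, f v := by
    refine Finset.sum_bij (fun x _ => z * x) ?_ ?_ ?_ ?_
    · intro x hx
      obtain ⟨g, rfl⟩ := (hX x).1 hx
      rw [Finset.mem_insert]
      by_cases h : z * (g * z * g⁻¹) = 1
      · exact Or.inl h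
      · right
        rw [hI]
        refine ⟨⟨h, hz.prod_odd g⟩, ?_⟩
        have : (g * z * g⁻¹)⁻¹ = g * z * g⁻¹ := by
          rw [mul_inv_rev, mul_inv_rev, inv_inv, hz.inv, mul_assoc]
        rw [mul_inv_rev, this, hz.inv, ← mul_assoc z z, hz.sq, one_mul]
    · intro a _ b _ h
      exact mul_left_cancel h
    · intro v hv
      rw [Finset.mem_insert] at hv
      have hh : ∃ g, g * z * g⁻¹ = z * v := by
        rcases hv with rfl | hv
        · exact ⟨1, by simp⟩
        · obtain ⟨hn, hi⟩ := (hI v).1 hv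
          obtain ⟨k, hk⟩ := inv_conj hn.2 hi
          exact ⟨(v ^ k)⁻¹, by rw [inv_inv]; exact hk⟩
      refine ⟨z * v, (hX _).2 hh, ?_⟩
      show z * (z * v) = v
      rw [← mul_assoc, hz.sq, one_mul]
    · intros; rfl
  have h2 : (1 : G) ∉ I1 := fun h => ((hI 1).1 h).1.1 rfl
  rw [h1, Finset.sum_insert h2]
  congr 1
  rw [← Finset.sum_fiberwise_of_maps_to (s := I1) (t := I1.image cen) (g := cen)
    (fun v hv => Finset.mem_image_of_mem _ hv)]
  refine Finset.sum_congr rfl ?_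
  intro A hA
  obtain ⟨u, hu, rfl⟩ := Finset.mem_image.1 hA
  obtain ⟨hun, hui⟩ := (hI u).1 hu
  have h3 : T (cen u) = insert 1 (I1.filter (fun v => cen v = cen u)) := by
    ext v
    rw [hT, Finset.mem_insert, Finset.mem_filter, hI]
    constructor
    · rintro ⟨hv, ho⟩
      by_cases h : v = 1
      · exact Or.inl h
      · right
        exact ⟨⟨⟨h, ho⟩, inverts_all hF hz hun hui hv ho⟩, cen_eq hF ⟨h, ho⟩ hun (mem_cen.1 hv)⟩
    · rintro (rfl | ⟨⟨hn, hi⟩, he⟩)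
      · exact ⟨one_mem _, by simp⟩
      · exact ⟨by rw [← he, mem_cen], hn.2⟩
  rw [h3, Finset.sum_insert (by simp [h2])]
  ring

theorem final_count (hS : SP G) (hF : CA G) {z : G} (hz : Iso z) (I1 : Finset G) 
    (hI : ∀ v, v ∈ I1 ↔ NT v ∧ z * v * z⁻¹ = v⁻¹) [DecidableEq (Subgroup G)] (c : ℕ)
    (hc : c * Nat.card (cen z) = Nat.card G)
    (e1 : c + 3 = 3 * (I1.image cen).card) (e2 : ∑ A ∈ I1.image cen, tor A + 4 = 4 * (I1.image cen).card) :
    False := by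
  classical
  set J := I1.image cen with hJ
  have hJm : ∀ A ∈ J, ∃ v, NT v ∧ z * v * z⁻¹ = v⁻¹ ∧ A = cen v := by
    intro A hA
    obtain ⟨v, hv, rfl⟩ := Finset.mem_image.1 hA
    exact ⟨v, ((hI v).1 hv).1, ((hI v).1 hv).2, rfl⟩
  have h3 : ∃ A ∈ J, tor A = 3 := by
    by_contra hcon
    push Not at hcon
    have : ∑ A ∈ J, 4 ≤ ∑ A ∈ J, tor A := by
      refine Finset.sum_le_sum ?_
      intro A hA
      obtain ⟨v, hv, -, rfl⟩ := hJm A hA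
      have := tor_ge hF hv
      have := hcon _ hA
      omega
    rw [Finset.sum_const, smul_eq_mul] at this
    omega
  obtain ⟨A₁, hA₁, ht₁⟩ := h3
  obtain ⟨v₁, hv₁, hz₁, rfl⟩ := hJm _ hA₁
  have hdvd : ∀ v, NT v → z * v * z⁻¹ = v⁻¹ → tor (cen v) ∣ c := by
    intro v hv hzv
    have h1 := tor_dvd hF hv
    rw [← hc] at h1
    exact (coprime_cen hS hF hz hv hzv).dvd_of_dvd_mul_right h1
  have hO : ∀ v, NT v → z * v * z⁻¹ = v⁻¹ → (J.filter (fun A => CJ (cen v) A)).card ∣ Nat.card (cen z) := by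
    intro v hv hzv
    apply orbit_dvd (cen z) (cen v)
    intro B
    rw [Finset.mem_filter]
    constructor
    · rintro ⟨hB, hcj⟩
      obtain ⟨w, hw, hzw, rfl⟩ := hJm _ hB
      exact cen_transitive hF hz hv hw hzv hzw hcj
    · rintro ⟨h, hh, hx⟩
      refine ⟨?_, h, hx⟩
      have hB : B = cen (h * v * h⁻¹) := by
        ext y
        have e := hx (h⁻¹ * y * h)
        have e2 := cen_conj (u := v) (g := h) rfl (h⁻¹ * y * h)
        have e3 : h * (h⁻¹ * y * h) * h⁻¹ = y := by group
        rw [e3] at e e2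
        rw [← e, ← e2]
      rw [hB, hJ]
      refine Finset.mem_image_of_mem _ ((hI _).2 ⟨hv.conj h, ?_⟩)
      have hc := mem_cen.1 hh
      have : z * (h * v * h⁻¹) * z⁻¹ = (z * h) * v * (z * h)⁻¹ := by group
      rw [this, ← hc]
      calc h * z * v * (h * z)⁻¹ = h * (z * v * z⁻¹) * h⁻¹ := by group
        _ = _ := by rw [hzv]; group
  by_cases hall : ∀ A ∈ J, CJ (cen v₁) A
  · have : ∑ A ∈ J, tor A = ∑ A ∈ J, 3 := Finset.sum_congr rfl (fun A hA => by
      rw [← tor_cj (hall A hA), ht₁])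
    rw [Finset.sum_const, smul_eq_mul] at this
    have hc9 : c = 9 := by omega
    obtain ⟨P, hP⟩ := sylow_le_cen hS hF hv₁ Nat.prime_three (by rw [ht₁])
    have : Fact (Nat.Prime 3) := ⟨Nat.prime_three⟩
    have h9 : 3 ^ 2 ∣ Nat.card P := by
      apply P.pow_dvd_card_of_pow_dvd_card
      rw [← hc, hc9]; exact Dvd.intro _ rfl
    have h9' : 9 ≤ Nat.card P := Nat.le_of_dvd Nat.card_pos h9
    have hle : Nat.card P ≤ tor (cen v₁) := by
      apply Nat.card_le_card_of_injective
        (fun x : P => (⟨x, hP x x.2, by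
          obtain ⟨k, hk⟩ := (IsPGroup.iff_orderOf.1 P.2) x
          have : orderOf (x : G) = 3 ^ k := by rw [← hk]; simp
          rw [this]
          exact Odd.pow (by decide)⟩ : {x : G // x ∈ cen v₁ ∧ Odd (orderOf x)}))
      intro a b hab
      exact Subtype.ext (Subtype.mk.inj hab)
    omega
  · push Not at hall
    obtain ⟨A₂, hA₂, hn⟩ := hall
    obtain ⟨v₂, hv₂, hz₂, rfl⟩ := hJm _ hA₂
    have hdv : ¬ 3 ∣ tor (cen v₂) := fun h =>
      hn (cj_of_prime hS hF hv₂ hv₁ Nat.prime_three h (by rw [ht₁]))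
    have ho := tor_odd hF hv₂
    have hg := tor_ge hF hv₂
    set a := tor (cen v₂) with ha
    have h5 : 5 ≤ a := by
      obtain ⟨k, hk⟩ := ho
      rcases Nat.lt_or_ge a 5 with h | h
      · have : a = 3 := by omega
        exact absurd (by rw [this]) hdv
      · exact h
    have hrest : ∀ A ∈ J, ¬ CJ (cen v₁) A → tor A = a := by
      intro A hA hnA
      obtain ⟨w, hw, hzw, rfl⟩ := hJm _ hA
      have hw5 : 5 ≤ tor (cen w) := by
        have := tor_ge hF hw
        obtain ⟨k, hk⟩ := tor_odd hF hw
        rcases Nat.lt_or_ge (tor (cen w)) 5 with h | h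
        · have : tor (cen w) = 3 := by omega
          exact absurd (cj_of_prime hS hF hw hv₁ Nat.prime_three (by rw [this]) (by rw [ht₁])) hnA
        · exact h
      by_contra hne
      refine two_classes hS hF hv₁ hv₂ hw h5 hw5 hn hnA ?_
      intro h
      exact hne (tor_cj h).symm
    have hsum : ∑ A ∈ J, tor A = 3 * (J.filter (fun A => CJ (cen v₁) A)).card
        + a * (J.filter (fun A => ¬ CJ (cen v₁) A)).card := by
      rw [← Finset.sum_filter_add_sum_filter_not J (fun A => CJ (cen v₁) A)]
      congr 1
      · rw [Finset.sum_congr rfl (g := fun _ => 3) (fun A hA => by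
          rw [← tor_cj (Finset.mem_filter.1 hA).2, ht₁]), Finset.sum_const, smul_eq_mul, mul_comm]
      · rw [Finset.sum_congr rfl (g := fun _ => a) (fun A hA => 
          hrest A (Finset.mem_filter.1 hA).1 (Finset.mem_filter.1 hA).2), Finset.sum_const, smul_eq_mul, mul_comm]
    have hkd := hO v₁ hv₁ hz₁
    set k₁ := (J.filter (fun A => CJ (cen v₁) A)).card with hk₁
    set k₂ := (J.filter (fun A => ¬ CJ (cen v₁) A)).card with hk₂
    have hcop3 : Nat.Coprime a 3 := ((Nat.Prime.coprime_iff_not_dvd Nat.prime_three).2 hdv).symm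
    have hac : a ∣ c := hdvd v₂ hv₂ hz₂
    have h1 : 1 ≤ J.card := Finset.card_pos.2 ⟨_, hA₁⟩
    have hcN : c = 3 * (J.card - 1) := by omega
    have haN : a ∣ J.card - 1 := hcop3.dvd_of_dvd_mul_left (hcN ▸ hac)
    have hak : a ∣ 3 * k₁ := by
      have : 3 * k₁ + a * k₂ = 4 * (J.card - 1) := by omega
      rw [Nat.dvd_add_iff_left (Dvd.intro k₂ rfl : a ∣ a * k₂), this]
      exact haN.mul_left 4
    have hak' : a ∣ k₁ := hcop3.dvd_of_dvd_mul_left hak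
    have := Nat.Coprime.eq_one_of_dvd (coprime_cen hS hF hz hv₂ hz₂) (hak'.trans hkd)
    omega

theorem step_one [Nontrivial G] (hG : commutator G = ⊤) (ρ : G →* GL (Fin 3) ℂ) (hρ : Function.Injective ρ)
    (hsub : ∀ H : Subgroup G, H ≠ ⊤ → EmbGL H 2) : EmbGL G 2 := by
  classical
  by_contra hirr
  have := Fintype.ofFinite G
  have hS := SP_of_perfect hG ρ hρ hsub
  have hF : CA G := fun v hv x y => centralizer_abelian hG hS ρ hρ v hv.1 hv.2 x y
  have hdet := det_one_of_perfect hG ρ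
  have h2 := two_dvd_card hG hS
  obtain ⟨z, hz, hziso⟩ : ∃ z : G, Iso z ∧ True := by
    obtain ⟨P⟩ : Nonempty (Sylow 2 G) := inferInstance
    have hPn : Nontrivial P := by
      rw [← Finite.one_lt_card_iff_nontrivial]
      have : 2 ^ 1 ∣ Nat.card P := P.pow_dvd_card_of_pow_dvd_card (by simpa using h2)
      have := Nat.le_of_dvd Nat.card_pos this
      omega
    have hc := P.2.center_nontrivial
    have hpc : IsPGroup 2 (Subgroup.center P) := P.2.to_subgroup _
    obtain ⟨n, hn, hcard⟩ := (IsPGroup.nontrivial_iff_card hpc).1 hc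
    obtain ⟨y, hy⟩ := exists_prime_orderOf_dvd_card' (G := Subgroup.center P) 2
      (by rw [hcard]; exact dvd_pow_self 2 (by omega))
    have hy1 : y ≠ 1 := by
      intro h
      rw [h, orderOf_one] at hy
      omega
    have hy2 : y * y = 1 := by
      have := pow_orderOf_eq_one y
      rwa [hy, pow_two] at this
    have hz1 : ((y : P) : G) ≠ 1 := by
      intro h
      apply hy1
      exact Subtype.ext (Subtype.ext h)
    have hz2 : ((y : P) : G) * ((y : P) : G) = 1 :=
      congrArg (fun t : Subgroup.center P => ((t : P) : G)) hy2
    refine ⟨((y : P) : G), ⟨hz1, hz2, isolated hG hS ρ hρ hz1 hz2 P ?_⟩, trivial⟩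
    intro x hx
    exact congrArg Subtype.val ((Subgroup.mem_center_iff.1 y.2) ⟨x, hx⟩)
  let X : Finset G := Finset.univ.filter (fun x => ∃ g, g * z * g⁻¹ = x)
  let I1 : Finset G := Finset.univ.filter (fun v => NT v ∧ z * v * z⁻¹ = v⁻¹)
  let T : Subgroup G → Finset G := fun A => Finset.univ.filter (fun x => x ∈ A ∧ Odd (orderOf x))
  have hX : ∀ x, x ∈ X ↔ ∃ g, g * z * g⁻¹ = x := fun x => by simp [X]
  have hI : ∀ v, v ∈ I1 ↔ NT v ∧ z * v * z⁻¹ = v⁻¹ := fun v => by simp [I1]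
  have hT : ∀ A x, x ∈ T A ↔ x ∈ A ∧ Odd (orderOf x) := fun A x => by simp [T]
  have htor : ∀ A, (T A).card = tor A := by
    intro A
    rw [tor, Nat.card_eq_fintype_card, Fintype.card_subtype]
  have f1 := fib hF hz X I1 hX hI T hT (fun _ => 1)
  have f2 := fib hF hz X I1 hX hI T hT (fun x => (ρ x).1.trace)
  have f3 := class_trace ρ hρ hdet hirr X (by
    intro g x hx
    obtain ⟨k, rfl⟩ := (hX x).1 hx
    exact (hX _).2 ⟨g * k, by group⟩) (by
    intro x hx
    obtain ⟨k, rfl⟩ := (hX x).1 hx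
    apply invol_trace ρ hρ hdet
    · simpa using hz.ne
    · have : k * z * k⁻¹ * (k * z * k⁻¹) = k * (z * z) * k⁻¹ := by group
      rw [this, hz.sq]; simp) z ((hX z).2 ⟨1, by simp⟩)
  have f4 : ∀ A ∈ I1.image cen, ∑ v ∈ T A, (ρ v).1.trace = tor A := by
    intro A hA
    obtain ⟨v, hv, rfl⟩ := Finset.mem_image.1 hA
    obtain ⟨hvn, hvi⟩ := (hI v).1 hv
    rw [← htor]
    refine torus_trace ρ hρ hdet z v hvn.1 (T (cen v)) ((hT _ _).2 ⟨mem_cen.2 rfl, hvn.2⟩) ?_ ?_ ?_ ?_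
    · intro x hx; exact mem_cen.1 ((hT _ _).1 hx).1
    · intro x hx; exact ((hT _ _).1 hx).2
    · intro x hx; exact inverts_all hF hz hvn hvi ((hT _ _).1 hx).1 ((hT _ _).1 hx).2
    · intro x hx
      obtain ⟨h1, h2⟩ := (hT _ _).1 hx
      refine (hT _ _).2 ⟨mul_mem (mem_cen.2 rfl) h1, ?_⟩
      have hcm : Commute v x := (mem_cen.1 h1).symm
      exact Odd.of_dvd_nat (hvn.2.mul h2) (hcm.orderOf_mul_dvd_mul_orderOf)
  rw [f2] at f3
  have e1 : (X.card : ℂ) = 1 + (∑ A ∈ I1.image cen, (tor A : ℂ) - (I1.image cen).card) := by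
    simpa [htor, Finset.sum_sub_distrib] using f1
  have e2 : ∑ A ∈ I1.image cen, (∑ v ∈ T A, (ρ v).1.trace - (ρ 1).1.trace)
      = ∑ A ∈ I1.image cen, (tor A : ℂ) - 3 * (I1.image cen).card := by
    have h3 : (ρ 1).1.trace = 3 := by simp
    rw [Finset.sum_congr rfl (fun A hA => by rw [f4 A hA, h3]), Finset.sum_sub_distrib]
    simp [mul_comm]
  have h3 : (ρ 1).1.trace = 3 := by simp
  rw [e2, h3] at f3
  refine final_count hS hF hz I1 hI X.card (class_card z X hX) ?_ ?_
  · have : ((X.card + 3 : ℕ) : ℂ) = ((3 * (I1.image cen).card : ℕ) : ℂ) := by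
      push_cast; linear_combination (3/2 : ℂ) * e1 + (1/2 : ℂ) * f3
    exact_mod_cast this
  · have : ((∑ A ∈ I1.image cen, tor A + 4 : ℕ) : ℂ) = ((4 * (I1.image cen).card : ℕ) : ℂ) := by
      push_cast; linear_combination (1/2 : ℂ) * e1 + (1/2 : ℂ) * f3
    exact_mod_cast this
end


theorem EmbGL.pad {H : Type*} [Group H] {n : ℕ} (h : EmbGL H n) : EmbGL H (n + 1) := by
  obtain ⟨ρ, hρ⟩ := h
  let F : H →* Matrix (Fin (n + 1)) (Fin (n + 1)) ℂ :=
    { toFun := fun g => Matrix.reindexAlgEquiv ℂ ℂ (finSumFinEquiv (m := n) (n := 1))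
        (Matrix.fromBlocks (ρ g).1 0 0 (1 : Matrix (Fin 1) (Fin 1) ℂ))
      map_one' := by
        rw [map_one, Units.val_one, Matrix.fromBlocks_one, map_one]
      map_mul' := by
        intro x y
        rw [← map_mul, Matrix.fromBlocks_multiply]
        simp }
  refine ⟨F.toHomUnits, ?_⟩
  rw [injective_iff_map_eq_one]
  intro g hg
  have h1 : F g = 1 := congrArg Units.val hg
  have h2 : Matrix.fromBlocks (ρ g).1 0 0 (1 : Matrix (Fin 1) (Fin 1) ℂ) = 1 := by
    apply (Matrix.reindexAlgEquiv ℂ ℂ (finSumFinEquiv (m := n) (n := 1))).injective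
    rw [map_one]; exact h1
  rw [← Matrix.fromBlocks_one] at h2
  have h3 := (Matrix.fromBlocks_inj.1 h2).1
  apply hρ
  rw [map_one]
  exact Units.ext h3

theorem EmbGL.pad_le {H : Type*} [Group H] {n m : ℕ} (h : EmbGL H n) (hnm : n ≤ m) : EmbGL H m := by
  induction hnm with
  | refl => exact h
  | step _ ih => exact ih.pad

theorem scal2 {H : Type*} [Group H] [Finite H] (σ : H →* GL (Fin 2) ℂ) (hσ : Function.Injective σ)
    {t x : H} (htx : t * x ≠ x * t) (c : H) (ht : c * t = t * c) (hx : c * x = x * c) :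
    ∃ l : ℂ, (σ c).1 = l • (1 : Matrix (Fin 2) (Fin 2) ℂ) := by
  have hcomm : ∀ {a b : H}, a * b = b * a → (σ a).1 * (σ b).1 = (σ b).1 * (σ a).1 := by
    intro a b h
    rw [← Units.val_mul, ← map_mul, h, map_mul, Units.val_mul]
  have hsplit : ∀ {Q : GL (Fin 2) ℂ} {a b : H} {d : Fin 2 → ℂ},
      (σ a).1 * Q.1 = Q.1 * Matrix.diagonal d → b * a = a * b → d 0 ≠ d 1 →
      ∃ e : Fin 2 → ℂ, (σ b).1 * Q.1 = Q.1 * Matrix.diagonal e := by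
    intro Q a b d hd hab hne
    apply diag_of_comm
    intro i j hij
    refine ⟨(σ a).1, d, hd, ?_, hcomm hab⟩
    fin_cases i <;> fin_cases j <;> simp_all
    exact fun h => hne h.symm
  have hscal : ∀ {Q : GL (Fin 2) ℂ} {a : H} {d : Fin 2 → ℂ},
      (σ a).1 * Q.1 = Q.1 * Matrix.diagonal d → d 0 = d 1 → (σ a).1 = d 0 • (1 : Matrix (Fin 2) (Fin 2) ℂ) := by
    intro Q a d hd he
    have h1 : Matrix.diagonal d = d 0 • (1 : Matrix (Fin 2) (Fin 2) ℂ) := by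
      ext i j; fin_cases i <;> fin_cases j <;> simp [he]
    rw [h1] at hd
    have h2 := congrArg (fun N => N * (Q⁻¹).1) hd
    simp only [mul_assoc, Matrix.mul_smul, Matrix.smul_mul, ← Units.val_mul, mul_inv_cancel, mul_one] at h2
    simpa using h2
  obtain ⟨Q, d, hd⟩ := diag_exists σ x
  have hd01 : d 0 ≠ d 1 := by
    intro h
    apply htx
    apply hσ
    rw [map_mul, map_mul]
    apply Units.ext
    rw [Units.val_mul, Units.val_mul, hscal hd h]
    simp
  obtain ⟨e, he⟩ := hsplit hd hx hd01
  by_cases h : e 0 = e 1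
  · exact ⟨e 0, hscal he h⟩
  · obtain ⟨f, hf⟩ := hsplit he ht.symm h
    exact absurd (diag_comm σ hσ hf hd) htx

theorem block3 {G : Type*} [Group G] (ρ : G →* GL (Fin 3) ℂ) (hρ : Function.Injective ρ) {z : G}
    (hz : ∀ g, g * z = z * g) {Q : GL (Fin 3) ℂ} {k : Fin 3}
    (hd : (ρ z).1 * Q.1 = Q.1 * Matrix.diagonal (fun i => if i = k then 1 else -1)) :
    ∃ (χ : G →* ℂ) (θ : G →* Matrix (Fin 2) (Fin 2) ℂ), ∀ g, χ g = 1 → θ g = 1 → g = 1 := by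
  let R : G →* GL (Fin 3) ℂ := (MulAut.conj Q⁻¹).toMonoidHom.comp ρ
  have hR : ∀ g, R g = Q⁻¹ * ρ g * Q := fun g => by simp [R]
  have hRz : (R z).1 = Matrix.diagonal (fun i => if i = k then 1 else -1) := by
    rw [hR, mul_assoc, Units.val_mul, Units.val_mul, hd, ← mul_assoc, ← Units.val_mul, inv_mul_cancel]
    simp
  have hc : ∀ g, (R g).1 * (R z).1 = (R z).1 * (R g).1 := by
    intro g
    rw [← Units.val_mul, ← map_mul, hz, map_mul, Units.val_mul]
  have h0 : ∀ g i, (R g).1 (k.succAbove i) k = 0 ∧ (R g).1 k (k.succAbove i) = 0 := by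
    intro g i
    have h1 := hc g
    rw [hRz] at h1
    have a := congrFun (congrFun h1 (k.succAbove i)) k
    have b := congrFun (congrFun h1 k) (k.succAbove i)
    rw [Matrix.mul_diagonal, Matrix.diagonal_mul] at a b
    simp only [Fin.succAbove_ne, if_true, if_false] at a b
    constructor
    · linear_combination (1/2 : ℂ) * a
    · linear_combination (-1/2 : ℂ) * b
  let χ : G →* ℂ :=
    { toFun := fun g => (R g).1 k k
      map_one' := by simp
      map_mul' := by
        intro x y
        rw [map_mul, Units.val_mul, Matrix.mul_apply, Fin.sum_univ_succAbove _ k]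
        rw [Finset.sum_eq_zero (fun i _ => by rw [(h0 x i).2, zero_mul]), add_zero] }
  let θ : G →* Matrix (Fin 2) (Fin 2) ℂ :=
    { toFun := fun g => (R g).1.submatrix k.succAbove k.succAbove
      map_one' := by
        rw [map_one, Units.val_one]
        exact Matrix.submatrix_one _ (Fin.succAbove_right_injective)
      map_mul' := by
        intro x y
        ext i j
        rw [map_mul, Units.val_mul, Matrix.submatrix_apply, Matrix.mul_apply, Fin.sum_univ_succAbove _ k,
          (h0 x i).1, zero_mul, zero_add, Matrix.mul_apply]
        rfl }
  refine ⟨χ, θ, ?_⟩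
  intro g h1 h2
  have h3 : R g = 1 := by
    apply Units.ext
    ext i j
    rw [Units.val_one]
    rcases Fin.eq_self_or_eq_succAbove k i with hi | ⟨i, rfl⟩ <;>
    rcases Fin.eq_self_or_eq_succAbove k j with hj | ⟨j, rfl⟩
    · rw [hi, hj, Matrix.one_apply_eq]; exact h1
    · rw [hi, (h0 g j).2, Matrix.one_apply_ne (Fin.succAbove_ne k j).symm]
    · rw [hj, (h0 g i).1, Matrix.one_apply_ne (Fin.succAbove_ne k i)]
    · have := congrFun (congrFun h2 i) j
      rw [Matrix.one_apply] at this
      rw [Matrix.one_apply]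
      simp only [Fin.succAbove_right_inj]
      exact this
  apply hρ
  rw [hR] at h3
  rw [map_one]
  have : ρ g = Q * (Q⁻¹ * ρ g * Q) * Q⁻¹ := by group
  rw [this, h3]; simp

theorem twist_emb {G : Type*} [Group G] [Finite G] (χ : G →* ℂ) (θ : G →* Matrix (Fin 2) (Fin 2) ℂ)
    (hinj : ∀ g, χ g = 1 → θ g = 1 → g = 1)
    (hcyc : ∀ p : ℕ, p.Prime → ∀ g l : G, (∀ x, g * x = x * g) → (∀ x, l * x = x * l) → orderOf g = p →
      orderOf l = p → ∃ i : ℕ, g = l ^ i) : EmbGL G 2 := by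
  classical
  let S := (Nat.card G).primeFactors.filter (fun p => ¬ ∃ l, θ l = 1 ∧ orderOf l = p)
  let m := ∏ p ∈ S, p
  have hχu : ∀ g, χ g ≠ 0 := by
    intro g h
    have h1 : χ (g * g⁻¹) = 1 := by simp
    rw [map_mul, h, zero_mul] at h1
    exact zero_ne_one h1
  let F : G →* Matrix (Fin 2) (Fin 2) ℂ :=
    { toFun := fun g => (χ g) ^ m • θ g
      map_one' := by simp
      map_mul' := by
        intro x y
        rw [map_mul, map_mul, mul_pow, Matrix.smul_mul, Matrix.mul_smul, smul_smul] }
  refine ⟨F.toHomUnits, ?_⟩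
  rw [injective_iff_map_eq_one]
  intro g₀ hg₀
  by_contra hne
  have hne' : orderOf g₀ ≠ 1 := fun h => hne (orderOf_eq_one_iff.1 h)
  obtain ⟨p, hp, hpd⟩ := Nat.exists_prime_and_dvd hne'
  have hog := orderOf_pow_orderOf_div (orderOf_pos g₀).ne' hpd
  have hF : F (g₀ ^ (orderOf g₀ / p)) = 1 := by
    rw [map_pow, show F g₀ = 1 from congrArg Units.val hg₀, one_pow]
  generalize g₀ ^ (orderOf g₀ / p) = g at hog hF
  have hF' : χ g ^ m • θ g = 1 := hF
  have hcent : ∀ l : G, (∃ c : ℂ, θ l = c • (1 : Matrix (Fin 2) (Fin 2) ℂ)) → ∀ x, l * x = x * l := by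
    rintro l ⟨c, hc⟩ x
    have h1 : l * x * (x * l)⁻¹ = 1 := by
      have hx : ∀ {M : Type} [Monoid M] (f : G →* M), f (x * l) = f (l * x) → f (l * x * (x * l)⁻¹) = 1 := by
        intro M _ f h
        rw [map_mul, ← h, ← map_mul, mul_inv_cancel, map_one]
      apply hinj
      · exact hx χ (by rw [map_mul, map_mul, mul_comm])
      · exact hx θ (by rw [map_mul, map_mul, hc]; simp)
    exact mul_inv_eq_one.1 h1
  have hgc := hcent g ⟨(χ g ^ m)⁻¹, by
    rw [← hF', smul_smul, inv_mul_cancel₀ (pow_ne_zero _ (hχu g)), one_smul]⟩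
  have hg1 : g ≠ 1 := by
    rintro rfl
    rw [orderOf_one] at hog
    exact hp.one_lt.ne hog
  have hχp : χ g ^ p = 1 := by rw [← map_pow, ← hog, pow_orderOf_eq_one, map_one]
  by_cases hl : ∃ l, θ l = 1 ∧ orderOf l = p
  · obtain ⟨l, hl1, hlo⟩ := hl
    obtain ⟨i, hi⟩ := hcyc p hp g l hgc (hcent l ⟨1, by rw [hl1, one_smul]⟩) hog hlo
    have hθ : θ g = 1 := by rw [hi, map_pow, hl1, one_pow]
    have hχm : χ g ^ m = 1 := by
      rw [hθ] at hF'
      have := congrFun (congrFun hF' 0) 0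
      simpa using this
    have hcop : Nat.Coprime m p := by
      apply Nat.Coprime.prod_left
      intro q hq
      obtain ⟨hq1, hq2⟩ := Finset.mem_filter.1 hq
      apply (Nat.coprime_primes (Nat.prime_of_mem_primeFactors hq1) hp).2
      rintro rfl
      exact hq2 ⟨l, hl1, hlo⟩
    have hχ : χ g = 1 := by
      have h1 := orderOf_dvd_of_pow_eq_one hχm
      have h2 := orderOf_dvd_of_pow_eq_one hχp
      have h3 := Nat.dvd_gcd h1 h2
      rw [hcop.gcd_eq_one, Nat.dvd_one] at h3
      exact orderOf_eq_one_iff.1 h3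
    exact hg1 (hinj g hχ hθ)
  · have hpm : p ∣ m := by
      apply Finset.dvd_prod_of_mem (fun p => p)
      refine Finset.mem_filter.2 ⟨Nat.mem_primeFactors.2 ⟨hp, ?_, Nat.card_pos.ne'⟩, hl⟩
      rw [← hog]; exact orderOf_dvd_natCard g
    obtain ⟨j, hj⟩ := hpm
    rw [hj, pow_mul, hχp, one_pow, one_smul] at hF'
    exact hl ⟨g, hF', hog⟩

/-- a finite non-solvable group has a nontrivial perfect normal subgroup -/
theorem exists_perfect {G : Type*} [Group G] [Finite G] (h : ¬ Group.IsSolvable G) :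
    ∃ K : Subgroup G, K.Normal ∧ commutator K = ⊤ ∧ K ≠ ⊥ := by
  let n := Function.argmin (fun n => Nat.card (derivedSeries G n))
  have hn : ∀ m, Nat.card (derivedSeries G n) ≤ Nat.card (derivedSeries G m) :=
    fun m => Function.argmin_le (fun n => Nat.card (derivedSeries G n)) m
  have h1 : derivedSeries G (n + 1) = derivedSeries G n :=
    Subgroup.eq_of_le_of_card_ge (derivedSeries_antitone G (Nat.le_succ n)) (hn _)
  refine ⟨derivedSeries G n, inferInstance, ?_, ?_⟩
  · rw [derivedSeries_succ] at h1
    apply Subgroup.map_injective (Subgroup.subtype_injective _)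
    rw [Subgroup.map_subtype_commutator, h1, ← MonoidHom.range_eq_map, Subgroup.range_subtype]
  · intro hb
    exact h ((Group.isSolvable_def G).2 ⟨n, hb⟩)

theorem unique_invol {K : Type*} [Group K] [Finite K] (hK : commutator K = ⊤) (σ : K →* GL (Fin 2) ℂ)
    (hσ : Function.Injective σ) {y : K} (hy : y ≠ 1) (hy2 : y * y = 1) : (σ y).1 = -1 := by
  obtain ⟨Q, d, hd⟩ := diag_exists σ y
  have h1 := det_one_of_perfect hK σ y
  rw [diag_det hd, Fin.prod_univ_two] at h1
  have hr : ∀ i, d i = 1 ∨ d i = -1 := fun i => by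
    have := diag_root σ hd (k := 2) (by rw [pow_two, hy2]) i
    exact sq_eq_one_iff.1 this
  have hdd : d = fun _ => -1 := by
    rcases hr 0 with h | h
    · exfalso
      apply hy
      rw [h, one_mul] at h1
      apply diag_inj σ hσ hd
      have : d = fun _ => 1 := by
        funext i; fin_cases i
        · exact h
        · exact h1
      rw [this]
      exact diag_one σ Q
    · rw [h] at h1
      funext i; fin_cases i
      · exact h
      · show d 1 = -1
        linear_combination -h1
  have h3 : Matrix.diagonal d = -1 := by
    rw [hdd]; ext i j; fin_cases i <;> fin_cases j <;> simp
  rw [h3] at hd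
  have h4 := congrArg (fun N => N * (Q⁻¹).1) hd
  simp only [mul_neg, neg_mul, mul_assoc, ← Units.val_mul, mul_inv_cancel, mul_one] at h4
  simpa using h4

theorem core {G : Type*} [Group G] [Finite G] (h3 : EmbGL G 3)
    (hsub : ∀ H : Subgroup G, H ≠ ⊤ → EmbGL H 2) (hns : ¬ Group.IsSolvable G) : EmbGL G 2 := by
  obtain ⟨ρ, hρ⟩ := h3
  obtain ⟨K, hKn, hKp, hKb⟩ := exists_perfect hns
  have hnt : Nontrivial K := (Subgroup.nontrivial_iff_ne_bot K).2 hKb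
  let ρK : K →* GL (Fin 3) ℂ := ρ.comp K.subtype
  have hρK : Function.Injective ρK := hρ.comp K.subtype_injective
  have hK2 : EmbGL K 2 := by
    refine step_one hKp ρK hρK ?_
    intro M hM
    have h1 : M.map K.subtype ≠ ⊤ := by
      intro h
      apply hM
      rw [Subgroup.eq_top_iff']
      intro x
      have hx : (x : G) ∈ M.map K.subtype := by rw [h]; trivial
      obtain ⟨y, hy, hyx⟩ := hx
      rwa [← K.subtype_injective hyx]
    exact (hsub _ h1).sub (M.equivMapOfInjective K.subtype K.subtype_injective).toMonoidHom
      (M.equivMapOfInjective K.subtype K.subtype_injective).injective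
  have hS := SP_of_GL2 hK2
  obtain ⟨σ, hσ⟩ := hK2
  -- the central involution
  obtain ⟨z, hzo⟩ := exists_prime_orderOf_dvd_card' (G := K) 2 (two_dvd_card hKp hS)
  have hz1 : z ≠ 1 := by
    rintro rfl
    rw [orderOf_one] at hzo
    omega
  have hz2 : z * z = 1 := by
    have := pow_orderOf_eq_one z
    rwa [hzo, pow_two] at this
  have hzc : ∀ g : G, g * z = z * g := by
    intro g
    let w : K := ⟨g * z * g⁻¹, hKn.conj_mem z z.2 g⟩
    have hw2 : w * w = 1 := by
      apply Subtype.ext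
      show g * z * g⁻¹ * (g * z * g⁻¹) = 1
      have h1 : (z : G) * z = 1 := congrArg Subtype.val hz2
      have : g * z * g⁻¹ * (g * z * g⁻¹) = g * (z * z : G) * g⁻¹ := by group
      rw [this, h1]; simp
    have hw1 : w ≠ 1 := by
      intro h
      have h1 : g * z * g⁻¹ = 1 := congrArg Subtype.val h
      apply hz1
      apply Subtype.ext
      simpa using h1
    have hwz : w = z := by
      apply hσ
      apply Units.ext
      exact (unique_invol hKp σ hσ hw1 hw2).trans (unique_invol hKp σ hσ hz1 hz2).symm
    have := congrArg Subtype.val hwz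
    exact mul_inv_eq_iff_eq_mul.1 this
  obtain ⟨Q, d, hd⟩ := diag_exists ρK z
  obtain ⟨k, rfl⟩ := invol_diag ρK hρK (det_one_of_perfect hKp ρK) hz1 hz2 hd
  obtain ⟨χ, θ, hinj⟩ := block3 ρ hρ (z := (z : G)) hzc (Q := Q) (k := k) hd
  -- an odd prime
  have hodd : ∃ p, p.Prime ∧ p ≠ 2 ∧ p ∣ Nat.card K := by
    by_contra hcon
    push Not at hcon
    have hpow : IsPGroup 2 K := by
      apply IsPGroup.of_card (n := (Nat.card K).primeFactorsList.length)
      apply Nat.eq_prime_pow_of_unique_prime_dvd Nat.card_pos.ne'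
      intro q hq hqd
      by_contra h
      exact hcon q hq h hqd
    have : Group.IsNilpotent K := hpow.isNilpotent
    have hlt := Group.IsSolvable.commutator_lt_top_of_nontrivial K
    exact hlt.ne hKp
  obtain ⟨p, hp, hp2, hpd⟩ := hodd
  have : Fact p.Prime := ⟨hp⟩
  obtain ⟨P⟩ : Nonempty (Sylow p K) := inferInstance
  have hab := sylow_abelian hS hp2 P
  obtain ⟨t, ht, htn⟩ := exists_noncentral hKp hS P hab hpd
  push Not at htn
  obtain ⟨x, hx, htx⟩ := htn
  let P' : Subgroup G := (P : Subgroup K).map K.subtype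
  let H : Subgroup G := Subgroup.normalizer (P' : Set G)
  have hmem : ∀ y : K, (y : G) ∈ P' ↔ y ∈ P := by
    intro y
    constructor
    · rintro ⟨w, hw, hwy⟩
      rwa [← K.subtype_injective hwy]
    · intro hy
      exact ⟨y, hy, rfl⟩
  have hH : H ≠ ⊤ := by
    intro h
    have hN : (P : Subgroup K).Normal := by
      refine ⟨?_⟩
      intro y hy g
      have hg : (g : G) ∈ H := by rw [h]; trivial
      have := (Subgroup.mem_normalizer_iff.1 hg (y : G)).1 ((hmem y).2 hy)
      exact (hmem (g * y * g⁻¹)).1 this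
    exact htx (normal_abelian_central hKp ρK hρK P hab hN t x hx)
  have hxH : (x : G) ∈ H := Subgroup.le_normalizer ((hmem x).2 hx)
  have htH : (t : G) ∈ H := by
    apply Subgroup.mem_normalizer_iff.2
    have ht' := Subgroup.mem_normalizer_iff.1 ht
    intro y
    constructor
    · rintro ⟨w, hw, rfl⟩
      exact ⟨t * w * t⁻¹, (ht' w).1 hw, rfl⟩
    · rintro ⟨w, hw, hwy⟩
      have : y = ((t⁻¹ * w * t : K) : G) := by
        have e : (w : G) = t * y * (t : G)⁻¹ := hwy
        push_cast
        rw [e]; group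
      rw [this]
      apply (hmem _).2
      apply (ht' _).2
      have e : t * (t⁻¹ * w * t) * t⁻¹ = w := by group
      rw [e]; exact hw
  have hcH : ∀ c : G, (∀ y, c * y = y * c) → c ∈ H := by
    intro c hc
    apply Subgroup.mem_normalizer_iff.2
    intro y
    rw [hc y]; simp
  obtain ⟨τ, hτ⟩ := hsub H hH
  have htxH : (⟨t, htH⟩ : H) * ⟨x, hxH⟩ ≠ ⟨x, hxH⟩ * ⟨t, htH⟩ := by
    intro h
    exact htx (Subtype.ext (congrArg (fun u : H => (u : G)) h))
  have hsc : ∀ c : G, ∀ hc : (∀ y, c * y = y * c), ∃ l : ℂ,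
      (τ ⟨c, hcH c hc⟩).1 = l • (1 : Matrix (Fin 2) (Fin 2) ℂ) := by
    intro c hc
    exact scal2 τ hτ htxH _ (Subtype.ext (hc t)) (Subtype.ext (hc x))
  refine twist_emb χ θ hinj ?_
  intro q hq g l hg hl hgo hlo
  obtain ⟨a, ha⟩ := hsc g hg
  obtain ⟨b, hb⟩ := hsc l hl
  have hpw : ∀ (c : G) (hc : ∀ y, c * y = y * c) (r : ℂ) (n : ℕ),
      (τ ⟨c, hcH c hc⟩).1 = r • (1 : Matrix (Fin 2) (Fin 2) ℂ) → (c ^ n = 1 ↔ r ^ n = 1) := by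
    intro c hc r n h
    have h1 : (τ ((⟨c, hcH c hc⟩ : H) ^ n)).1 = r ^ n • (1 : Matrix (Fin 2) (Fin 2) ℂ) := by
      rw [map_pow, Units.val_pow_eq_pow_val, h, smul_pow, one_pow]
    constructor
    · intro hn
      have h2 : (⟨c, hcH c hc⟩ : H) ^ n = 1 := Subtype.ext hn
      rw [h2, map_one, Units.val_one] at h1
      have := congrFun (congrFun h1 0) 0
      simpa using this.symm
    · intro hn
      rw [hn, one_smul] at h1
      have h2 : (⟨c, hcH c hc⟩ : H) ^ n = 1 := by
        apply hτ
        rw [map_one]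
        exact Units.ext h1
      exact congrArg Subtype.val h2
  have haq : a ^ q = 1 := (hpw g hg a q ha).1 (by rw [← hgo, pow_orderOf_eq_one])
  have hbp : IsPrimitiveRoot b q := by
    have : orderOf b = q := by
      rw [← hlo]
      apply Nat.dvd_antisymm
      · exact orderOf_dvd_of_pow_eq_one ((hpw l hl b _ hb).1 (pow_orderOf_eq_one l))
      · exact orderOf_dvd_of_pow_eq_one ((hpw l hl b _ hb).2 (pow_orderOf_eq_one b))
    rw [← this]
    exact IsPrimitiveRoot.orderOf b
  have : NeZero q := ⟨hq.ne_zero⟩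
  obtain ⟨i, -, hi⟩ := hbp.eq_pow_of_pow_eq_one haq
  refine ⟨i, ?_⟩
  have h5 : (⟨g, hcH g hg⟩ : H) = (⟨l, hcH l hl⟩ : H) ^ i := by
    apply hτ
    apply Units.ext
    rw [map_pow, Units.val_pow_eq_pow_val, ha, hb, smul_pow, one_pow, hi]
  exact congrArg Subtype.val h5

theorem stmt_9 (G : Type*) [Group G] [Finite G] (h : MinFaithful G 3) :
    IsSolvable G := by
  obtain ⟨h1, h2⟩ := h
  have h3 : EmbGL G 3 := by
    have hne : {n : ℕ | ∃ ρ : G →* GL (Fin n) ℂ, Function.Injective ρ}.Nonempty := by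
      apply Nat.nonempty_of_pos_sInf
      show 0 < rdim G
      omega
    have := Nat.sInf_mem hne
    change EmbGL G (rdim G) at this
    rwa [h1] at this
  have hsub : ∀ H : Subgroup G, H ≠ ⊤ → EmbGL H 2 := by
    intro H hH
    have hH3 : EmbGL H 3 := h3.sub H.subtype H.subtype_injective
    have : EmbGL H (rdim H) :=
      Nat.sInf_mem (s := {n : ℕ | ∃ ρ : H →* GL (Fin n) ℂ, Function.Injective ρ}) ⟨3, hH3⟩
    exact this.pad_le (by have := h2 H hH; omega)
  by_contra hns
  have h4 : EmbGL G 2 := core h3 hsub hns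
  have h5 : rdim G ≤ 2 := Nat.sInf_le h4
  omega
end

section
/- Let G be a finite group that is minimally faithful of degree 3, of even order, and whose Sylow 2-subgroups are cyclic. Then there exist distinct odd primes p and q and an integer m ≥ 1 such that G is isomorphic to (C_q ⋊ C_{2^m}) × C_p × C_p, where a generator of the cyclic group C_{2^m} acts on the cyclic group C_q by inversion (g ↦ g⁻¹). -/
lemma aux_embed {H : Type*} [Group H] {n k : ℕ} (hnk : n ≤ k) (ρ : H →* GL (Fin n) ℂ)
    (hρ : Function.Injective ρ) : ∃ ρ' : H →* GL (Fin k) ℂ, Function.Injective ρ' := by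
  obtain ⟨d, rfl⟩ := Nat.exists_eq_add_of_le hnk
  let f : Matrix (Fin n) (Fin n) ℂ →* Matrix (Fin n ⊕ Fin d) (Fin n ⊕ Fin d) ℂ :=
    { toFun := fun A => Matrix.fromBlocks A 0 0 1
      map_one' := by simp
      map_mul' := fun A B => by simp [Matrix.fromBlocks_multiply] }
  have hf : Function.Injective f := by
    intro A B hAB
    exact (Matrix.fromBlocks_inj.1 hAB).1
  let e : Matrix (Fin n ⊕ Fin d) (Fin n ⊕ Fin d) ℂ ≃ₐ[ℂ] Matrix (Fin (n+d)) (Fin (n+d)) ℂ :=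
    Matrix.reindexAlgEquiv ℂ ℂ finSumFinEquiv
  let g : Matrix (Fin n) (Fin n) ℂ →* Matrix (Fin (n+d)) (Fin (n+d)) ℂ :=
    (e : _ →* Matrix (Fin (n+d)) (Fin (n+d)) ℂ).comp f
  have hg : Function.Injective g := fun a b hab => hf (e.injective hab)
  refine ⟨(Units.map g).comp ρ, fun a b hab => hρ ?_⟩
  exact Units.map_injective hg hab

lemma aux_scalar {A B C : Matrix (Fin 2) (Fin 2) ℂ} (h1 : A * B = B * A) (h2 : A * C = C * A)
    (h3 : B * C ≠ C * B) : A = A 0 0 • (1 : Matrix (Fin 2) (Fin 2) ℂ) := by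
  have e1 : A 0 1 * B 1 0 = B 0 1 * A 1 0 := by
    have := congrFun (congrFun h1 0) 0
    simp [Matrix.mul_apply, Fin.sum_univ_two] at this; linear_combination this
  have e2 := congrFun (congrFun h1 0) 1
  have e3 := congrFun (congrFun h1 1) 0
  have f1 : A 0 1 * C 1 0 = C 0 1 * A 1 0 := by
    have := congrFun (congrFun h2 0) 0
    simp [Matrix.mul_apply, Fin.sum_univ_two] at this; linear_combination this
  have f2 := congrFun (congrFun h2 0) 1
  have f3 := congrFun (congrFun h2 1) 0
  simp only [Matrix.mul_apply, Fin.sum_univ_two] at e2 e3 f2 f3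
  have key : ∀ x y z : ℂ, x = B 0 1 * C 1 0 - C 0 1 * B 1 0 →
      y = B 0 1 * (C 1 1 - C 0 0) - C 0 1 * (B 1 1 - B 0 0) →
      z = B 1 0 * (C 1 1 - C 0 0) - C 1 0 * (B 1 1 - B 0 0) →
      ¬ (x = 0 ∧ y = 0 ∧ z = 0) := by
    rintro x y z hx hy hz ⟨rfl, rfl, rfl⟩
    apply h3
    ext i j
    fin_cases i <;> fin_cases j <;> simp [Matrix.mul_apply, Fin.sum_univ_two]
    · linear_combination -hx
    · linear_combination -hy
    · linear_combination hz
    · linear_combination hx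
  have key := key _ _ _ rfl rfl rfl
  -- each of b, c, a - d kills each of x, y, z
  set x := B 0 1 * C 1 0 - C 0 1 * B 1 0 with hx
  set y := B 0 1 * (C 1 1 - C 0 0) - C 0 1 * (B 1 1 - B 0 0) with hy
  set z := B 1 0 * (C 1 1 - C 0 0) - C 1 0 * (B 1 1 - B 0 0) with hz
  have b0 : A 0 1 = 0 ∧ A 1 0 = 0 ∧ A 1 1 - A 0 0 = 0 := by
    grind
  ext i j
  fin_cases i <;> fin_cases j <;> simp
  · exact b0.1
  · exact b0.2.1
  · linear_combination b0.2.2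

lemma aux_trace_int {n : ℕ} {A : Matrix (Fin n) (Fin n) ℂ} {k : ℕ} (hk : 0 < k) (hA : A ^ k = 1) :
    IsIntegral ℤ A.trace := by
  rw [Matrix.trace_eq_sum_roots_charpoly]
  apply IsIntegral.multiset_sum
  intro x hx
  have hx' : x ∈ spectrum ℂ A := Matrix.mem_spectrum_iff_isRoot_charpoly.2 (Polynomial.isRoot_of_mem_roots hx)
  have h2 : x ^ k ∈ spectrum ℂ (A ^ k) := spectrum.pow_mem_pow A k hx'
  rw [hA] at h2
  have : x ^ k = 1 := by
    by_contra hne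
    rw [spectrum.mem_iff] at h2
    apply h2
    have : algebraMap ℂ (Matrix (Fin n) (Fin n) ℂ) (x^k) - 1 = algebraMap ℂ _ (x^k - 1) := by simp
    rw [this]
    exact (IsUnit.mk0 _ (sub_ne_zero.2 hne)).map _
  refine IsIntegral.of_pow hk ?_
  rw [this]; exact isIntegral_one

lemma aux_sum {H : Type*} [Group H] [Fintype H] (hodd : Odd (Nat.card H)) (f : H → ℂ)
    (hf : ∀ h, f h⁻¹ = f h) (hIsInt : ∀ h, IsIntegral ℤ (f h)) :
    ∃ S : ℂ, IsIntegral ℤ S ∧ ∑ h, f h = f 1 + 2 * S := by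
  classical
  have hinv : ∀ h : H, h = h⁻¹ ↔ h = 1 := by
    intro h
    constructor
    · intro hh
      have h2 : h ^ 2 = 1 := by rw [pow_two]; nth_rewrite 1 [hh]; simp
      have := orderOf_dvd_of_pow_eq_one h2
      have h3 := orderOf_dvd_natCard h
      have h4 : orderOf h ∣ Nat.gcd 2 (Nat.card H) := Nat.dvd_gcd this h3
      rw [Nat.Coprime.gcd_eq_one (Nat.coprime_two_left.2 hodd)] at h4
      exact orderOf_eq_one_iff.1 (Nat.dvd_one.1 h4)
    · rintro rfl; simp
  let e := Fintype.equivFin H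
  refine ⟨∑ h, if e h < e h⁻¹ then f h else 0, ?_, ?_⟩
  · apply IsIntegral.sum
    intro h _
    split_ifs
    · exact hIsInt h
    · exact isIntegral_zero
  · have h3 : ∑ h, (if e h⁻¹ < e h then f h else 0) = ∑ h, if e h < e h⁻¹ then f h else 0 := by
      rw [← Equiv.sum_comp (Equiv.inv H)]
      simp [hf]
    have : ∀ h, f h = (if h = 1 then f h else 0) + (if e h < e h⁻¹ then f h else 0)
        + (if e h⁻¹ < e h then f h else 0) := by
      intro h
      rcases lt_trichotomy (e h) (e h⁻¹) with hlt | heq | hgt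
      · have : h ≠ 1 := by rintro rfl; simp at hlt
        simp [this, hlt, hlt.le]
      · have := (hinv h).1 (e.injective heq)
        subst this; simp
      · have : h ≠ 1 := by rintro rfl; simp at hgt
        simp [this, hgt, hgt.le]
    rw [Finset.sum_congr rfl (fun h _ => this h), Finset.sum_add_distrib, Finset.sum_add_distrib, h3]
    simp; ring

lemma aux_odd_comm {H : Type*} [Group H] [Finite H] (hodd : Odd (Nat.card H))
    (ρ : H →* GL (Fin 2) ℂ) (hρ : Function.Injective ρ) (a b : H) : a * b = b * a := by
  classical
  have := Fintype.ofFinite H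
  by_contra hab
  have hab' : (ρ a : Matrix (Fin 2) (Fin 2) ℂ) * ρ b ≠ ρ b * ρ a := by
    intro h
    apply hab
    apply hρ
    rw [map_mul, map_mul]
    exact Units.ext h
  let R : Representation ℂ H (Fin 2 → ℂ) :=
    ((Matrix.toLinAlgEquiv' : Matrix (Fin 2) (Fin 2) ℂ ≃ₐ[ℂ] _) : _ →* Module.End ℂ (Fin 2 → ℂ)).comp
      ((Units.coeHom _).comp ρ)
  have hR : ∀ h, R h = Matrix.toLin' (ρ h : Matrix (Fin 2) (Fin 2) ℂ) := fun h => rfl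
  have hchar : ∀ h, R.character h = (ρ h : Matrix (Fin 2) (Fin 2) ℂ).trace := by
    intro h
    simp [Representation.character, hR]
  have hcard : (Nat.card H : ℂ) ≠ 0 := by simp
  have inst : Invertible (Nat.card H : ℂ) := invertibleOfNonzero hcard
  have h1 := Representation.card_inv_mul_sum_char_mul_char_eq_finrank R R
  have hfin : Module.finrank ℂ (Representation.IntertwiningMap R R) = 1 := by
    apply finrank_eq_one (Representation.IntertwiningMap.id R)
    · intro h
      have := congrArg (fun T => T.toLinearMap (fun _ => 1) 0) h
      simp at this
    · intro T
      let A := LinearMap.toMatrix' T.toLinearMap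
      have hA : ∀ h, A * (ρ h : Matrix (Fin 2) (Fin 2) ℂ) = ρ h * A := by
        intro h
        have := T.isIntertwining' h
        have := congrArg LinearMap.toMatrix' this
        rw [hR, LinearMap.toMatrix'_comp, LinearMap.toMatrix'_comp, LinearMap.toMatrix'_toLin'] at this
        exact this
      have := aux_scalar (hA a) (hA b) hab'
      refine ⟨A 0 0, ?_⟩
      have h2 : T.toLinearMap = A 0 0 • LinearMap.id := by
        rw [← Matrix.toLin'_toMatrix' T.toLinearMap]
        change Matrix.toLin' A = _
        rw [this]; simp [Matrix.toLin'_one]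
      apply Representation.IntertwiningMap.toLinearMap_injective
      exact h2.symm
  rw [hfin] at h1
  obtain ⟨S, hS, hS2⟩ := aux_sum hodd (fun h => R.character h * R.character h⁻¹)
    (fun h => by simp [mul_comm]) (fun h => by
      have : ∀ h, IsIntegral ℤ (R.character h) := by
        intro h
        rw [hchar]
        apply aux_trace_int (k := Nat.card H) Nat.card_pos
        have : (ρ h) ^ Nat.card H = 1 := by rw [← map_pow, pow_card_eq_one', map_one]
        rw [← Units.val_pow_eq_pow_val, this, Units.val_one]
      exact (this _).mul (this _))
  rw [hS2] at h1
  have h1' : (4 : ℂ) + 2 * S = Nat.card H := by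
    simp at h1
    field_simp at h1
    rw [Nat.card_eq_fintype_card, ← h1]; ring
  obtain ⟨k, hk⟩ := hodd
  have hSq : S = algebraMap ℚ ℂ ((2 * k - 3) / 2) := by
    rw [hk] at h1'
    push_cast at h1'
    simp
    linear_combination h1' / 2
  rw [hSq, isIntegral_algebraMap_iff (algebraMap ℚ ℂ).injective, IsIntegrallyClosed.isIntegral_iff] at hS
  obtain ⟨y, hy⟩ := hS
  simp at hy
  have : (2 * y : ℚ) = 2 * k - 3 := by rw [hy]; ring
  have : 2 * y = 2 * k - 3 := by exact_mod_cast this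
  omega

lemma aux_weights {A : Type*} [Group A] [Finite A] (hc : ∀ a b : A, a * b = b * a) {n : ℕ}
    (ρ : A →* GL (Fin n) ℂ) (hρ : Function.Injective ρ) :
    ∃ χ : Fin n → (A →* ℂˣ), (∀ a, (∀ i, χ i a = 1) → a = 1) ∧
      ∀ (T : GL (Fin n) ℂ) (σ : MulAut A), (∀ a, T * ρ a = ρ (σ a) * T) →
        ∀ i, ∃ j, ∀ a, χ i a = χ j (σ a) := by
  classical
  let V := Fin n → ℂ
  let L : Matrix (Fin n) (Fin n) ℂ ≃ₐ[ℂ] Module.End ℂ (Fin n → ℂ) := Matrix.toLinAlgEquiv'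
  let R : A →* Module.End ℂ (Fin n → ℂ) :=
    (L : _ →* Module.End ℂ (Fin n → ℂ)).comp ((Units.coeHom _).comp ρ)
  have hRL : ∀ a, R a = L (ρ a : Matrix (Fin n) (Fin n) ℂ) := fun a => rfl
  have hss : ∀ a, (R a).IsSemisimple := by
    intro a
    apply Module.End.isSemisimple_of_squarefree_aeval_eq_zero
      (p := (Polynomial.X ^ (Nat.card A) - 1 : Polynomial ℂ))
    · apply Polynomial.Separable.squarefree
      have := Polynomial.separable_X_pow_sub_C (F := ℂ) (n := Nat.card A) 1
        (by exact_mod_cast Nat.card_pos.ne') one_ne_zero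
      simpa using this
    · rw [map_sub, map_pow, Polynomial.aeval_X, map_one, ← map_pow, pow_card_eq_one', map_one, sub_self]
  have htop := Module.End.iSup_iInf_maxGenEigenspace_eq_top_of_iSup_maxGenEigenspace_eq_top_of_commute
    (fun a => R a) (fun a b _ => by
      change R a * R b = R b * R a
      rw [← map_mul, hc, map_mul]) (fun a => Module.End.iSup_maxGenEigenspace_eq_top (R a))
  let S : Set (Fin n → ℂ) := {v | ∃ χ : A → ℂ, ∀ a, R a v = χ a • v}
  have hspan : Submodule.span ℂ S = ⊤ := by
    rw [eq_top_iff, ← htop]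
    apply iSup_le
    intro χ v hv
    apply Submodule.subset_span
    refine ⟨χ, fun a => ?_⟩
    rw [Submodule.mem_iInf] at hv
    have := hv a
    rw [(hss a).isFinitelySemisimple.maxGenEigenspace_eq_eigenspace] at this
    exact Module.End.mem_eigenspace_iff.1 this
  obtain ⟨b, hbS, hbspan, hbli⟩ := exists_linearIndependent ℂ S
  rw [hspan] at hbspan
  let B0 : Module.Basis b ℂ (Fin n → ℂ) := Module.Basis.mk hbli (by simp [hbspan])
  have hB0 : ∀ i, B0 i = i := fun i => by simp [B0]
  have : Fintype b := Module.Basis.fintypeIndexOfRankLtAleph0 B0 (Module.rank_lt_aleph0 ℂ _)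
  have hcard : Fintype.card b = n := by
    rw [← Module.finrank_eq_card_basis B0]; simp
  let B : Module.Basis (Fin n) ℂ (Fin n → ℂ) := B0.reindex (Fintype.equivFinOfCardEq hcard)
  have hB : ∀ i, ∃ χ : A → ℂ, ∀ a, R a (B i) = χ a • B i := by
    intro i
    have : B i ∈ S := by
      apply hbS
      simp [B, hB0]
    exact this
  choose χ hχ using hB
  have hone : ∀ i, χ i 1 = 1 := by
    intro i
    have := hχ i 1
    rw [map_one, Module.End.one_apply] at this
    have h2 : (χ i 1 - 1) • B i = 0 := by rw [sub_smul, ← this, one_smul, sub_self]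
    rcases smul_eq_zero.1 h2 with h | h
    · exact sub_eq_zero.1 h
    · exact absurd h (B.ne_zero i)
  have hmul : ∀ i a b, χ i (a * b) = χ i a * χ i b := by
    intro i x y
    have h1 := hχ i (x * y)
    rw [map_mul, Module.End.mul_apply, hχ, map_smul, hχ, smul_smul] at h1
    have h2 : (χ i (x*y) - χ i x * χ i y) • B i = 0 := by
      rw [sub_smul, ← h1, mul_comm, sub_self]
    rcases smul_eq_zero.1 h2 with h | h
    · exact sub_eq_zero.1 h
    · exact absurd h (B.ne_zero i)
  let X : Fin n → (A →* ℂˣ) := fun i => MonoidHom.toHomUnits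
    { toFun := χ i, map_one' := hone i, map_mul' := hmul i }
  have hX : ∀ i a, (X i a : ℂ) = χ i a := fun i a => rfl
  refine ⟨X, ?_, ?_⟩
  · intro a ha
    apply hρ
    rw [map_one]
    apply Units.ext
    apply L.injective
    rw [← hRL, Units.val_one, map_one]
    apply B.ext
    intro i
    rw [hχ, ← hX, ha]; simp
  · intro T σ hT i
    have hTB : L (T : Matrix (Fin n) (Fin n) ℂ) (B i) ≠ 0 := by
      intro h
      have h2 : L ((T⁻¹ : GL (Fin n) ℂ) : Matrix (Fin n) (Fin n) ℂ) (L (T : Matrix (Fin n) (Fin n) ℂ) (B i)) = B i := by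
        rw [← Module.End.mul_apply, ← map_mul, ← Units.val_mul]; simp
      rw [h, map_zero] at h2
      exact B.ne_zero i h2.symm
    set w := L (T : Matrix (Fin n) (Fin n) ℂ) (B i) with hw
    have hrep : ∀ a, R (σ a) w = χ i a • w := by
      intro a
      rw [hw, hRL, ← Module.End.mul_apply, ← map_mul, ← Units.val_mul, ← hT, Units.val_mul, map_mul,
        Module.End.mul_apply, ← hRL, hχ, map_smul]
    have : ∃ j, B.repr w j ≠ 0 := by
      by_contra hcon
      push Not at hcon
      apply hTB
      apply B.repr.injective
      ext j; simpa using hcon j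
    obtain ⟨j, hj⟩ := this
    refine ⟨j, fun a => ?_⟩
    apply Units.ext
    rw [hX, hX]
    have hcoord : ∀ a, B.repr (R a w) j = χ j a * B.repr w j := by
      intro a
      have : (B.coord j).comp (R a) = χ j a • B.coord j := by
        apply B.ext
        intro k
        simp [hχ, Finsupp.single_apply]
        split_ifs with h <;> simp [h]
      simpa using congrArg (fun l => l w) this
    have := hcoord (σ a)
    rw [hrep] at this
    simp at this
    exact (this.resolve_right hj)

lemma aux_two {A : Type*} [Group A] [Finite A] (hc : ∀ a b : A, a * b = b * a)
    (ρ : A →* GL (Fin 2) ℂ) (hρ : Function.Injective ρ) :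
    ∃ α β : A →* ℂˣ, ∀ a, α a = 1 → β a = 1 → a = 1 := by
  obtain ⟨χ, h, -⟩ := aux_weights hc ρ hρ
  refine ⟨χ 0, χ 1, fun a h0 h1 => h a ?_⟩
  intro i; fin_cases i <;> assumption

lemma aux_odd_pow {K : Type*} [Group K] {x : K} {c k : ℕ} (hc : Odd c) (h1 : x ^ c = 1)
    (h2 : x ^ (2 ^ k) = 1) : x = 1 := by
  have h4 := Nat.dvd_gcd (orderOf_dvd_of_pow_eq_one h1) (orderOf_dvd_of_pow_eq_one h2)
  rw [Nat.Coprime.gcd_eq_one (Nat.Coprime.pow_right _ (Nat.coprime_two_right.2 hc))] at h4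
  exact orderOf_eq_one_iff.1 (Nat.dvd_one.1 h4)

lemma aux_three {A : Type*} [Group A] [Finite A] (hc : ∀ a b : A, a * b = b * a)
    (hodd : Odd (Nat.card A))
    (ρ : A →* GL (Fin 3) ℂ) (hρ : Function.Injective ρ) (σ : MulAut A) (m : ℕ)
    (hσ : σ ^ (2 ^ m) = 1) (T : GL (Fin 3) ℂ) (hT : ∀ a, T * ρ a = ρ (σ a) * T) :
    (∀ a, σ (σ a) = a) ∧ ∃ χ : A →* ℂˣ, ∀ a, σ a = a⁻¹ → χ a = 1 → a = 1 := by
  classical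
  obtain ⟨χ, hsep, hperm⟩ := aux_weights hc ρ hρ
  have hperm := hperm T σ hT
  let W : Finset (A →* ℂˣ) := Finset.univ.image χ
  have hW3 : Fintype.card W ≤ 3 := by
    rw [Fintype.card_coe]
    exact Finset.card_image_le.trans (by simp)
  have hex : ∀ ψ : W, ∃ ψ' : W, ∀ a, ψ.1 a = ψ'.1 (σ a) := by
    rintro ⟨ψ, hψ⟩
    obtain ⟨i, -, rfl⟩ := Finset.mem_image.1 hψ
    obtain ⟨j, hj⟩ := hperm i
    exact ⟨⟨χ j, Finset.mem_image_of_mem _ (Finset.mem_univ _)⟩, hj⟩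
  choose f hf using hex
  have finj : Function.Injective f := by
    intro x y hxy
    apply Subtype.ext
    ext a
    rw [hf x, hf y, hxy]
  let π : Equiv.Perm W := Equiv.ofBijective f (Finite.injective_iff_bijective.1 finj)
  have hπ : ∀ ψ : W, ∀ a, ψ.1 a = (π ψ).1 (σ a) := hf
  have hπk : ∀ k : ℕ, ∀ ψ : W, ∀ a, ψ.1 a = ((π ^ k) ψ).1 ((σ ^ k) a) := by
    intro k
    induction k with
    | zero => simp
    | succ k ih =>
      intro ψ a
      rw [pow_succ', pow_succ', Equiv.Perm.mul_apply, MulAut.mul_apply, ← hπ, ← ih]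
  have hπm : π ^ (2 ^ m) = 1 := by
    ext1 ψ
    apply Subtype.ext
    ext a
    have := hπk (2 ^ m) ψ a
    rw [hσ] at this
    exact congrArg Units.val this.symm
  have hπ2 : π ^ 2 = 1 := by
    have h1 : orderOf π ∣ 2 ^ m := orderOf_dvd_of_pow_eq_one hπm
    have h2 : orderOf π ∣ 6 := by
      have := orderOf_dvd_card (x := π)
      rw [Fintype.card_perm] at this
      exact this.trans (Nat.factorial_dvd_factorial hW3)
    have h3 : orderOf π ∣ 2 := by
      have h4 : (2 ^ m).Coprime 3 := Nat.Coprime.pow_left _ (by norm_num)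
      exact (Nat.Coprime.coprime_dvd_left h1 h4).dvd_of_dvd_mul_right (show _ ∣ 2 * 3 from h2)
    exact orderOf_dvd_iff_pow_eq_one.1 h3
  have hππ : ∀ ψ, π (π ψ) = ψ := fun ψ => by
    have := congrArg (fun p => p ψ) hπ2
    simpa [pow_two] using this
  have hsepW : ∀ a, (∀ ψ : W, ψ.1 a = 1) → a = 1 := fun a ha =>
    hsep a fun i => ha ⟨χ i, Finset.mem_image_of_mem _ (Finset.mem_univ _)⟩
  have hoddA : ∀ (ψ : A →* ℂˣ) a, σ a = a⁻¹ → ψ (σ a) = ψ a → ψ a = 1 := by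
    intro ψ a h1 h2
    rw [h1, map_inv] at h2
    apply aux_odd_pow (k := 1) hodd
    · rw [← map_pow, pow_card_eq_one', map_one]
    · rw [pow_one, pow_two]; nth_rewrite 1 [← h2]; simp
  constructor
  · intro a
    have : σ (σ a) * a⁻¹ = 1 := by
      apply hsepW
      intro ψ
      rw [map_mul, map_inv, mul_inv_eq_one, hπ ψ a, hπ (π ψ), hππ]
    exact mul_inv_eq_one.1 this
  · by_cases hall : ∀ ψ, π ψ = ψ
    · refine ⟨1, fun a ha _ => hsepW a fun ψ => ?_⟩
      apply hoddA ψ.1 a ha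
      conv_rhs => rw [hπ ψ a, hall]
    · push Not at hall
      obtain ⟨ψ0, h0⟩ := hall
      refine ⟨ψ0.1, fun a ha ha1 => hsepW a fun ψ => ?_⟩
      by_cases h1 : ψ = ψ0
      · rw [h1, ha1]
      by_cases h2 : ψ = π ψ0
      · have := hπ ψ0 a
        rw [ha1, ← h2, ha, map_inv] at this
        simpa using this.symm
      by_cases h3 : π ψ = ψ
      · apply hoddA ψ.1 a ha
        conv_rhs => rw [hπ ψ a, h3]
      exfalso
      have : ({ψ0, π ψ0, ψ, π ψ} : Finset W).card = 4 := by
        have e1 : ψ0 ≠ π ψ := fun h => h2 (by rw [h, hππ])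
        have e2 : π ψ0 ≠ π ψ := fun h => h1 (π.injective h).symm
        rw [Finset.card_insert_of_notMem, Finset.card_insert_of_notMem,
          Finset.card_insert_of_notMem, Finset.card_singleton]
        · simpa using fun h => h3 h.symm
        · simp only [Finset.mem_insert, Finset.mem_singleton, not_or]; exact ⟨fun h => h2 h.symm, e2⟩
        · simp only [Finset.mem_insert, Finset.mem_singleton, not_or]; exact ⟨fun h => h0 h.symm, fun h => h1 h.symm, e1⟩
      have h4 := Finset.card_le_univ ({ψ0, π ψ0, ψ, π ψ} : Finset W)
      omega

lemma aux_ext {G K : Type*} [Group G] [Group K] [Finite G] (N P : Subgroup G) [N.Normal]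
    (hNP : N.IsComplement' P) (hodd : Odd (Nat.card N)) (t : G) (htP : t ∈ P)
    (ht : ∀ x ∈ P, ∃ k : ℕ, x = t ^ k) (m : ℕ) (htm : orderOf t = 2 ^ m)
    (D : N →* K) (hD : Function.Injective D) (M : K) (hM : orderOf M = 2 ^ m)
    (hconj : ∀ n : N, D (MulAut.conjNormal t n) = M * D n * M⁻¹) :
    ∃ ρ : G →* K, Function.Injective ρ := by
  let t' : P := ⟨t, htP⟩
  have ht' : ∀ x : P, ∃ k : ℕ, x = t' ^ k := by
    rintro ⟨x, hx⟩
    obtain ⟨k, rfl⟩ := ht x hx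
    exact ⟨k, Subtype.ext rfl⟩
  have hto : orderOf t' = orderOf M := by rw [hM, ← htm]; exact Subgroup.orderOf_mk t htP
  have hz : ∀ x : P, x ∈ Subgroup.zpowers t' := by
    intro x
    obtain ⟨k, rfl⟩ := ht' x
    exact Subgroup.npow_mem_zpowers _ _
  let F : P →* K := monoidHomOfForallMemZpowers hz (g' := M) (dvd_of_eq hto.symm)
  have hF : F t' = M := monoidHomOfForallMemZpowers_apply_gen hz _
  let e := SemidirectProduct.mulEquivSubgroup hNP
  have hh : ∀ g : P, D.comp (((N.normalizerMonoidHom).comp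
      (Subgroup.inclusion (N.normalizer_eq_top ▸ le_top))) g).toMonoidHom =
      (MulAut.conj (F g)).toMonoidHom.comp D := by
    have key : ∀ k : ℕ, ∀ n : N, D (MulAut.conjNormal (t ^ k) n) = M ^ k * D n * (M ^ k)⁻¹ := by
      intro k
      induction k with
      | zero => simp
      | succ k ih =>
        intro n
        rw [pow_succ', pow_succ', map_mul, MulAut.mul_apply, hconj, ih]
        group
    intro g
    obtain ⟨k, rfl⟩ := ht' g
    ext n
    change D _ = F (t' ^ k) * D n * (F (t' ^ k))⁻¹
    rw [map_pow F, hF, ← key]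
    congr 1
  let Φ := SemidirectProduct.lift D F hh
  refine ⟨Φ.comp e.symm.toMonoidHom, ?_⟩
  refine Function.Injective.comp (g := Φ) ?_ e.symm.injective
  rw [injective_iff_map_eq_one]
  rintro ⟨n, g⟩ hx
  have hx : D n * F g = 1 := hx
  have h1 : D n = 1 := by
    apply aux_odd_pow (k := m) hodd
    · rw [← map_pow, pow_card_eq_one', map_one]
    · rw [mul_eq_one_iff_eq_inv.1 hx]
      obtain ⟨k, rfl⟩ := ht' g
      rw [map_pow, hF, inv_pow, ← pow_mul, mul_comm, pow_mul, ← hM, pow_orderOf_eq_one]; simp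
  rw [h1, one_mul] at hx
  have h2 : n = 1 := hD (by rw [h1, map_one])
  obtain ⟨k, rfl⟩ := ht' g
  rw [map_pow, hF, ← orderOf_dvd_iff_pow_eq_one, ← hto, orderOf_dvd_iff_pow_eq_one] at hx
  rw [h2, hx]; rfl

lemma aux_cyclic {A : Type*} [Group A] [Finite A] (hc : ∀ a b : A, a * b = b * a)
    (h : ∀ p : ℕ, p.Prime → Nat.card {a : A // a ^ p = 1} ≤ p) : IsCyclic A := by
  classical
  have := Fintype.ofFinite A
  have key : ∀ n : ℕ, 0 < n → (Finset.univ.filter fun a : A => a ^ n = 1).card ≤ n := by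
    intro n
    induction n using Nat.recOnMul with
    | zero => intro h0; omega
    | one => intro _; rw [Finset.card_le_one]; intro a ha b hb; simp at ha hb; rw [ha, hb]
    | prime p hp =>
      intro _
      have := h p hp
      rwa [Nat.card_eq_fintype_card, Fintype.card_subtype] at this
    | mul a b iha ihb =>
      intro hab
      have ha : 0 < a := Nat.pos_of_mul_pos_right hab
      have hb : 0 < b := Nat.pos_of_mul_pos_left hab
      refine (Finset.card_le_mul_card_image_of_maps_to (f := fun x : A => x ^ a)
        (t := Finset.univ.filter fun y : A => y ^ b = 1) ?_ a ?_).trans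
          (Nat.mul_le_mul_left a (ihb hb))
      · intro x hx
        simp only [Finset.mem_filter, Finset.mem_univ, true_and] at hx ⊢
        rw [← pow_mul, hx]
      · intro y hy
        rcases Finset.eq_empty_or_nonempty ((Finset.univ.filter fun x : A => x ^ (a * b) = 1).filter
          fun x => x ^ a = y) with he | ⟨x0, hx0⟩
        · rw [he]; simp
        · refine le_trans ?_ (iha ha)
          apply Finset.card_le_card_of_injOn (fun x => x * x0⁻¹)
          · intro x hx
            simp only [Finset.coe_filter, Finset.mem_filter, Finset.mem_univ, true_and,
              Set.mem_ofPred_eq] at hx hx0 ⊢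
            rw [Commute.mul_pow (hc _ _), inv_pow, hx.2, hx0.2, mul_inv_cancel]
          · intro x _ y _ hxy
            exact mul_right_cancel hxy
  exact isCyclic_of_card_pow_eq_one_le key

lemma aux_zmod_pow {n : ℕ} [NeZero n] (x : Multiplicative (ZMod n)) :
    ∃ k : ℕ, x = (Multiplicative.ofAdd (1 : ZMod n)) ^ k := by
  refine ⟨(Multiplicative.toAdd x).val, ?_⟩
  rw [← ofAdd_nsmul]
  simp

lemma aux_zmodHom {M : Type*} [Group M] {n : ℕ} [NeZero n] (g : M) (hg : g ^ n = 1) :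
    ∃ f : Multiplicative (ZMod n) →* M, f (Multiplicative.ofAdd 1) = g := by
  have hz : ∀ x : Multiplicative (ZMod n),
      x ∈ Subgroup.zpowers (Multiplicative.ofAdd (1 : ZMod n)) := by
    intro x
    obtain ⟨k, rfl⟩ := aux_zmod_pow x
    exact Subgroup.npow_mem_zpowers _ _
  have ho : orderOf (Multiplicative.ofAdd (1 : ZMod n)) = n := by
    rw [orderOf_ofAdd_eq_addOrderOf, ZMod.addOrderOf_one]
  have hd : orderOf g ∣ orderOf (Multiplicative.ofAdd (1 : ZMod n)) := by
    rw [ho]; exact orderOf_dvd_of_pow_eq_one hg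
  exact ⟨monoidHomOfForallMemZpowers hz hd, monoidHomOfForallMemZpowers_apply_gen hz hd⟩

lemma aux_diag {A : Type*} [Group A] (α β : A →* ℂˣ) : ∃ D : A →* GL (Fin 2) ℂ,
    ∀ a, (D a : Matrix (Fin 2) (Fin 2) ℂ) = !![(α a : ℂ), 0; 0, (β a : ℂ)] := by
  refine ⟨MonoidHom.toHomUnits
    { toFun := fun a => !![(α a : ℂ), 0; 0, (β a : ℂ)]
      map_one' := by simp [Matrix.one_fin_two]
      map_mul' := fun a b => by simp }, fun a => rfl⟩

lemma aux_diag_inj {A : Type*} [Group A] {α β : A →* ℂˣ}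
    (hinj : ∀ a, α a = 1 → β a = 1 → a = 1) (D : A →* GL (Fin 2) ℂ)
    (hD : ∀ a, (D a : Matrix (Fin 2) (Fin 2) ℂ) = !![(α a : ℂ), 0; 0, (β a : ℂ)]) :
    Function.Injective D := by
  rw [injective_iff_map_eq_one]
  intro a ha
  have h1 := hD a
  rw [ha, Units.val_one] at h1
  apply hinj
  · have := congrFun (congrFun h1 0) 0
    simp at this
    exact Units.ext this.symm
  · have := congrFun (congrFun h1 1) 1
    simp at this
    exact Units.ext this.symm

lemma aux_root (k : ℕ) : ∃ ζ : ℂˣ, orderOf ζ = 2 ^ k := by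
  have h := Complex.isPrimitiveRoot_exp (2 ^ k) (by positivity)
  exact ⟨(h.isUnit (by positivity)).unit, by
    rw [← orderOf_units, IsUnit.unit_spec]; exact h.eq_orderOf.symm⟩

lemma aux_M1 (k : ℕ) : ∃ M : GL (Fin 2) ℂ, orderOf M = 2 ^ k ∧ ∀ X : GL (Fin 2) ℂ, M * X = X * M := by
  obtain ⟨ζ, hζ⟩ := aux_root k
  let F : ℂˣ →* GL (Fin 2) ℂ := Units.map (algebraMap ℂ (Matrix (Fin 2) (Fin 2) ℂ) : ℂ →* _)
  have hF : Function.Injective F := Units.map_injective (algebraMap ℂ (Matrix (Fin 2) (Fin 2) ℂ)).injective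
  refine ⟨F ζ, by rw [orderOf_injective F hF, hζ], fun X => Units.ext ?_⟩
  exact Algebra.commutes _ _

lemma aux_M2 (k : ℕ) : ∃ (M : GL (Fin 2) ℂ) (c : ℂ), orderOf M = 2 ^ (k + 1) ∧
    (M : Matrix (Fin 2) (Fin 2) ℂ) = !![0, 1; c, 0] := by
  obtain ⟨ζ, hζ⟩ := aux_root k
  let F : ℂˣ →* GL (Fin 2) ℂ := Units.map (algebraMap ℂ (Matrix (Fin 2) (Fin 2) ℂ) : ℂ →* _)
  have hF : Function.Injective F := Units.map_injective (algebraMap ℂ (Matrix (Fin 2) (Fin 2) ℂ)).injective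
  let M : GL (Fin 2) ℂ := ⟨!![0, 1; (ζ : ℂ), 0], !![0, ((ζ⁻¹ : ℂˣ) : ℂ); 1, 0],
    by simp [Matrix.one_fin_two], by simp [Matrix.one_fin_two]⟩
  have hM2 : M ^ 2 = F ζ := by
    apply Units.ext
    rw [pow_two]
    ext i j
    fin_cases i <;> fin_cases j <;> simp [M, F, Matrix.algebraMap_matrix_apply]
  have hFo : orderOf (F ζ) = 2 ^ k := by rw [orderOf_injective F hF, hζ]
  refine ⟨M, ζ, ?_, rfl⟩
  apply orderOf_eq_prime_pow (p := 2)
  · rcases k with _ | j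
    · intro h
      have := congrArg (fun X : GL (Fin 2) ℂ => (X : Matrix (Fin 2) (Fin 2) ℂ) 0 0) h
      simp [M] at this
    · rw [pow_succ', pow_mul, hM2, ← orderOf_dvd_iff_pow_eq_one, hFo]
      intro h
      have := (Nat.pow_dvd_pow_iff_le_right (by norm_num : 1 < 2)).1 h
      omega
  · rw [pow_succ', pow_mul, hM2, ← hFo, pow_orderOf_eq_one]

lemma aux_cyc_char {A : Type*} [Group A] [Finite A] [IsCyclic A] :
    ∃ l : A →* ℂˣ, Function.Injective l := by
  have hne : NeZero (Nat.card A) := ⟨Nat.card_pos.ne'⟩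
  have hcard : Nat.card A = Nat.card (rootsOfUnity (Nat.card A) ℂ) := by
    rw [Complex.card_rootsOfUnity]
  let e := mulEquivOfCyclicCardEq hcard
  exact ⟨(Subgroup.subtype _).comp e.toMonoidHom, fun a b hab => e.injective (Subtype.ext hab)⟩

/-- The map to `μ_p × μ_p`. -/
lemma aux_mup {A : Type*} [Group A] {α β : A →* ℂˣ}
    (hinj : ∀ a, α a = 1 → β a = 1 → a = 1) (B : Subgroup A) (p : ℕ) (hB : ∀ b ∈ B, b ^ p = 1) :
    ∃ j : B →* rootsOfUnity p ℂ × rootsOfUnity p ℂ, Function.Injective j := by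
  let a' : B →* rootsOfUnity p ℂ := (α.comp B.subtype).codRestrict _ (fun b => by
    rw [mem_rootsOfUnity, ← map_pow]
    have : b ^ p = 1 := Subtype.ext (hB b b.2)
    rw [this, map_one])
  let b' : B →* rootsOfUnity p ℂ := (β.comp B.subtype).codRestrict _ (fun b => by
    rw [mem_rootsOfUnity, ← map_pow]
    have : b ^ p = 1 := Subtype.ext (hB b b.2)
    rw [this, map_one])
  refine ⟨a'.prod b', ?_⟩
  rw [injective_iff_map_eq_one]
  intro x hx
  have h1 := congrArg Prod.fst hx
  have h2 := congrArg Prod.snd hx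
  exact Subtype.ext (hinj x (congrArg Subtype.val h1) (congrArg Subtype.val h2))


set_option maxHeartbeats 2000000 in
lemma aux_core (G : Type*) [Group G] [Finite G] (ρ3 : G →* GL (Fin 3) ℂ)
    (hρ3 : Function.Injective ρ3) (hno : ¬ ∃ ρ : G →* GL (Fin 2) ℂ, Function.Injective ρ)
    (hsub : ∀ H : Subgroup G, H ≠ ⊤ → ∃ ρ : H →* GL (Fin 2) ℂ, Function.Injective ρ)
    (N P : Subgroup G) [N.Normal]
    (hNP : N.IsComplement' P) (hodd : Odd (Nat.card N)) (t : G) (htP : t ∈ P)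
    (ht : ∀ x ∈ P, ∃ k : ℕ, x = t ^ k) (m : ℕ) (hm : 1 ≤ m) (htm : orderOf t = 2 ^ m)
    (hPm : Nat.card P = 2 ^ m) :
    ∃ p q m : ℕ, p.Prime ∧ q.Prime ∧ Odd p ∧ Odd q ∧ p ≠ q ∧ 1 ≤ m ∧
      ∃ φ : Multiplicative (ZMod (2 ^ m)) →* MulAut (Multiplicative (ZMod q)),
        (∀ g : Multiplicative (ZMod q), φ (Multiplicative.ofAdd 1) g = g⁻¹) ∧
        Nonempty (G ≃* ((Multiplicative (ZMod q) ⋊[φ] Multiplicative (ZMod (2 ^ m))) ×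
          Multiplicative (ZMod p) × Multiplicative (ZMod p))) := by
  classical
  have htpow : t ^ (2 ^ m) = 1 := by rw [← htm, pow_orderOf_eq_one]
  have hNtop : N ≠ ⊤ := by
    rintro rfl
    rw [Subgroup.card_top] at hodd
    have h1 : 2 ∣ Nat.card G := by
      have := orderOf_dvd_natCard t
      rw [htm] at this
      exact (dvd_pow_self 2 (by omega)).trans this
    exact (Nat.not_even_iff_odd.2 hodd) (even_iff_two_dvd.2 h1)
  obtain ⟨ρN, hρN⟩ := hsub N hNtop
  have hc : ∀ a b : N, a * b = b * a := aux_odd_comm hodd ρN hρN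
  obtain ⟨α, β, hαβ⟩ := aux_two hc ρN hρN
  let σ : MulAut N := MulAut.conjNormal t
  have hσc : ∀ n : N, ((σ n : N) : G) = t * n * t⁻¹ := fun n => MulAut.conjNormal_apply t n
  have hσm : σ ^ (2 ^ m) = 1 := by rw [← map_pow, htpow, map_one]
  obtain ⟨hσσ, χ, hχ⟩ := aux_three hc hodd (ρ3.comp N.subtype)
    (hρ3.comp N.subtype_injective) σ m hσm (ρ3 t) (fun a => by
      simp only [MonoidHom.comp_apply, Subgroup.coe_subtype, hσc, ← map_mul]
      congr 1; group)
  have hsq : ∀ {K : Type} [Group K] (f : N →* K) (n : N), f n ^ 2 = 1 → f n = 1 := by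
    intro K _ f n hn
    apply aux_odd_pow (k := 1) hodd
    · rw [← map_pow, pow_card_eq_one', map_one]
    · rwa [pow_one]
  have hsq' : ∀ n : N, n * n = 1 → n = 1 := by
    intro n hn
    apply aux_odd_pow (k := 1) hodd
    · rw [pow_card_eq_one']
    · rwa [pow_one, pow_two]
  -- the inverted part is nontrivial
  have hz0 : ∃ z0 : N, σ z0 = z0⁻¹ ∧ z0 ≠ 1 := by
    by_contra hcon
    push Not at hcon
    have hσ1 : ∀ n, σ n = n := by
      intro n
      have := hcon (σ n * n⁻¹) (by rw [map_mul, hσσ, map_inv, mul_inv_rev, inv_inv])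
      exact mul_inv_eq_one.1 this
    obtain ⟨D, hD⟩ := aux_diag α β
    obtain ⟨M, hM, hMc⟩ := aux_M1 m
    apply hno
    refine aux_ext N P hNP hodd t htP ht m htm D (aux_diag_inj hαβ D hD) M hM ?_
    intro n
    change D (σ n) = _
    rw [hσ1, hMc, mul_inv_cancel_right]
  obtain ⟨z0, hz0σ, hz01⟩ := hz0
  obtain ⟨q, hq, hqd⟩ := Nat.exists_prime_and_dvd (n := orderOf z0) (by rwa [Ne, orderOf_eq_one_iff])
  obtain ⟨z, hzσ, hzq⟩ : ∃ z : N, σ z = z⁻¹ ∧ orderOf z = q := by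
    refine ⟨z0 ^ (orderOf z0 / q), by rw [map_pow, hz0σ, inv_pow], ?_⟩
    exact orderOf_pow_orderOf_div (orderOf_pos z0).ne' hqd
  have hz1 : z ≠ 1 := by rw [Ne, ← orderOf_eq_one_iff, hzq]; exact hq.one_lt.ne'
  have hqN : q ∣ Nat.card N := hzq ▸ orderOf_dvd_natCard z
  have hqodd : Odd q := Odd.of_dvd_nat hodd hqN
  -- the centralized part is not cyclic
  let Np : Subgroup N :=
    { carrier := {n | σ n = n}
      one_mem' := map_one σ
      mul_mem' := fun {a b} ha hb => by
        change σ (a * b) = a * b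
        rw [map_mul, show σ a = a from ha, show σ b = b from hb]
      inv_mem' := fun {a} ha => by
        change σ a⁻¹ = a⁻¹
        rw [map_inv, show σ a = a from ha] }
  have hNpmem : ∀ n, n ∈ Np ↔ σ n = n := fun n => Iff.rfl
  have hNp : ¬ IsCyclic Np := by
    intro hcyc
    obtain ⟨l, hl⟩ := aux_cyc_char (A := Np)
    have hmemNp : ∀ n, n * σ n ∈ Np := fun n => by
      rw [hNpmem, map_mul, hσσ, hc]
    let l' : N →* ℂˣ :=
      { toFun := fun n => l ⟨n * σ n, hmemNp n⟩
        map_one' := by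
          rw [← map_one l]; congr 1; apply Subtype.ext; simp
        map_mul' := fun a b => by
          rw [← map_mul l]; congr 1; apply Subtype.ext
          simp only [map_mul, Subgroup.coe_mul]
          rw [mul_assoc, mul_assoc, ← mul_assoc b, hc b (σ a), mul_assoc] }
    let χ' : N →* ℂˣ :=
      { toFun := fun n => χ n * (χ (σ n))⁻¹
        map_one' := by simp
        map_mul' := fun a b => by simp only [map_mul, mul_inv]; exact mul_mul_mul_comm _ _ _ _ }
    have hl'σ : ∀ n, l' (σ n) = l' n := by
      intro n
      change l _ = l _
      congr 1; apply Subtype.ext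
      change σ n * σ (σ n) = n * σ n
      rw [hσσ, hc]
    have hχ'σ : ∀ n, χ' (σ n) = (χ' n)⁻¹ := by
      intro n
      change χ (σ n) * (χ (σ (σ n)))⁻¹ = (χ n * (χ (σ n))⁻¹)⁻¹
      rw [hσσ, mul_inv, inv_inv, mul_comm]
    obtain ⟨D, hD⟩ := aux_diag (χ' * l') (χ'⁻¹ * l')
    have hinj : ∀ a, (χ' * l') a = 1 → (χ'⁻¹ * l') a = 1 → a = 1 := by
      intro a h1 h2
      rw [MonoidHom.mul_apply] at h1 h2
      rw [MonoidHom.inv_apply] at h2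
      have hla : l' a = 1 := by
        apply hsq
        calc l' a ^ 2 = (χ' a * l' a) * ((χ' a)⁻¹ * l' a) := by
              rw [mul_mul_mul_comm, mul_inv_cancel, one_mul, pow_two]
          _ = 1 := by rw [h1, h2, one_mul]
      rw [hla, mul_one] at h1
      have h3 : (⟨a * σ a, hmemNp a⟩ : Np) = 1 := by
        apply hl
        rw [map_one]; exact hla
      have h4 : a * σ a = 1 := congrArg Subtype.val h3
      have h5 : σ a = a⁻¹ := (inv_eq_of_mul_eq_one_right h4).symm
      have h6 : χ a * (χ (σ a))⁻¹ = 1 := h1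
      rw [h5, map_inv, inv_inv, ← pow_two] at h6
      exact hχ a h5 (hsq χ a h6)
    obtain ⟨k, rfl⟩ : ∃ k, m = k + 1 := ⟨m - 1, by omega⟩
    obtain ⟨M, c, hM, hMc⟩ := aux_M2 k
    apply hno
    refine aux_ext N P hNP hodd t htP ht (k + 1) htm D (aux_diag_inj hinj D hD) M hM ?_
    intro n
    rw [eq_mul_inv_iff_mul_eq]
    change D (σ n) * M = M * D n
    apply Units.ext
    rw [Units.val_mul, Units.val_mul, hD, hD, hMc]
    simp only [MonoidHom.mul_apply, MonoidHom.inv_apply, hl'σ, hχ'σ, inv_inv]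
    generalize ((χ' n * l' n : ℂˣ) : ℂ) = u
    generalize (((χ' n)⁻¹ * l' n : ℂˣ) : ℂ) = v
    simp [mul_comm]
  have hp : ∃ p : ℕ, p.Prime ∧ p < Nat.card {a : Np // a ^ p = 1} := by
    by_contra hcon
    push Not at hcon
    exact hNp (aux_cyclic (fun a b => Subtype.ext (hc a b)) hcon)
  obtain ⟨p, hp, hpcard⟩ := hp
  have hNE : NeZero p := ⟨hp.ne_zero⟩
  have hNEq : NeZero q := ⟨hq.ne_zero⟩
  let A : Subgroup N :=
    { carrier := {n | σ n = n ∧ n ^ p = 1}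
      one_mem' := ⟨map_one σ, one_pow _⟩
      mul_mem' := fun {a b} ha hb => by
        refine ⟨?_, ?_⟩
        · rw [map_mul, ha.1, hb.1]
        · rw [Commute.mul_pow (hc _ _), ha.2, hb.2, one_mul]
      inv_mem' := fun {a} ha => by
        refine ⟨?_, ?_⟩
        · rw [map_inv, ha.1]
        · rw [inv_pow, ha.2, inv_one] }
  have hAmem : ∀ n, n ∈ A ↔ σ n = n ∧ n ^ p = 1 := fun n => Iff.rfl
  have hμ : Nat.card (rootsOfUnity p ℂ × rootsOfUnity p ℂ) = p ^ 2 := by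
    rw [Nat.card_prod, Complex.card_rootsOfUnity, pow_two]
  have hAgt : p < Nat.card A := by
    refine lt_of_lt_of_le hpcard ?_
    apply Nat.card_le_card_of_injective
      (fun x : {a : Np // a ^ p = 1} => (⟨x.1.1, x.1.2, by
        have := congrArg Subtype.val x.2
        exact this⟩ : A))
    intro x y hxy
    exact Subtype.ext (Subtype.ext (congrArg (fun w : A => (w : N)) hxy))
  obtain ⟨j, hj⟩ := aux_mup hαβ A p (fun b hb => hb.2)
  have hAcard : Nat.card A = p ^ 2 := by
    have h1 := Subgroup.card_dvd_of_injective j hj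
    rw [hμ] at h1
    obtain ⟨i, hi, hi2⟩ := (Nat.dvd_prime_pow hp).1 h1
    interval_cases i
    · rw [pow_zero] at hi2; have := hp.one_lt; omega
    · rw [pow_one] at hi2; omega
    · exact hi2
  have hpN : p ^ 2 ∣ Nat.card N := hAcard ▸ Subgroup.card_subgroup_dvd_card A
  have hpodd : Odd p := Odd.of_dvd_nat hodd ((dvd_pow_self p two_ne_zero).trans hpN)
  have hpq : p ≠ q := by
    rintro rfl
    let B : Subgroup N :=
      { carrier := {n | n ^ p = 1}
        one_mem' := one_pow _
        mul_mem' := fun {a b} ha hb => by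
          change (a * b) ^ p = 1
          rw [Commute.mul_pow (hc _ _), show a ^ p = 1 from ha, show b ^ p = 1 from hb, one_mul]
        inv_mem' := fun {a} ha => by
          change a⁻¹ ^ p = 1
          rw [inv_pow, show a ^ p = 1 from ha, inv_one] }
    obtain ⟨j', hj'⟩ := aux_mup hαβ B p (fun b hb => hb)
    have h1 : Nat.card B ≤ Nat.card A := by
      rw [hAcard, ← hμ]
      exact Nat.card_le_card_of_injective j' hj'
    have hAB : A ≤ B := fun x hx => hx.2
    have h2 : A = B := Subgroup.eq_of_le_of_card_ge hAB h1
    have hzB : z ∈ B := by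
      change z ^ p = 1
      rw [← hzq, pow_orderOf_eq_one]
    rw [← h2, hAmem, hzσ] at hzB
    apply hz1
    apply hsq'
    nth_rewrite 1 [← hzB.1]
    simp
  have hjbij : Function.Bijective j :=
    hj.bijective_of_nat_card_le (by rw [hμ, hAcard])
  -- identify `A` with `C_p × C_p`
  have eμ : Nonempty (Multiplicative (ZMod p) ≃* rootsOfUnity p ℂ) := by
    refine ⟨mulEquivOfCyclicCardEq ?_⟩
    rw [Complex.card_rootsOfUnity, Nat.card_congr Multiplicative.toAdd, Nat.card_zmod]
  obtain ⟨eμ⟩ := eμ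
  let eA : Multiplicative (ZMod p) × Multiplicative (ZMod p) ≃* A :=
    (MulEquiv.prodCongr eμ eμ).trans (MulEquiv.ofBijective j hjbij).symm
  let fA : Multiplicative (ZMod p) × Multiplicative (ZMod p) →* G :=
    (N.subtype.comp A.subtype).comp eA.toMonoidHom
  -- the semidirect part
  let invq : MulAut (Multiplicative (ZMod q)) := MulEquiv.inv (Multiplicative (ZMod q))
  have hinvq : ∀ g, invq g = g⁻¹ := fun g => rfl
  have hinv2 : invq ^ (2 ^ m) = 1 := by
    obtain ⟨k, rfl⟩ : ∃ k, m = k + 1 := ⟨m - 1, by omega⟩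
    have : invq ^ 2 = 1 := by
      ext1 g
      rw [pow_two, MulAut.mul_apply, hinvq, hinvq, inv_inv]; rfl
    rw [pow_succ', pow_mul, this, one_pow]
  obtain ⟨φ, hφ⟩ := aux_zmodHom invq hinv2
  obtain ⟨fz, hfz⟩ := aux_zmodHom (n := q) (z : G) (by
    have : z ^ q = 1 := by rw [← hzq, pow_orderOf_eq_one]
    exact_mod_cast congrArg Subtype.val this)
  obtain ⟨ft, hft⟩ := aux_zmodHom (n := 2 ^ m) t htpow
  have htz : t * (z : G) * t⁻¹ = (z : G)⁻¹ := by
    rw [← hσc, hzσ]; rfl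
  have hbase : ∀ x, fz x⁻¹ = t * fz x * t⁻¹ := by
    intro x
    obtain ⟨k, rfl⟩ := aux_zmod_pow x
    rw [map_inv, map_pow, hfz, ← conj_pow, htz, inv_pow]
  have hlift : ∀ g, fz.comp (φ g).toMonoidHom = (MulAut.conj (ft g)).toMonoidHom.comp fz := by
    have key : ∀ k : ℕ, ∀ x, fz ((invq ^ k) x) = t ^ k * fz x * (t ^ k)⁻¹ := by
      intro k
      induction k with
      | zero => simp
      | succ k ih =>
        intro x
        rw [pow_succ', pow_succ', MulAut.mul_apply, hinvq, hbase, ih]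
        group
    intro g
    obtain ⟨k, rfl⟩ := aux_zmod_pow g
    refine MonoidHom.ext fun x => ?_
    change fz (φ (_ ^ k) x) = ft (_ ^ k) * fz x * (ft (_ ^ k))⁻¹
    rw [map_pow φ, hφ, map_pow ft, hft, key]
  let F1 := SemidirectProduct.lift fz ft hlift
  have hF1z : F1 (SemidirectProduct.inl (Multiplicative.ofAdd 1)) = z := by
    rw [SemidirectProduct.lift_inl, hfz]
  have hF1t : F1 (SemidirectProduct.inr (Multiplicative.ofAdd 1)) = t := by
    rw [SemidirectProduct.lift_inr, hft]
  have hcommAz : ∀ a : A, Commute (z : G) ((a : N) : G) := fun a => by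
    have := hc z a
    exact congrArg (fun w : N => (w : G)) this
  have hcommAt : ∀ a : A, Commute t ((a : N) : G) := fun a => by
    have := hσc a
    rw [a.2.1] at this
    exact (eq_mul_inv_iff_mul_eq.1 this).symm
  have hcomm : ∀ x y, Commute (F1 x) (fA y) := by
    rintro ⟨x, g⟩ y
    obtain ⟨k, rfl⟩ := aux_zmod_pow x
    obtain ⟨i, rfl⟩ := aux_zmod_pow g
    change Commute (fz (_ ^ k) * ft (_ ^ i)) _
    rw [map_pow, map_pow, hfz, hft]
    exact ((hcommAz (eA y)).pow_left k).mul_left ((hcommAt (eA y)).pow_left i)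
  let f := MonoidHom.noncommCoprod F1 fA hcomm
  have hf : ∀ x y, f (x, y) = F1 x * fA y := fun x y => rfl
  have hzR : (z : G) ∈ f.range := ⟨(_, 1), by rw [hf, hF1z, map_one, mul_one]⟩
  have htR : t ∈ f.range := ⟨(_, 1), by rw [hf, hF1t, map_one, mul_one]⟩
  have hAR : ∀ a : A, ((a : N) : G) ∈ f.range := fun a => ⟨(1, eA.symm a), by
    rw [hf, map_one, one_mul]
    change ((eA (eA.symm a) : N) : G) = _
    rw [MulEquiv.apply_symm_apply]⟩
  have hrange : f.range = ⊤ := by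
    by_contra hne
    obtain ⟨ρ, hρ⟩ := hsub f.range hne
    let z' : f.range := ⟨z, hzR⟩
    let t' : f.range := ⟨t, htR⟩
    have hzt : (ρ z' : Matrix (Fin 2) (Fin 2) ℂ) * ρ t' ≠ ρ t' * ρ z' := by
      intro h
      have h1 : z' * t' = t' * z' := by
        apply hρ
        rw [map_mul, map_mul]
        exact Units.ext h
      have h2 : (z : G) * t = t * z := congrArg Subtype.val h1
      apply hz1
      apply hsq'
      apply Subtype.ext
      rw [← h2, mul_inv_cancel_right] at htz
      change (z : G) * z = 1
      nth_rewrite 1 [htz]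
      simp
    let ι : A →* f.range := (N.subtype.comp A.subtype).codRestrict _ hAR
    have hι : Function.Injective ι := fun a b hab =>
      Subtype.ext (Subtype.ext (congrArg (fun w : f.range => (w : G)) hab))
    have hsc : ∀ a : A, (ρ (ι a) : Matrix (Fin 2) (Fin 2) ℂ) =
        (ρ (ι a) : Matrix (Fin 2) (Fin 2) ℂ) 0 0 • (1 : Matrix (Fin 2) (Fin 2) ℂ) := by
      intro a
      apply aux_scalar (B := ρ z') (C := ρ t') _ _ hzt
      · rw [← Units.val_mul, ← Units.val_mul, ← map_mul, ← map_mul]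
        congr 2
        exact Subtype.ext (hcommAz a).symm
      · rw [← Units.val_mul, ← Units.val_mul, ← map_mul, ← map_mul]
        congr 2
        exact Subtype.ext (hcommAt a).symm
    have hle : Nat.card A ≤ Nat.card (Polynomial.nthRootsFinset p (1 : ℂ)) := by
      apply Nat.card_le_card_of_injective (fun a : A =>
        (⟨(ρ (ι a) : Matrix (Fin 2) (Fin 2) ℂ) 0 0, by
          rw [Polynomial.mem_nthRootsFinset hp.pos]
          have h1 : a ^ p = 1 := Subtype.ext a.2.2
          have h2 : (ρ (ι a) : Matrix (Fin 2) (Fin 2) ℂ) ^ p = 1 := by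
            rw [← Units.val_pow_eq_pow_val, ← map_pow, ← map_pow, h1, map_one, map_one, Units.val_one]
          rw [hsc a, smul_pow, one_pow] at h2
          have := congrFun (congrFun h2 0) 0
          simpa using this⟩ : Polynomial.nthRootsFinset p (1 : ℂ)))
      intro a b hab
      have hab := congrArg Subtype.val hab
      dsimp only at hab
      apply hι
      apply hρ
      apply Units.ext
      rw [hsc a, hsc b, hab]
    have h2 : Nat.card (Polynomial.nthRootsFinset p (1 : ℂ)) ≤ p := by
      rw [Nat.card_eq_fintype_card, Fintype.card_coe]
      exact (Multiset.toFinset_card_le _).trans (Polynomial.card_nthRoots p 1)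
    omega
  refine ⟨p, q, m, hp, hq, hpodd, hqodd, hpq, hm, φ, fun g => by rw [hφ, hinvq], ?_⟩
  have hsurj : Function.Surjective f := MonoidHom.range_eq_top.1 hrange
  have hcardle : Nat.card ((Multiplicative (ZMod q) ⋊[φ] Multiplicative (ZMod (2 ^ m))) ×
          Multiplicative (ZMod p) × Multiplicative (ZMod p)) ≤ Nat.card G := by
    have hzc : ∀ n : ℕ, Nat.card (Multiplicative (ZMod n)) = n := fun n => by
      rw [Nat.card_congr Multiplicative.toAdd, Nat.card_zmod]
    rw [Nat.card_prod, SemidirectProduct.card, Nat.card_prod, hzc, hzc, hzc, ← hNP.card_mul_card, hPm]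
    have h1 : p ^ 2 * q ∣ Nat.card N :=
      Nat.Coprime.mul_dvd_of_dvd_of_dvd
        (Nat.Coprime.pow_left _ ((Nat.coprime_primes hp hq).2 hpq)) hpN hqN
    have h2 := Nat.le_of_dvd Nat.card_pos h1
    calc q * 2 ^ m * (p * p) = (p ^ 2 * q) * 2 ^ m := by ring
      _ ≤ _ := Nat.mul_le_mul_right _ h2
  have : Finite ((Multiplicative (ZMod q) ⋊[φ] Multiplicative (ZMod (2 ^ m)))) :=
    Finite.of_equiv _ SemidirectProduct.equivProd.symm
  exact ⟨(MulEquiv.ofBijective f (hsurj.bijective_of_nat_card_le hcardle)).symm⟩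

theorem stmt_10 (G : Type*) [Group G] [Finite G] (h : MinFaithful G 3)
    (heven : Even (Nat.card G)) (hsyl : ∀ P : Sylow 2 G, IsCyclic P) :
    ∃ p q m : ℕ, p.Prime ∧ q.Prime ∧ Odd p ∧ Odd q ∧ p ≠ q ∧ 1 ≤ m ∧
      ∃ φ : Multiplicative (ZMod (2 ^ m)) →* MulAut (Multiplicative (ZMod q)),
        (∀ g : Multiplicative (ZMod q), φ (Multiplicative.ofAdd 1) g = g⁻¹) ∧
        Nonempty (G ≃* ((Multiplicative (ZMod q) ⋊[φ] Multiplicative (ZMod (2 ^ m))) ×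
          Multiplicative (ZMod p) × Multiplicative (ZMod p))) := by
  obtain ⟨h3, hlt⟩ := h
  have hne : {n : ℕ | ∃ ρ : G →* GL (Fin n) ℂ, Function.Injective ρ}.Nonempty := by
    by_contra hcon
    rw [Set.not_nonempty_iff_eq_empty] at hcon
    rw [rdim, hcon, Nat.sInf_empty] at h3
    omega
  obtain ⟨ρ3, hρ3⟩ : ∃ ρ : G →* GL (Fin 3) ℂ, Function.Injective ρ := by
    have := Nat.sInf_mem hne
    rw [show sInf {n : ℕ | ∃ ρ : G →* GL (Fin n) ℂ, Function.Injective ρ} = 3 from h3] at this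
    exact this
  have hno : ¬ ∃ ρ : G →* GL (Fin 2) ℂ, Function.Injective ρ := by
    intro hex
    have : rdim G ≤ 2 := Nat.sInf_le hex
    omega
  have hsub : ∀ H : Subgroup G, H ≠ ⊤ → ∃ ρ : H →* GL (Fin 2) ℂ, Function.Injective ρ := by
    intro H hH
    have h1 := hlt H hH
    have hneH : {n : ℕ | ∃ ρ : H →* GL (Fin n) ℂ, Function.Injective ρ}.Nonempty :=
      ⟨3, ρ3.comp H.subtype, hρ3.comp H.subtype_injective⟩
    obtain ⟨ρ, hρ⟩ := Nat.sInf_mem hneH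
    exact aux_embed (Nat.le_of_lt_succ h1) ρ hρ
  have h2 : Fact (Nat.Prime 2) := ⟨Nat.prime_two⟩
  let P : Sylow 2 G := default
  have hP := hsyl P
  have hmin : (Nat.card G).minFac = 2 := (Nat.minFac_eq_two_iff _).2 (even_iff_two_dvd.1 heven)
  have hNP := IsCyclic.isComplement' hmin hP
  have hodd : Odd (Nat.card (MonoidHom.transferSylow P (hP.normalizer_le_centralizer hmin)).ker) := by
    rw [← Nat.not_even_iff_odd, even_iff_two_dvd, ← hNP.index_eq_card]
    exact P.not_dvd_index
  obtain ⟨m, hPm⟩ := P.2.exists_card_eq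
  have hm : 1 ≤ m := by
    by_contra hm0
    have : m = 0 := by omega
    subst this
    have h4 := P.card_mul_index
    rw [hPm, pow_zero, one_mul] at h4
    apply P.not_dvd_index
    rw [h4]
    exact even_iff_two_dvd.1 heven
  obtain ⟨⟨t, htP⟩, htgen⟩ := hP.exists_generator
  have ht : ∀ x ∈ (P : Subgroup G), ∃ k : ℕ, x = t ^ k := by
    intro x hx
    have := htgen ⟨x, hx⟩
    rw [← mem_powers_iff_mem_zpowers] at this
    obtain ⟨k, hk⟩ := this
    exact ⟨k, (congrArg Subtype.val hk).symm⟩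
  have hto : orderOf t = 2 ^ m := by
    have := orderOf_eq_card_of_forall_mem_zpowers htgen
    rw [hPm] at this
    rw [← this]
    exact (Subgroup.orderOf_mk t htP).symm
  exact aux_core G ρ3 hρ3 hno hsub _ P hNP hodd t htP ht m hm hto hPm
end
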